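/- Let G = ⟨h₁, …, h_m⟩ be a rational semigroup satisfying: G satisfies the open set condition with an open set U with respect to the generator system {h₁, …, h_m}; UH(G) ∩ J(G) is a finite set; UH(G) ∩ J(G) ⊂ U; and either m ≥ 2 and G contains an element of degree two or greater, or m = 1 and J(G) ≠ ℂ̂. If UH(G) ∩ J(G) ≠ ∅, then for each point z ∈ UH(G) ∩ J(G) there exists an element h ∈ G such that z is a parabolic fixed point of h; furthermore, the stabilizer { β ∈ G : β(z) = z } equals { g_z^n : n ∈ ℕ } for some g_z ∈ G for which z is a parabolic fixed point. -/

import Mathlib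

open Set Metric Topology Filter MeasureTheory

noncomputable section

/-- The Riemann sphere `ℂ̂`, as a type synonym of the one-point compactification
`Option ℂ = OnePoint ℂ` of `ℂ`, equipped below with the spherical metric
(induced by a stereographic-type embedding into `ℂ × ℝ`). -/
def CSphere : Type := Option ℂ

namespace CSphere

/-- The point at infinity of the Riemann sphere. -/
def infty : CSphere := (none : Option ℂ)

/-- The inclusion of `ℂ` into the Riemann sphere. -/
def ofC (z : ℂ) : CSphere := (some z : Option ℂ)

/-- A stereographic-type embedding of the Riemann sphere into `ℂ × ℝ`,
used to induce the spherical metric. -/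
def embed (z : CSphere) : ℂ × ℝ :=
  Option.rec ((0 : ℂ), (1 : ℝ))
    (fun w => ((2 / (1 + ‖w‖ ^ 2)) • w, (‖w‖ ^ 2 - 1) / (‖w‖ ^ 2 + 1))) z

@[simp] lemma embed_infty : embed infty = ((0 : ℂ), (1 : ℝ)) := rfl

@[simp] lemma embed_ofC (w : ℂ) :
    embed (ofC w) = (((2 / (1 + ‖w‖ ^ 2)) • w : ℂ), (‖w‖ ^ 2 - 1) / (‖w‖ ^ 2 + 1)) := rfl

lemma cases' (z : CSphere) : z = infty ∨ ∃ w : ℂ, z = ofC w :=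
  Option.rec (Or.inl rfl) (fun w => Or.inr ⟨w, rfl⟩) z

lemma embed_inj : Function.Injective embed := by
  intro a b h
  rcases cases' a with rfl | ⟨v, rfl⟩ <;> rcases cases' b with rfl | ⟨w, rfl⟩
  · rfl
  · exfalso
    have h2 := congrArg Prod.snd h
    simp only [embed_infty, embed_ofC] at h2
    have hw : (0:ℝ) < ‖w‖ ^ 2 + 1 := by positivity
    rw [eq_div_iff (by nlinarith : (‖w‖ ^ 2 + 1 : ℝ) ≠ 0)] at h2
    nlinarith
  · exfalso
    have h2 := congrArg Prod.snd h
    simp only [embed_infty, embed_ofC] at h2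
    have hv : (0:ℝ) < ‖v‖ ^ 2 + 1 := by positivity
    rw [div_eq_iff (by nlinarith : (‖v‖ ^ 2 + 1 : ℝ) ≠ 0)] at h2
    nlinarith
  · have h2 := congrArg Prod.snd h
    simp only [embed_ofC] at h2
    have hv : (0:ℝ) < ‖v‖ ^ 2 + 1 := by positivity
    have hw : (0:ℝ) < ‖w‖ ^ 2 + 1 := by positivity
    have hnorm : ‖v‖ ^ 2 = ‖w‖ ^ 2 := by
      rw [div_eq_div_iff (by nlinarith : (‖v‖ ^ 2 + 1 : ℝ) ≠ 0)
        (by nlinarith : (‖w‖ ^ 2 + 1 : ℝ) ≠ 0)] at h2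
      nlinarith
    have h1 := congrArg Prod.fst h
    simp only [embed_ofC, hnorm] at h1
    have hc : (2 / (1 + ‖w‖ ^ 2) : ℝ) ≠ 0 := by positivity
    exact congrArg ofC (smul_right_injective ℂ hc h1)

/-- The spherical metric on the Riemann sphere. -/
instance : MetricSpace CSphere := MetricSpace.induced embed embed_inj inferInstance

instance : MeasurableSpace CSphere := borel CSphere

instance : BorelSpace CSphere := ⟨rfl⟩

/-- The self-map of the Riemann sphere induced by a pair of polynomials `p, q`,
i.e. the rational map `z ↦ p(z)/q(z)`. -/
def ratLift (p q : Polynomial ℂ) (z : CSphere) : CSphere :=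
  Option.rec
    (if q.natDegree < p.natDegree then infty
     else if p.natDegree < q.natDegree then ofC 0
     else ofC (p.leadingCoeff / q.leadingCoeff))
    (fun w => if q.eval w = 0 then infty else ofC (p.eval w / q.eval w)) z

/-- `φ` is the rational map on the Riemann sphere determined by the coprime
pair of polynomials `(p, q)` with `q ≠ 0`. -/
def IsRatPair (p q : Polynomial ℂ) (φ : CSphere → CSphere) : Prop :=
  q ≠ 0 ∧ IsCoprime p q ∧ φ = ratLift p q

/-- `φ` is a rational map of degree `n` on the Riemann sphere. -/
def ratDegEq (φ : CSphere → CSphere) (n : ℕ) : Prop :=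
  ∃ p q : Polynomial ℂ, IsRatPair p q φ ∧ max p.natDegree q.natDegree = n

/-- `φ` is a rational map on the Riemann sphere (constants allowed). -/
def IsRatMap (φ : CSphere → CSphere) : Prop := ∃ n, ratDegEq φ n

/-- `φ` is a Möbius transformation of the Riemann sphere. -/
def IsMobius (φ : CSphere → CSphere) : Prop := ratDegEq φ 1

/-- `φ` is a non-constant rational map on the Riemann sphere. -/
def IsNonconstRatMap (φ : CSphere → CSphere) : Prop := ∃ n, 1 ≤ n ∧ ratDegEq φ n

/-- `φ` is a rational map of degree at least two. -/
def IsRatMapDegGeTwo (φ : CSphere → CSphere) : Prop := ∃ n, 2 ≤ n ∧ ratDegEq φ n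

end CSphere

/-- For a proper holomorphic map `g : V → B`, "`deg (g : V → B) ≤ N`":
every point of `B` has at most `N` preimages in `V`.  (For proper holomorphic
maps this is equivalent to the degree, counted with multiplicity, being `≤ N`,
since a generic point has `deg` distinct preimages.) -/
def degLe {α β : Type*} (gmap : α → β) (V : Set α) (B : Set β) (N : ℕ) : Prop :=
  ∀ w ∈ B, (V ∩ gmap ⁻¹' {w}).ncard ≤ N

/-- `K` is `C`-uniformly perfect: `K` has at least two points, and every round
annulus `{z | r < dist a z < R}` disjoint from `K` which separates `K`
has modulus `log (R/r) / (2π) < C`.  (By Teichmüller's theorem this round-annulus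
formulation is equivalent to the formulation with arbitrary separating ring domains.) -/
def UnifPerfect {α : Type*} [MetricSpace α] (K : Set α) (C : ℝ) : Prop :=
  K.Nontrivial ∧ ∀ (a : α) (r R : ℝ), 0 < r → r < R →
    (∀ z ∈ K, dist a z ≤ r ∨ R ≤ dist a z) →
    (K ∩ {z | dist a z ≤ r}).Nonempty →
    (K ∩ {z | R ≤ dist a z}).Nonempty →
    Real.log (R / r) < 2 * Real.pi * C

/-- `J` is `k`-porous: every ball `B(x,r)` centred on `J` contains a ball of
radius `k r` disjoint from `J`. -/
def kPorous {α : Type*} [MetricSpace α] (J : Set α) (k : ℝ) : Prop :=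
  ∀ x ∈ J, ∀ r > (0:ℝ), ∃ y, Metric.ball y (k * r) ⊆ Metric.ball x r \ J

/-- `J` is `k`-porous inside the subspace `A`: for every `x ∈ J` and `r > 0`
there is a relative ball in `A` of radius `k r` inside `B(x,r) ∩ A` missing `J`. -/
def kPorousIn {α : Type*} [MetricSpace α] (A J : Set α) (k : ℝ) : Prop :=
  ∀ x ∈ J, ∀ r > (0:ℝ), ∃ y ∈ A, A ∩ Metric.ball y (k * r) ⊆ (A ∩ Metric.ball x r) \ J

/-- Minimal number of balls of radius `r` needed to cover `s`. -/
def coverNum {α : Type*} [MetricSpace α] (s : Set α) (r : ℝ) : ℕ∞ :=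
  sInf {n : ℕ∞ | ∃ t : Finset α, (t.card : ℕ∞) = n ∧ s ⊆ ⋃ y ∈ t, Metric.ball y r}

/-- The upper box (Minkowski) dimension of a (bounded) set. -/
def upperBoxDim {α : Type*} [MetricSpace α] (s : Set α) : ℝ :=
  Filter.limsup (fun r : ℝ => Real.log ((coverNum s r).toNat : ℝ) / Real.log (1 / r))
    (𝓝[>] (0:ℝ))

/-- The norm of the derivative of `φ` at `z` with respect to the metrics of the
source and target (for a holomorphic map between spheres with their spherical
metrics, this is the usual spherical derivative `‖φ′(z)‖`). -/
def sphDeriv {α β : Type*} [MetricSpace α] [MetricSpace β] (φ : α → β) (z : α) : ℝ :=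
  Filter.limsup (fun w => dist (φ w) (φ z) / dist w z) (𝓝[≠] z)

/-- The derivative of `φ` along `S` vanishes at `z` (i.e. `z` is a critical point
with `φ′(z) = 0`, expressed metrically). -/
def critPtOn {α β : Type*} [MetricSpace α] [MetricSpace β] (φ : α → β) (S : Set α)
    (z : α) : Prop :=
  Filter.Tendsto (fun w => dist (φ w) (φ z) / dist w z) (𝓝[S \ {z}] z) (𝓝 0)

end
noncomputable section

open Set Metric Topology Filter MeasureTheory
open scoped ENNReal NNReal

/-- `G` is a rational semigroup: a set of non-constant rational self-maps of the
Riemann sphere closed under composition. -/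
def RatSemigroup (G : Set (CSphere → CSphere)) : Prop :=
  (∀ a ∈ G, ∀ b ∈ G, a ∘ b ∈ G) ∧ ∀ a ∈ G, CSphere.IsNonconstRatMap a

/-- The semigroup (under composition) generated by a set `S` of self-maps. -/
def genSet (S : Set (CSphere → CSphere)) : Set (CSphere → CSphere) :=
  {gm | ∃ l : List (CSphere → CSphere), l ≠ [] ∧ (∀ a ∈ l, a ∈ S) ∧
    gm = l.foldr (· ∘ ·) id}

/-- The rational semigroup `⟨h₁, …, h_m⟩` generated by finitely many maps. -/
def genFin {m : ℕ} (h : Fin m → CSphere → CSphere) : Set (CSphere → CSphere) :=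
  genSet (Set.range h)

/-- `H` is a subsemigroup of `G`. -/
def IsSubsemigroupOf (H G : Set (CSphere → CSphere)) : Prop :=
  H.Nonempty ∧ H ⊆ G ∧ ∀ a ∈ H, ∀ b ∈ H, a ∘ b ∈ H

/-- The Fatou set `F(G)` of a rational semigroup: the set of points having a
neighbourhood on which the family `G` is (uniformly) equicontinuous —
equivalently (by the Arzelà–Ascoli theorem, since `ℂ̂` is compact), normal. -/
def rsFatou (G : Set (CSphere → CSphere)) : Set CSphere :=
  {z | ∃ r > (0:ℝ), ∀ ε > (0:ℝ), ∃ δ > (0:ℝ), ∀ gm ∈ G,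
    ∀ w₁ ∈ ball z r, ∀ w₂ ∈ ball z r, dist w₁ w₂ < δ → dist (gm w₁) (gm w₂) < ε}

/-- The Julia set `J(G) = ℂ̂ \ F(G)`. -/
def rsJulia (G : Set (CSphere → CSphere)) : Set CSphere := (rsFatou G)ᶜ

/-- The set of exceptional points `E(G)`: points whose backward orbit contains
at most two points. -/
def rsE (G : Set (CSphere → CSphere)) : Set CSphere :=
  {z | ∃ a b : CSphere, {w | ∃ gm ∈ G, gm w = z} ⊆ {a, b}}

/-- `SH_N(G)`: the set of semi-hyperbolic points of degree `N` for the rational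
semigroup `G`. -/
def rsSHN (G : Set (CSphere → CSphere)) (N : ℕ) : Set CSphere :=
  {z | ∃ δ > (0:ℝ), ∀ gm ∈ G, ∀ y ∈ gm ⁻¹' ball z δ,
    degLe gm (connectedComponentIn (gm ⁻¹' ball z δ) y) (ball z δ) N}

/-- `UH(G) = ℂ̂ \ ⋃_N SH_N(G)`. -/
def rsUH (G : Set (CSphere → CSphere)) : Set CSphere := (⋃ N : ℕ, rsSHN G N)ᶜ

/-- `G = ⟨h₁, …, h_m⟩` satisfies the (backward) open set condition with the
open set `U` with respect to the generator system `h`. -/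
def OpenSetCond {m : ℕ} (h : Fin m → CSphere → CSphere) (U : Set CSphere) : Prop :=
  U.Nonempty ∧ IsOpen U ∧ (∀ j, h j ⁻¹' U ⊆ U) ∧
    Pairwise fun i j => Disjoint (h i ⁻¹' U) (h j ⁻¹' U)

/-- `μ` is a `δ`-subconformal measure for `G`. -/
def Subconformal (G : Set (CSphere → CSphere)) (δ : ℝ)
    (μ : MeasureTheory.Measure CSphere) : Prop :=
  ∀ gm ∈ G, ∀ A : Set CSphere, MeasurableSet A →
    μ (gm '' A) ≤ ∫⁻ z in A, ENNReal.ofReal (sphDeriv gm z ^ δ) ∂μ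

/-- `s(G)`: the infimum of exponents `δ ≥ 0` admitting a `δ`-subconformal
probability measure for `G`. -/
def sExp (G : Set (CSphere → CSphere)) : ℝ :=
  sInf {δ : ℝ | 0 ≤ δ ∧ ∃ μ : MeasureTheory.Measure CSphere,
    MeasureTheory.IsProbabilityMeasure μ ∧ Subconformal G δ μ}

/-- The Poincaré series `S(s, x) = ∑_{g ∈ G} ∑_{g(y) = x} ‖g′(y)‖^{-s}`. -/
def Ssum (G : Set (CSphere → CSphere)) (s : ℝ) (x : CSphere) : ℝ≥0∞ :=
  ∑' gm : G, ∑' y : ((gm : CSphere → CSphere) ⁻¹' {x}),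
    ENNReal.ofReal (sphDeriv (gm : CSphere → CSphere) (y : CSphere) ^ (-s))

/-- `s₀(G) = inf_x S(x) = inf {s | ∃ x, S(s, x) < ∞}`. -/
def s0Exp (G : Set (CSphere → CSphere)) : ℝ :=
  sInf {s : ℝ | ∃ x : CSphere, Ssum G s x < ⊤}

/-- The conical Julia set `J_con(G)` of a rational semigroup. -/
def rsJcon (G : Set (CSphere → CSphere)) : Set CSphere :=
  {z | z ∈ rsJulia G ∧ ∃ (N : ℕ) (r : ℝ), 0 < r ∧ ∀ ε > (0:ℝ), ∃ gm ∈ G,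
    gm z ∈ rsJulia G ∧
    Metric.diam (connectedComponentIn (gm ⁻¹' ball (gm z) r) z) ≤ ε ∧
    SimplyConnectedSpace ↥(connectedComponentIn (gm ⁻¹' ball (gm z) r) z) ∧
    degLe gm (connectedComponentIn (gm ⁻¹' ball (gm z) r) z) (ball (gm z) r) N}

/-- The rational map `z ↦ 1/z` on the Riemann sphere. -/
def sphInv : CSphere → CSphere := CSphere.ratLift 1 Polynomial.X

/-- The (complex) derivative of `h` at a fixed point `z` equals `d`, computed in
the affine chart at `z` (the chart `w ↦ 1/w` if `z = ∞`). -/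
def derivFixEq (h : CSphere → CSphere) (z : CSphere) (d : ℂ) : Prop :=
  (∃ zc : ℂ, z = CSphere.ofC zc ∧ ∃ Floc : ℂ → ℂ,
      (∀ᶠ w in 𝓝 zc, CSphere.ofC (Floc w) = h (CSphere.ofC w)) ∧
      HasDerivAt Floc d zc) ∨
  (z = CSphere.infty ∧ ∃ Floc : ℂ → ℂ,
      (∀ᶠ w in 𝓝 (0:ℂ), CSphere.ofC (Floc w) = sphInv (h (sphInv (CSphere.ofC w)))) ∧
      HasDerivAt Floc d 0)

/-- `z` is a parabolic fixed point of `h`: `h(z) = z` and `h′(z)` is a root of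
unity. -/
def IsParabolicFixPt (h : CSphere → CSphere) (z : CSphere) : Prop :=
  h z = z ∧ ∃ d : ℂ, derivFixEq h z d ∧ ∃ n : ℕ, 0 < n ∧ d ^ n = 1

/-- `φ` is an elliptic Möbius transformation: a Möbius map with a fixed point
whose multiplier has modulus one and is different from `1`. -/
def IsEllipticMobius (φ : CSphere → CSphere) : Prop :=
  CSphere.IsMobius φ ∧ ∃ (z : CSphere) (d : ℂ), φ z = z ∧ derivFixEq φ z d ∧
    ‖d‖ = 1 ∧ d ≠ 1

end
noncomputable section
open Set Metric Topology Filter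
namespace CSphere

def toC (x : CSphere) : ℂ := Option.rec 0 (fun w => w) x
@[simp] lemma toC_ofC (w : ℂ) : toC (ofC w) = w := rfl
@[simp] lemma toC_infty : toC infty = 0 := rfl
lemma ofC_ne (w : ℂ) : ofC w ≠ infty := by intro h; cases h
lemma ofC_inj : Function.Injective ofC := fun a b h => by
  have := congrArg toC h; simpa using this
lemma ofC_toC {x : CSphere} (h : x ≠ infty) : ofC (toC x) = x := by
  rcases cases' x with rfl | ⟨w, rfl⟩
  · exact absurd rfl h
  · rfl

lemma isom_embed : Isometry embed := fun _ _ => rfl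
lemma cont_ofC : Continuous ofC := by
  rw [isom_embed.isEmbedding.continuous_iff]
  have : embed ∘ ofC = fun w : ℂ => (((2 / (1 + ‖w‖ ^ 2)) • w : ℂ), (‖w‖ ^ 2 - 1) / (‖w‖ ^ 2 + 1)) := rfl
  rw [this]
  have h1 : Continuous fun w : ℂ => (2 / (1 + ‖w‖ ^ 2) : ℝ) :=
    Continuous.div (by fun_prop) (by fun_prop) fun x => by positivity
  have h2 : Continuous fun w : ℂ => ((‖w‖ ^ 2 - 1) / (‖w‖ ^ 2 + 1) : ℝ) :=
    Continuous.div (by fun_prop) (by fun_prop) fun x => by positivity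
  exact (h1.smul continuous_id).prodMk h2

lemma toC_eq (x : CSphere) : toC x = (embed x).1 / ((1 - (embed x).2 : ℝ) : ℂ) := by
  rcases cases' x with rfl | ⟨w, rfl⟩
  · simp
  · have h : (1 - (embed (ofC w)).2 : ℝ) = 2 / (1 + ‖w‖ ^ 2) := by
      have : (0:ℝ) < 1 + ‖w‖ ^ 2 := by positivity
      have : (0:ℝ) < ‖w‖ ^ 2 + 1 := by positivity
      simp only [embed_ofC]; field_simp; ring
    rw [h, embed_ofC, toC_ofC]
    have h2 : ((2 / (1 + ‖w‖ ^ 2) : ℝ) : ℂ) ≠ 0 := by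
      have : (2 / (1 + ‖w‖ ^ 2) : ℝ) ≠ 0 := by positivity
      exact_mod_cast this
    simp only [Complex.real_smul]
    rw [mul_div_cancel_left₀ _ h2]

lemma contAt_toC {x : CSphere} (h : x ≠ infty) : ContinuousAt toC x := by
  have e : toC = fun x => (embed x).1 / ((1 - (embed x).2 : ℝ) : ℂ) := funext toC_eq
  rw [e]
  have ce : Continuous embed := isom_embed.continuous
  refine ContinuousAt.div ce.fst.continuousAt ?_ ?_
  · exact (Complex.continuous_ofReal.comp (continuous_const.sub ce.snd)).continuousAt
  · rcases cases' x with rfl | ⟨w, rfl⟩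
    · exact absurd rfl h
    · have : (1 - (embed (ofC w)).2 : ℝ) ≠ 0 := by
        simp only [embed_ofC]
        have h1 : (0:ℝ) < ‖w‖ ^ 2 + 1 := by positivity
        rw [sub_ne_zero, ne_eq, eq_div_iff h1.ne']
        intro h; linarith
      exact_mod_cast this

lemma ofC_image (s : Set ℂ) : ofC '' s = {infty}ᶜ ∩ toC ⁻¹' s := by
  ext x; constructor
  · rintro ⟨w, hw, rfl⟩; exact ⟨ofC_ne w, hw⟩
  · rintro ⟨h1, h2⟩; exact ⟨_, h2, ofC_toC h1⟩

lemma isOpen_ofC {s : Set ℂ} (h : IsOpen s) : IsOpen (ofC '' s) := by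
  rw [ofC_image]
  refine ContinuousOn.isOpen_inter_preimage (fun x hx => (contAt_toC hx).continuousWithinAt) ?_ h
  exact isOpen_compl_singleton

lemma sphInv_ofC {w : ℂ} (h : w ≠ 0) : sphInv (ofC w) = ofC (1 / w) := by
  show (if (Polynomial.X : Polynomial ℂ).eval w = 0 then infty else
    ofC ((1 : Polynomial ℂ).eval w / (Polynomial.X : Polynomial ℂ).eval w)) = _
  simp [h]
@[simp] lemma sphInv_zero : sphInv (ofC 0) = infty := by
  show (if (Polynomial.X : Polynomial ℂ).eval 0 = 0 then infty else _) = _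
  simp
@[simp] lemma sphInv_infty : sphInv infty = ofC 0 := by
  show (if (Polynomial.X : Polynomial ℂ).natDegree < (1 : Polynomial ℂ).natDegree then infty
     else if (1 : Polynomial ℂ).natDegree < (Polynomial.X : Polynomial ℂ).natDegree then ofC 0
     else _) = _
  simp
@[simp] lemma sphInv_sphInv (x : CSphere) : sphInv (sphInv x) = x := by
  rcases cases' x with rfl | ⟨w, rfl⟩
  · simp
  · by_cases h : w = 0
    · simp [h]
    · rw [sphInv_ofC h, sphInv_ofC (by simpa using h)]; simp

lemma embed_sphInv (x : CSphere) : embed (sphInv x) = (starRingEnd ℂ (embed x).1, -(embed x).2) := by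
  rcases cases' x with rfl | ⟨w, rfl⟩
  · simp [embed_ofC]
  · by_cases h : w = 0
    · simp [h]
    · rw [sphInv_ofC h, embed_ofC, embed_ofC]
      have hn : (0:ℝ) < ‖w‖ := norm_pos_iff.2 h
      have h1 : (0:ℝ) < ‖w‖ ^ 2 + 1 := by positivity
      ext1
      · simp only [Complex.real_smul, map_mul, Complex.conj_ofReal]
        have : (starRingEnd ℂ) w = ((‖w‖ ^ 2 : ℝ) : ℂ) / w := by
          rw [eq_div_iff h, mul_comm, Complex.mul_conj, Complex.normSq_eq_norm_sq]
        rw [this, ← mul_div_assoc, ← mul_div_assoc, mul_one, ← Complex.ofReal_mul]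
        congr 2
        rw [norm_div, norm_one]; field_simp
        ring
      · simp only [norm_div, norm_one]; field_simp; ring

lemma isom_sphInv : Isometry sphInv := by
  refine Isometry.of_dist_eq fun x y => ?_
  rw [← isom_embed.dist_eq, ← isom_embed.dist_eq, embed_sphInv, embed_sphInv, Prod.dist_eq, Prod.dist_eq]
  congr 1
  · simp only [dist_eq_norm, ← map_sub]; exact RCLike.norm_conj _
  · exact dist_neg_neg _ _

lemma cover (x : CSphere) : x ∈ ofC '' closedBall 0 1 ∨ x ∈ sphInv '' (ofC '' closedBall 0 1) := by
  rcases cases' x with rfl | ⟨w, rfl⟩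
  · right; exact ⟨ofC 0, ⟨0, by simp, rfl⟩, by simp⟩
  · by_cases h : ‖w‖ ≤ 1
    · left; exact ⟨w, by simpa using h, rfl⟩
    · right
      have h0 : w ≠ 0 := by rintro rfl; simp at h
      refine ⟨ofC (1/w), ⟨1/w, ?_, rfl⟩, by rw [← sphInv_ofC h0]; simp⟩
      push Not at h
      simp only [mem_closedBall, dist_zero_right, norm_div, norm_one]
      rw [div_le_one (by linarith)]; exact h.le

instance : CompactSpace CSphere := by
  constructor
  have h1 : IsCompact (ofC '' closedBall (0:ℂ) 1) := (isCompact_closedBall _ _).image cont_ofC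
  have h2 := h1.union (h1.image isom_sphInv.continuous)
  convert h2
  ext x; simpa using cover x

lemma isOpenEmb_ofC : IsOpenEmbedding ofC :=
  .of_continuous_injective_isOpenMap cont_ofC ofC_inj fun _ h => isOpen_ofC h

end CSphere
end

noncomputable section
open Set Metric Topology Filter
namespace CSphere

structure Hol (f : CSphere → CSphere) : Prop where
  cont : Continuous f
  fib : ∃ d : ℕ, ∀ w, (f ⁻¹' {w}).Finite ∧ (f ⁻¹' {w}).ncard ≤ d
  an : ∃ S : Set ℂ, S.Finite ∧ ∀ u ∉ S, AnalyticAt ℂ (fun v => toC (f (ofC v))) u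

lemma Hol.finfib {f : CSphere → CSphere} (h : Hol f) (w : CSphere) : (f ⁻¹' {w}).Finite := by
  obtain ⟨d, hd⟩ := h.fib; exact (hd w).1

lemma Hol.comp {f g : CSphere → CSphere} (hf : Hol f) (hg : Hol g) : Hol (f ∘ g) := by
  refine ⟨hf.cont.comp hg.cont, ?_, ?_⟩
  · obtain ⟨d, hd⟩ := hf.fib
    obtain ⟨e, he⟩ := hg.fib
    refine ⟨d * e, fun w => ?_⟩
    have key : (f ∘ g) ⁻¹' {w} = ⋃ v ∈ (hd w).1.toFinset, g ⁻¹' {v} := by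
      ext x; simp
    rw [key]
    refine ⟨Set.Finite.biUnion (Finset.finite_toSet _) fun v _ => (he v).1, ?_⟩
    refine (Finset.set_ncard_biUnion_le _ _).trans ?_
    refine (Finset.sum_le_card_nsmul _ _ e fun v _ => (he v).2).trans ?_
    rw [smul_eq_mul, ← Set.ncard_eq_toFinset_card _ (hd w).1]
    exact Nat.mul_le_mul_right _ (hd w).2
  · obtain ⟨S, hS, hSa⟩ := hf.an
    obtain ⟨T, hT, hTa⟩ := hg.an
    have h1 : (ofC ⁻¹' (g ⁻¹' {infty})).Finite := (hg.finfib _).preimage ofC_inj.injOn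
    have h2 : (ofC ⁻¹' (⋃ s ∈ S, g ⁻¹' {ofC s})).Finite :=
      (hS.biUnion fun s _ => hg.finfib _).preimage ofC_inj.injOn
    refine ⟨_, (hT.union h1).union h2, fun u hu => ?_⟩
    simp only [mem_union, not_or, mem_preimage, mem_singleton_iff, mem_iUnion, not_exists] at hu
    obtain ⟨⟨hu1, hu2⟩, hu3⟩ := hu
    have ha := hTa u hu1
    have hb : AnalyticAt ℂ (fun v => toC (f (ofC v))) (toC (g (ofC u))) :=
      hSa _ fun hmem => hu3 _ hmem (ofC_toC hu2).symm
    refine (AnalyticAt.fun_comp (g := fun v => toC (f (ofC v))) (f := fun v => toC (g (ofC v))) hb ha).congr ?_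
    have : ∀ᶠ v in 𝓝 u, g (ofC v) ≠ infty :=
      (hg.cont.comp cont_ofC).continuousAt.eventually_ne hu2
    filter_upwards [this] with v hv
    simp [ofC_toC hv]

open Polynomial in
lemma ratLift_infty (p q : ℂ[X]) : ratLift p q infty = (if q.natDegree < p.natDegree then infty
     else if p.natDegree < q.natDegree then ofC 0
     else ofC (p.leadingCoeff / q.leadingCoeff)) := rfl
open Polynomial in
lemma ratLift_ofC (p q : ℂ[X]) (w : ℂ) : ratLift p q (ofC w) =
  if q.eval w = 0 then infty else ofC (p.eval w / q.eval w) := rfl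

open Polynomial in
lemma ratLift_swap (p q : ℂ[X]) {w : ℂ} (h : p.eval w ≠ 0 ∨ q.eval w ≠ 0) :
    sphInv (ratLift q p (ofC w)) = ratLift p q (ofC w) := by
  rw [ratLift_ofC, ratLift_ofC]
  by_cases hq : q.eval w = 0 <;> by_cases hp : p.eval w = 0
  · simp [hp, hq] at h
  · simp [hp, hq]
  · simp [hp, hq]
  · rw [if_neg hp, if_neg hq, sphInv_ofC (div_ne_zero hq hp)]; simp

open Polynomial in
lemma ratLift_contAt1 (p q : ℂ[X]) {w : ℂ} (h : q.eval w ≠ 0) :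
    ContinuousAt (fun v => ratLift p q (ofC v)) w := by
  have h1 : ∀ᶠ v in 𝓝 w, q.eval v ≠ 0 := q.continuous.continuousAt.eventually_ne h
  have h2 : ContinuousAt (fun v => ofC (p.eval v / q.eval v)) w :=
    cont_ofC.continuousAt.comp (p.continuous.continuousAt.div q.continuous.continuousAt h)
  refine h2.congr ?_
  filter_upwards [h1] with v hv
  rw [ratLift_ofC, if_neg hv]

open Polynomial in
lemma ratLift_contAt (p q : ℂ[X]) {w : ℂ} (h : p.eval w ≠ 0 ∨ q.eval w ≠ 0) :
    ContinuousAt (fun v => ratLift p q (ofC v)) w := by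
  by_cases hq : q.eval w = 0
  · have hp : p.eval w ≠ 0 := by tauto
    have h1 : ∀ᶠ v in 𝓝 w, p.eval v ≠ 0 := p.continuous.continuousAt.eventually_ne hp
    have h2 : ContinuousAt (fun v => sphInv (ratLift q p (ofC v))) w :=
      isom_sphInv.continuous.continuousAt.comp (ratLift_contAt1 q p hp)
    refine h2.congr ?_
    filter_upwards [h1] with v hv
    exact ratLift_swap p q (Or.inl hv)
  · exact ratLift_contAt1 p q hq

open Polynomial in
lemma eval_reflect (p : ℂ[X]) {n : ℕ} (h : p.natDegree ≤ n) {u : ℂ} (hu : u ≠ 0) :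
    p.eval (1/u) = (p.reflect n).eval u / u ^ n := by
  let : Invertible (u⁻¹) := invertibleOfNonzero (inv_ne_zero hu)
  have := eval₂_reflect_mul_pow (RingHom.id ℂ) u⁻¹ n p h
  simp only [invOf_eq_inv, eval₂_id, inv_inv] at this
  rw [one_div, ← this, inv_pow, div_eq_mul_inv]

open Polynomial in
lemma ratLift_inv (p q : ℂ[X]) (hq : q ≠ 0) (u : ℂ) :
    ratLift p q (sphInv (ofC u)) = ratLift (p.reflect (max p.natDegree q.natDegree))
      (q.reflect (max p.natDegree q.natDegree)) (ofC u) := by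
  set n := max p.natDegree q.natDegree with hn
  by_cases hu : u = 0
  · subst hu
    rw [sphInv_zero, ratLift_infty, ratLift_ofC, ← coeff_zero_eq_eval_zero, ← coeff_zero_eq_eval_zero,
      coeff_reflect, coeff_reflect, show (revAt n) 0 = n by simp [revAt_le]]
    rcases lt_trichotomy q.natDegree p.natDegree with h | h | h
    · rw [if_pos h, if_pos (coeff_eq_zero_of_natDegree_lt (by omega))]
    · have h1 : n = q.natDegree := by omega
      have h2 : n = p.natDegree := by omega
      rw [if_neg (by omega), if_neg (by omega)]
      have e : q.coeff n = q.leadingCoeff := by rw [h1]; rfl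
      have e' : p.coeff n = p.leadingCoeff := by rw [h2]; rfl
      rw [e, e', if_neg (by simpa using hq)]
    · have h1 : n = q.natDegree := by omega
      have e : q.coeff n = q.leadingCoeff := by rw [h1]; rfl
      rw [if_neg (by omega), if_pos h, e, if_neg (by simpa using hq),
        coeff_eq_zero_of_natDegree_lt (by omega : p.natDegree < n)]
      simp
  · have hn1 : p.natDegree ≤ n := le_max_left _ _
    have hn2 : q.natDegree ≤ n := le_max_right _ _
    rw [sphInv_ofC hu, ratLift_ofC, ratLift_ofC, eval_reflect p hn1 hu, eval_reflect q hn2 hu]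
    have : u ^ n ≠ 0 := pow_ne_zero _ hu
    simp only [div_eq_zero_iff, this, or_false, div_div_div_cancel_right₀ this]

open Polynomial in
lemma ratLift_hol {p q : ℂ[X]} (hq : q ≠ 0) (hc : IsCoprime p q) (hd : 1 ≤ max p.natDegree q.natDegree) :
    Hol (ratLift p q) := by
  have hcop : ∀ w, p.eval w ≠ 0 ∨ q.eval w ≠ 0 := fun w => by
    obtain ⟨a, b, hab⟩ := hc
    by_contra! hh
    have := congrArg (eval w) hab
    simp [hh.1, hh.2] at this
  set n := max p.natDegree q.natDegree with hn
  refine ⟨?_, ⟨n + 1, fun w => ?_⟩, ?_⟩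
  · rw [continuous_iff_continuousAt]
    intro x
    rcases cases' x with rfl | ⟨w, rfl⟩
    · have h1 : ContinuousAt (fun u => ratLift (p.reflect n) (q.reflect n) (ofC u)) 0 := by
        refine ratLift_contAt _ _ ?_
        rw [← coeff_zero_eq_eval_zero, ← coeff_zero_eq_eval_zero,
          coeff_reflect, coeff_reflect, show (revAt n) 0 = n by simp [revAt_le]]
        rcases le_total q.natDegree p.natDegree with h | h
        · have h2 : n = p.natDegree := by omega
          have e' : p.coeff n = p.leadingCoeff := by rw [h2]; rfl
          left; rw [e']
          simp only [ne_eq, leadingCoeff_eq_zero]; rintro rfl; simp at h2; omega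
        · have h2 : n = q.natDegree := by omega
          have e' : q.coeff n = q.leadingCoeff := by rw [h2]; rfl
          right; rw [e']; simpa using hq
      have h2 : ContinuousAt (fun u => ratLift p q (sphInv (ofC u))) 0 := by
        refine h1.congr (Eventually.of_forall fun u => (ratLift_inv p q hq u).symm)
      have h3 : ContinuousAt ((fun u => ratLift p q (sphInv (ofC u))) ∘ fun x => toC (sphInv x)) infty := by
        refine ContinuousAt.comp (by simpa using h2) ?_
        exact (contAt_toC (by simpa using ofC_ne 0)).comp isom_sphInv.continuous.continuousAt
      refine h3.congr ?_
      have : ∀ᶠ x in 𝓝 (infty : CSphere), x ≠ ofC 0 := isOpen_compl_singleton.mem_nhds (ofC_ne 0).symm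
      filter_upwards [this] with x hx
      have : sphInv x ≠ infty := fun h => hx (by rw [← sphInv_sphInv x, h]; simp)
      simp [ofC_toC this]
    · exact isOpenEmb_ofC.continuousAt_iff.1 (ratLift_contAt p q (hcop w))
  · have key : ∃ r : ℂ[X], r ≠ 0 ∧ r.natDegree ≤ n ∧ ratLift p q ⁻¹' {w} ⊆ ofC '' {z | r.IsRoot z} ∪ {infty} := by
      rcases cases' w with rfl | ⟨c, rfl⟩
      · refine ⟨q, hq, le_max_right _ _, fun x hx => ?_⟩
        rcases cases' x with rfl | ⟨v, rfl⟩
        · exact Or.inr rfl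
        · left; refine ⟨v, ?_, rfl⟩
          by_contra h
          simp only [mem_preimage, ratLift_ofC, mem_singleton_iff, mem_ofPred_eq, IsRoot.def] at hx h
          rw [if_neg h] at hx; exact ofC_ne _ hx
      · refine ⟨p - C c * q, ?_, ?_, fun x hx => ?_⟩
        · intro h0
          have hp : p = C c * q := sub_eq_zero.1 h0
          have hu : IsUnit q := by
            obtain ⟨a, b, hab⟩ := hc
            rw [hp] at hab
            exact IsUnit.of_mul_eq_one (a * C c + b) (by rw [← hab]; ring)
          have e1 := natDegree_eq_zero_of_isUnit hu
          have e2 : p.natDegree ≤ 0 := by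
            rw [hp]; exact (natDegree_C_mul_le _ _).trans e1.le
          omega
        · refine (natDegree_sub_le _ _).trans (max_le (le_max_left _ _) ?_)
          exact (natDegree_C_mul_le _ _).trans (le_max_right _ _)
        · rcases cases' x with rfl | ⟨v, rfl⟩
          · exact Or.inr rfl
          · left; refine ⟨v, ?_, rfl⟩
            simp only [mem_preimage, ratLift_ofC, mem_singleton_iff, mem_ofPred_eq, IsRoot.def] at hx ⊢
            by_cases h : q.eval v = 0
            · rw [if_pos h] at hx; exact absurd hx.symm (ofC_ne _)
            · rw [if_neg h] at hx
              have := ofC_inj hx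
              rw [div_eq_iff h] at this
              simp [this]
    obtain ⟨r, hr, hrn, hsub⟩ := key
    have e : {z | r.IsRoot z} = (r.roots.toFinset : Set ℂ) := by
      ext z; simp [hr]
    have hf : (ofC '' {z | r.IsRoot z} ∪ {infty}).Finite := by
      rw [e]; exact ((Finset.finite_toSet _).image _).union (finite_singleton _)
    refine ⟨hf.subset hsub, (ncard_le_ncard hsub hf).trans ((ncard_union_le _ _).trans ?_)⟩
    rw [ncard_singleton]
    refine Nat.add_le_add_right ?_ 1
    rw [e]
    refine (ncard_image_le (Finset.finite_toSet _)).trans ?_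
    rw [ncard_coe_finset]
    exact (Multiset.toFinset_card_le _).trans ((card_roots' r).trans hrn)
  · refine ⟨(q.roots.toFinset : Set ℂ), Finset.finite_toSet _, fun u hu => ?_⟩
    have hu' : q.eval u ≠ 0 := by simpa [hq] using hu
    have h1 : ∀ᶠ v in 𝓝 u, q.eval v ≠ 0 := q.continuous.continuousAt.eventually_ne hu'
    have h2 : AnalyticAt ℂ (fun v => p.eval v / q.eval v) u := by
      refine AnalyticAt.fun_div ?_ ?_ hu'
      · exact (Polynomial.differentiable p).analyticAt u
      · exact (Polynomial.differentiable q).analyticAt u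
    refine h2.congr ?_
    filter_upwards [h1] with v hv
    rw [ratLift_ofC, if_neg hv, toC_ofC]

lemma IsNonconstRatMap.hol {f : CSphere → CSphere} (h : IsNonconstRatMap f) : Hol f := by
  obtain ⟨n, hn, p, q, ⟨h1, h2, rfl⟩, h3⟩ := h
  exact ratLift_hol h1 h2 (by omega)

lemma hol_sphInv : Hol sphInv :=
  ratLift_hol Polynomial.X_ne_zero isCoprime_one_left (by simp)

def trans (a : ℂ) : CSphere → CSphere := ratLift (Polynomial.X + Polynomial.C a) 1
lemma hol_trans (a : ℂ) : Hol (trans a) :=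
  ratLift_hol one_ne_zero isCoprime_one_right (by simp)
@[simp] lemma trans_ofC (a u : ℂ) : trans a (ofC u) = ofC (u + a) := by
  rw [trans, ratLift_ofC]; simp
@[simp] lemma trans_infty (a : ℂ) : trans a infty = infty := by
  rw [trans, ratLift_infty]; simp
lemma hol_id : Hol id := by
  refine ⟨continuous_id, ⟨1, fun w => ⟨by simp, by simp⟩⟩, ∅, by simp, fun u _ => ?_⟩
  exact analyticAt_id

/-- A chart of the sphere. -/
structure Cht where
  M : CSphere → CSphere
  Mi : CSphere → CSphere
  hM : Hol M
  hMi : Hol Mi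
  l : ∀ x, Mi (M x) = x
  r : ∀ x, M (Mi x) = x

namespace Cht
def κ (c : Cht) (u : ℂ) : CSphere := c.M (ofC u)
def τ (c : Cht) (x : CSphere) : ℂ := toC (c.Mi x)
def pole (c : Cht) : CSphere := c.M infty
variable (c : Cht)
@[simp] lemma τκ (u : ℂ) : c.τ (c.κ u) = u := by simp [τ, κ, c.l]
lemma Mi_ne {x : CSphere} (h : x ≠ c.pole) : c.Mi x ≠ infty := fun e => h (by rw [pole, ← e, c.r])
lemma κτ {x : CSphere} (h : x ≠ c.pole) : c.κ (c.τ x) = x := by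
  rw [κ, τ, ofC_toC (c.Mi_ne h), c.r]
lemma κ_ne (u : ℂ) : c.κ u ≠ c.pole := fun h => by
  have := congrArg c.Mi h; simp only [κ, pole, c.l] at this; exact ofC_ne _ this
lemma κ_inj : Function.Injective c.κ := fun u v h => by simpa using congrArg c.τ h
lemma κ_cont : Continuous c.κ := c.hM.cont.comp cont_ofC
lemma τ_cont {x : CSphere} (h : x ≠ c.pole) : ContinuousAt c.τ x :=
  (contAt_toC (c.Mi_ne h)).comp c.hMi.cont.continuousAt
lemma κ_image (s : Set ℂ) : c.κ '' s = {c.pole}ᶜ ∩ c.τ ⁻¹' s := by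
  ext x; constructor
  · rintro ⟨w, hw, rfl⟩; exact ⟨c.κ_ne w, by simpa using hw⟩
  · rintro ⟨h1, h2⟩; exact ⟨_, h2, c.κτ h1⟩
lemma κ_open {s : Set ℂ} (h : IsOpen s) : IsOpen (c.κ '' s) := by
  rw [κ_image]
  exact ContinuousOn.isOpen_inter_preimage (fun x hx => (c.τ_cont hx).continuousWithinAt)
    isOpen_compl_singleton h
lemma κ_emb : IsOpenEmbedding c.κ :=
  .of_continuous_injective_isOpenMap c.κ_cont c.κ_inj fun _ h => c.κ_open h
/-- chart disc -/
def D (u : ℂ) (r : ℝ) : Set CSphere := c.κ '' ball u r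
lemma D_open (u : ℂ) (r : ℝ) : IsOpen (c.D u r) := c.κ_open isOpen_ball
lemma D_conn (u : ℂ) (r : ℝ) : IsPreconnected (c.D u r) :=
  (convex_ball u r).isPreconnected.image _ c.κ_cont.continuousOn
lemma D_mono {u v : ℂ} {r s : ℝ} (h : ball u r ⊆ ball v s) : c.D u r ⊆ c.D v s := image_mono h
lemma mem_D {u : ℂ} {r : ℝ} {x : CSphere} : x ∈ c.D u r ↔ x ≠ c.pole ∧ ‖c.τ x - u‖ < r := by
  rw [D, κ_image]; simp [dist_eq_norm]
lemma κ_mem_D {u v : ℂ} {r : ℝ} : c.κ v ∈ c.D u r ↔ ‖v - u‖ < r := by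
  rw [mem_D]; simp [c.κ_ne]
lemma D_nhds {u : ℂ} {r : ℝ} (h : 0 < r) : c.D u r ∈ 𝓝 (c.κ u) :=
  (c.D_open u r).mem_nhds ⟨u, by simpa using h, rfl⟩
lemma D_basis {u : ℂ} {O : Set CSphere} (h : O ∈ 𝓝 (c.κ u)) : ∃ r > 0, c.D u r ⊆ O := by
  have := c.κ_cont.continuousAt.preimage_mem_nhds h
  obtain ⟨r, hr, h⟩ := Metric.mem_nhds_iff.1 this
  exact ⟨r, hr, by rw [D, image_subset_iff]; exact h⟩
end Cht

lemma exists_chart (x : CSphere) : ∃ c : Cht, c.κ 0 = x := by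
  rcases cases' x with rfl | ⟨w, rfl⟩
  · exact ⟨⟨sphInv, sphInv, hol_sphInv, hol_sphInv, sphInv_sphInv, sphInv_sphInv⟩, by simp [Cht.κ]⟩
  · refine ⟨⟨trans w, trans (-w), hol_trans _, hol_trans _, fun x => ?_, fun x => ?_⟩, by simp [Cht.κ]⟩ <;>
    rcases cases' x with rfl | ⟨w, rfl⟩ <;> simp

lemma exists_chart_pole (x : CSphere) : ∃ c : Cht, c.pole = x := by
  obtain ⟨c, hc⟩ := exists_chart x
  refine ⟨⟨c.M ∘ sphInv, sphInv ∘ c.Mi, c.hM.comp hol_sphInv, hol_sphInv.comp c.hMi, fun x => ?_, fun x => ?_⟩, ?_⟩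
  · simp [c.l]
  · simp [c.r]
  · simpa [Cht.pole, Cht.κ] using hc

lemma Hol.an' {f : CSphere → CSphere} (hf : Hol f) {u : ℂ} (h : f (ofC u) ≠ infty) :
    AnalyticAt ℂ (fun v => toC (f (ofC v))) u := by
  obtain ⟨S, hS, hSa⟩ := hf.an
  refine Complex.analyticAt_of_differentiable_on_punctured_nhds_of_continuousAt ?_ ?_
  · have : (S \ {u})ᶜ ∈ 𝓝 u := (hS.subset sdiff_subset).isClosed.isOpen_compl.mem_nhds (by simp)
    filter_upwards [nhdsWithin_le_nhds this, self_mem_nhdsWithin] with v hv hv'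
    exact (hSa v fun hm => hv ⟨hm, hv'⟩).differentiableAt
  · exact ContinuousAt.comp (g := toC) (f := fun v => f (ofC v)) (contAt_toC h)
      (hf.cont.comp cont_ofC).continuousAt

lemma Hol.anc {f : CSphere → CSphere} (hf : Hol f) (c c' : Cht) {u : ℂ} (h : f (c.κ u) ≠ c'.pole) :
    AnalyticAt ℂ (fun v => c'.τ (f (c.κ v))) u :=
  ((c'.hMi.comp hf).comp c.hM).an' (c'.Mi_ne h)

end CSphere
end

noncomputable section
open Set Metric Topology Filter
namespace CSphere

instance : LocallyConnectedSpace CSphere := by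
  rw [locallyConnectedSpace_iff_subsets_isOpen_isConnected]
  intro x O hO
  obtain ⟨c, rfl⟩ := exists_chart x
  obtain ⟨r, hr, h⟩ := c.D_basis hO
  exact ⟨c.D 0 r, h, c.D_open _ _, ⟨0, by simpa using hr, rfl⟩, ⟨c.κ 0, 0, by simpa using hr, rfl⟩, c.D_conn _ _⟩

instance : PreconnectedSpace CSphere := by
  constructor
  have h1 : IsPreconnected (ofC '' closedBall (0:ℂ) 1) :=
    (convex_closedBall _ _).isPreconnected.image _ cont_ofC.continuousOn
  have h2 := h1.image _ isom_sphInv.continuous.continuousOn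
  have h3 := IsPreconnected.union (ofC 1) (mem_image_of_mem _ (by simp))
    (⟨ofC 1, ⟨1, by simp, rfl⟩, by rw [sphInv_ofC one_ne_zero]; simp⟩ : ofC 1 ∈ sphInv '' (ofC '' closedBall (0:ℂ) 1)) h1 h2
  convert h3
  ext x; simpa using cover x

lemma nebot_ne (x : CSphere) : ∀ O ∈ 𝓝 x, ¬ O.Finite := by
  intro O hO hf
  obtain ⟨c, rfl⟩ := exists_chart x
  have h1 := c.κ_cont.continuousAt.preimage_mem_nhds hO
  have h2 : (c.κ ⁻¹' O).Finite := hf.preimage c.κ_inj.injOn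
  exact (infinite_of_mem_nhds _ h1) h2

lemma Hol.isOpenMap {f : CSphere → CSphere} (hf : Hol f) : IsOpenMap f := by
  rw [isOpenMap_iff_nhds_le]
  intro x
  obtain ⟨c, rfl⟩ := exists_chart x
  obtain ⟨c', hc'⟩ := exists_chart (f (c.κ 0))
  have hne : f (c.κ 0) ≠ c'.pole := by rw [← hc']; exact c'.κ_ne 0
  have ev : ∀ᶠ v in 𝓝 (0:ℂ), f (c.κ v) ≠ c'.pole :=
    (hf.cont.comp c.κ_cont).continuousAt.eventually_ne hne
  rcases (hf.anc c c' hne).eventually_constant_or_nhds_le_map_nhds with h | h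
  · exfalso
    have h2 : ∀ᶠ v in 𝓝 (0:ℂ), f (c.κ v) = f (c.κ 0) := by
      filter_upwards [ev, h] with v hv hv'
      rw [← c'.κτ hv, hv', c'.κτ hne]
    have h3 : (c.κ ⁻¹' (f ⁻¹' {f (c.κ 0)})).Finite := (hf.finfib _).preimage c.κ_inj.injOn
    exact (infinite_of_mem_nhds _ h2) h3
  · intro O hO
    have h1 : c.κ ⁻¹' (f ⁻¹' O) ∈ 𝓝 (0:ℂ) := c.κ_cont.continuousAt.preimage_mem_nhds hO
    have h2 := h (image_mem_map (inter_mem h1 ev))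
    have h3 := c'.κ_emb.isOpenMap.image_mem_nhds h2
    rw [c'.κτ hne] at h3
    refine mem_of_superset h3 ?_
    rintro _ ⟨_, ⟨v, ⟨hv, hv'⟩, rfl⟩, rfl⟩
    simp only [c'.κτ hv']; exact hv

lemma Hol.surj {f : CSphere → CSphere} (hf : Hol f) : Function.Surjective f := by
  have h1 : IsClopen (range f) := ⟨(isCompact_range hf.cont).isClosed, hf.isOpenMap.isOpen_range⟩
  rcases isClopen_iff.1 h1 with h | h
  · exact absurd h (range_nonempty_iff_nonempty.2 ⟨infty⟩).ne_empty
  · exact range_eq_univ.1 h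

lemma Hol.iter {g : CSphere → CSphere} (hg : Hol g) : ∀ n : ℕ, Hol (g^[n])
  | 0 => hol_id
  | n + 1 => by rw [Function.iterate_succ]; exact (hg.iter n).comp hg

/-- component maps onto -/
lemma comp_onto {f : CSphere → CSphere} (hf : Hol f) {D : Set CSphere} (hD : IsOpen D)
    (hc : IsPreconnected D) {y : CSphere} (hy : f y ∈ D) {w : CSphere} (hw : w ∈ D) :
    ∃ x ∈ connectedComponentIn (f ⁻¹' D) y, f x = w := by
  set W := connectedComponentIn (f ⁻¹' D) y with hW
  have hWo : IsOpen W := (hD.preimage hf.cont).connectedComponentIn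
  have hyW : y ∈ W := mem_connectedComponentIn hy
  have hWD : W ⊆ f ⁻¹' D := connectedComponentIn_subset _ _
  have key : D ⊆ f '' W := by
    refine hc.subset_left_of_subset_union (v := (f '' closure W)ᶜ) (hf.isOpenMap _ hWo) ?_ ?_ ?_ ⟨f y, hy, y, hyW, rfl⟩
    · exact (isClosed_closure.isCompact.image hf.cont).isClosed.isOpen_compl
    · exact disjoint_compl_right_iff_subset.2 (image_mono subset_closure)
    · intro d hd
      by_cases h : d ∈ f '' closure W
      · left
        obtain ⟨x, hx, rfl⟩ := h
        refine ⟨x, ?_, rfl⟩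
        have h1 : IsPreconnected (W ∪ {x}) :=
          isPreconnected_connectedComponentIn.subset_closure (subset_union_left)
            (union_subset subset_closure (singleton_subset_iff.2 hx))
        exact h1.subset_connectedComponentIn (Or.inl hyW) (union_subset hWD (singleton_subset_iff.2 hd)) (Or.inr rfl)
      · right; exact h
  obtain ⟨x, hx, h⟩ := key hw
  exact ⟨x, hx, h⟩

def Small (ε : ℝ) (V : Set CSphere) : Prop := ∀ x ∈ V, ∀ y ∈ V, dist x y ≤ ε

lemma exists_nhds_preimage {f : CSphere → CSphere} (hf : Continuous f) {p : CSphere} {P : Set CSphere}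
    (hP : IsOpen P) (h : f ⁻¹' {p} ⊆ P) : ∃ O, IsOpen O ∧ p ∈ O ∧ f ⁻¹' O ⊆ P := by
  refine ⟨(f '' Pᶜ)ᶜ, (hP.isClosed_compl.isCompact.image hf).isClosed.isOpen_compl, ?_, ?_⟩
  · rintro ⟨x, hx, e⟩; exact hx (h e)
  · intro x hx; by_contra hn; exact hx ⟨x, hn, rfl⟩

lemma fixN {f : CSphere → CSphere} (hf : Hol f) (p : CSphere) {ε : ℝ} (hε : 0 < ε) :
    ∃ O, IsOpen O ∧ p ∈ O ∧ ∀ V, IsPreconnected V → f '' V ⊆ O → ∃ a, f a = p ∧ V ⊆ ball a ε := by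
  have hfin := hf.finfib p
  obtain ⟨U, hU, hd⟩ := hfin.t2_separation
  obtain ⟨O, hO, hp, hsub⟩ := exists_nhds_preimage hf.cont (p := p)
    (P := ⋃ a ∈ f ⁻¹' {p}, (U a ∩ ball a ε))
    (isOpen_biUnion fun a _ => (hU a).2.inter isOpen_ball)
    (fun a ha => mem_biUnion ha ⟨(hU a).1, mem_ball_self hε⟩)
  refine ⟨O, hO, hp, fun V hV hVO => ?_⟩
  have hVU : V ⊆ ⋃ a ∈ f ⁻¹' {p}, (U a ∩ ball a ε) := fun x hx => hsub (hVO ⟨x, hx, rfl⟩)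
  rcases V.eq_empty_or_nonempty with rfl | ⟨v, hv⟩
  · obtain ⟨a, ha⟩ := hf.surj p; exact ⟨a, ha, empty_subset _⟩
  obtain ⟨a, ha, hva⟩ := mem_iUnion₂.1 (hVU hv)
  refine ⟨a, ha, ?_⟩
  have : V ⊆ U a ∩ ball a ε := by
    refine hV.subset_left_of_subset_union ((hU a).2.inter isOpen_ball)
      (v := ⋃ b ∈ f ⁻¹' {p} \ {a}, (U b ∩ ball b ε)) (isOpen_biUnion fun b _ => (hU b).2.inter isOpen_ball) ?_ ?_ ⟨v, hv, hva⟩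
    · rw [disjoint_iUnion₂_right]
      intro b hb
      exact (hd ha hb.1 (fun h => hb.2 h.symm)).mono inter_subset_left inter_subset_left
    · intro x hx
      obtain ⟨b, hb, hxb⟩ := mem_iUnion₂.1 (hVU hx)
      by_cases e : b = a
      · left; rwa [← e]
      · right; exact mem_biUnion ⟨hb, e⟩ hxb
  exact this.trans inter_subset_right

lemma montel {ι : Type*} {F : ι → CSphere → CSphere} (hF : ∀ i, Hol (F i)) {B O : Set CSphere}
    (hB : IsOpen B) (hO : IsOpen O) (hne : O.Nonempty) (h : ∀ i, ∀ x ∈ B, F i x ∉ O) {x : CSphere} (hx : x ∈ B) :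
    EquicontinuousAt F x := by
  obtain ⟨o, ho⟩ := hne
  obtain ⟨c', rfl⟩ := exists_chart_pole o
  obtain ⟨c, rfl⟩ := exists_chart x
  obtain ⟨r, hr, hrB⟩ := c.D_basis (hB.mem_nhds hx)
  have hne : ∀ y ∈ Oᶜ, y ≠ c'.pole := fun y hy e => hy (e ▸ ho)
  obtain ⟨R, hR⟩ := hO.isClosed_compl.isCompact.exists_bound_of_continuousOn
    (f := c'.τ) fun y hy => (c'.τ_cont (hne y hy)).continuousWithinAt
  have hm : ∀ i, ∀ v ∈ ball (0:ℂ) r, F i (c.κ v) ∈ Oᶜ := fun i v hv => h i _ (hrB ⟨v, hv, rfl⟩)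
  have hb : ∀ i, ∀ v ∈ ball (0:ℂ) r, ‖c'.τ (F i (c.κ v))‖ ≤ R := fun i v hv => hR _ (hm i v hv)
  have h0 : (0:ℂ) ∈ ball (0:ℂ) r := mem_ball_self hr
  rw [Metric.equicontinuousAt_iff_right]
  intro ε hε
  have huc := (isCompact_closedBall (0:ℂ) R).uniformContinuousOn_of_continuous c'.κ_cont.continuousOn
  rw [Metric.uniformContinuousOn_iff] at huc
  obtain ⟨δ, hδ, huc⟩ := huc ε hε
  have hev : ∀ᶠ v in 𝓝 (0:ℂ), v ∈ ball (0:ℂ) r ∧ (2 * |R| + 1) / r * dist v 0 < δ := by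
    refine Filter.Eventually.and (ball_mem_nhds _ hr) ?_
    have : Tendsto (fun v : ℂ => (2 * |R| + 1) / r * dist v 0) (𝓝 0) (𝓝 ((2 * |R| + 1) / r * dist (0:ℂ) 0)) := by
      apply Continuous.tendsto; fun_prop
    rw [dist_self, mul_zero] at this
    exact this.eventually_lt_const hδ
  have := c.κ_emb.isOpenMap.image_mem_nhds hev
  filter_upwards [this]
  rintro _ ⟨v, ⟨hv, hv2⟩, rfl⟩ i
  have hd : DifferentiableOn ℂ (fun v => c'.τ (F i (c.κ v))) (ball 0 r) := fun v hv =>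
    ((hF i).anc c c' (hne _ (hm i v hv))).differentiableAt.differentiableWithinAt
  have hS := Complex.dist_le_div_mul_dist_of_mapsTo_ball hd (R₂ := 2 * |R| + 1) (fun v hv => by
    rw [mem_closedBall, dist_eq_norm]
    have := norm_sub_le (c'.τ (F i (c.κ v))) (c'.τ (F i (c.κ 0)))
    have := hb i v hv; have := hb i 0 h0; have := le_abs_self R
    linarith) hv
  have := huc (c'.τ (F i (c.κ 0))) (by simpa using hb i 0 h0) (c'.τ (F i (c.κ v))) (by simpa using hb i v hv)
    (by rw [dist_comm]; exact hS.trans_lt hv2)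
  rwa [c'.κτ (hne _ (hm i 0 h0)), c'.κτ (hne _ (hm i v hv))] at this

section dyn
variable {g : CSphere → CSphere}

def Fa (g : CSphere → CSphere) : Set CSphere := interior {x | EquicontinuousAt (fun n : ℕ => g^[n]) x}
def Ju (g : CSphere → CSphere) : Set CSphere := (Fa g)ᶜ

lemma Fa_open : IsOpen (Fa g) := isOpen_interior
lemma Ju_closed : IsClosed (Ju g) := Fa_open.isClosed_compl
lemma Fa_eq {x : CSphere} (h : x ∈ Fa g) : EquicontinuousAt (fun n : ℕ => g^[n]) x := interior_subset h
lemma not_Ju {x : CSphere} : x ∉ Ju g ↔ x ∈ Fa g := not_not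

lemma eq_of_tail (hg : Continuous g) {N : ℕ} {x : CSphere}
    (h : EquicontinuousAt (fun n : ℕ => g^[n + N]) x) : EquicontinuousAt (fun n : ℕ => g^[n]) x := by
  rw [Metric.equicontinuousAt_iff_right] at h ⊢
  intro ε hε
  have h1 : ∀ᶠ y in 𝓝 x, ∀ n ∈ Finset.range N, dist (g^[n] x) (g^[n] y) < ε := by
    rw [Filter.eventually_all_finset]
    intro n _
    have := (hg.iterate n).continuousAt (x := x)
    have := Metric.tendsto_nhds.1 this ε hε
    simpa only [dist_comm] using this
  filter_upwards [h ε hε, h1] with y hy hy' n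
  by_cases hn : n < N
  · exact hy' n (Finset.mem_range.2 hn)
  · have := hy (n - N)
    rwa [Nat.sub_add_cancel (not_lt.1 hn)] at this

lemma sub_Fa (hg : Hol g) {B O : Set CSphere} (hB : IsOpen B) (hO : IsOpen O) (hne : O.Nonempty) (N : ℕ)
    (h : ∀ n ≥ N, ∀ x ∈ B, g^[n] x ∉ O) : B ⊆ Fa g :=
  interior_maximal (fun _ hx => eq_of_tail hg.cont (N := N) (montel (fun n => hg.iter (n + N)) hB hO hne
    (fun n => h (n + N) (Nat.le_add_left _ _)) hx)) hB

lemma dense_orbit (hg : Hol g) {B O : Set CSphere} (hB : IsOpen B) (hJ : (B ∩ Ju g).Nonempty) (hO : IsOpen O)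
    (hne : O.Nonempty) (N : ℕ) : ∃ n ≥ N, ∃ x ∈ B, g^[n] x ∈ O := by
  by_contra! h
  obtain ⟨x, hx, hx'⟩ := hJ
  exact hx' (sub_Fa hg hB hO hne N h hx)

lemma Fa_fwd (hg : Hol g) {x : CSphere} (h : x ∈ Fa g) : g x ∈ Fa g := by
  have : g '' Fa g ⊆ Fa g := by
    refine interior_maximal ?_ (hg.isOpenMap _ Fa_open)
    rintro _ ⟨y, hy, rfl⟩
    have := Fa_eq hy
    simp only [mem_ofPred_eq, Metric.equicontinuousAt_iff_right] at this ⊢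
    intro ε hε
    have h1 := hg.isOpenMap.image_mem_nhds (this ε hε)
    filter_upwards [h1]
    rintro _ ⟨v, hv, rfl⟩ n
    exact hv (n + 1)
  exact this ⟨x, h, rfl⟩

lemma Fa_bwd (hg : Hol g) {x : CSphere} (h : g x ∈ Fa g) : x ∈ Fa g := by
  have : g ⁻¹' Fa g ⊆ Fa g := by
    refine interior_maximal ?_ (Fa_open.preimage hg.cont)
    intro y hy
    refine eq_of_tail hg.cont (N := 1) ?_
    have := Fa_eq hy
    rw [Metric.equicontinuousAt_iff_right] at this ⊢
    intro ε hε
    exact hg.cont.continuousAt.eventually (this ε hε)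
  exact this h

lemma Fa_iff (hg : Hol g) (n : ℕ) {x : CSphere} : g^[n] x ∈ Fa g ↔ x ∈ Fa g := by
  induction n generalizing x with
  | zero => rfl
  | succ n ih => rw [Function.iterate_succ_apply, ih]; exact ⟨Fa_bwd hg, Fa_fwd hg⟩
lemma Ju_iff (hg : Hol g) (n : ℕ) {x : CSphere} : g^[n] x ∈ Ju g ↔ x ∈ Ju g := (Fa_iff hg n).not

/-- semi-hyperbolic point -/
def SHt (g : CSphere → CSphere) (p : CSphere) : Prop := ∃ N : ℕ, ∃ B, IsOpen B ∧ p ∈ B ∧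
  ∀ n V, IsPreconnected V → g^[n] '' V ⊆ B → ∀ w, (V ∩ g^[n] ⁻¹' {w}).ncard ≤ N

end dyn
end CSphere
end

noncomputable section
open Set Metric Topology Filter
namespace CSphere
open MeasureTheory

lemma det_mulc (a : ℂ) : |((ContinuousLinearMap.toSpanSingleton ℂ a).restrictScalars ℝ).det| = ‖a‖ ^ 2 := by
  have : ((ContinuousLinearMap.toSpanSingleton ℂ a).restrictScalars ℝ).det = ‖a‖ ^ 2 := by
    rw [ContinuousLinearMap.det, ContinuousLinearMap.coe_restrictScalars, LinearMap.det_restrictScalars]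
    rw [Algebra.norm_complex_apply, Complex.normSq_eq_norm_sq]
    congr 2
    simp [LinearMap.det_ring]
  rw [this, abs_of_nonneg (by positivity)]

/-- area with multiplicity -/
lemma area_mult {Ω : Set ℂ} (hΩ : IsOpen Ω) {F : ℂ → ℂ} (hF : DifferentiableOn ℂ F Ω) {N : ℕ}
    (hN : ∀ w, (Ω ∩ F ⁻¹' {w}).encard ≤ N) {B : Set ℂ} (hB : MeasurableSet B) (hm : MapsTo F Ω B) :
    ∫⁻ ζ in Ω, ‖deriv F ζ‖ₑ ^ 2 ≤ N * volume B := by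
  classical
  have han : AnalyticOnNhd ℂ F Ω := hF.analyticOnNhd hΩ
  set Ω' : Set ℂ := {ζ ∈ Ω | deriv F ζ ≠ 0} with hΩ'
  have hloc : ∀ ζ ∈ Ω', ∃ V ∈ 𝓝[Ω'] ζ, IsOpen V ∧ V ⊆ Ω ∧ InjOn F V := by
    intro ζ hζ
    have hs : HasStrictDerivAt F (deriv F ζ) ζ := (han ζ hζ.1).hasStrictDerivAt
    obtain ⟨e, he⟩ : ∃ e : OpenPartialHomeomorph ℂ ℂ, ζ ∈ e.source ∧ (e : ℂ → ℂ) = F :=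
      ⟨(hs.hasStrictFDerivAt_equiv hζ.2).toOpenPartialHomeomorph F, HasStrictFDerivAt.mem_toOpenPartialHomeomorph_source _, rfl⟩
    refine ⟨e.source ∩ Ω, mem_nhdsWithin_of_mem_nhds ((e.open_source.inter hΩ).mem_nhds ⟨he.1, hζ.1⟩),
      e.open_source.inter hΩ, inter_subset_right, ?_⟩
    have := e.injOn
    rw [he.2] at this
    exact this.mono inter_subset_left
  choose! V hV1 hV2 hV3 hV4 using hloc
  obtain ⟨t, ht, htc, hcov⟩ := TopologicalSpace.countable_cover_nhdsWithin (s := Ω') (f := V) hV1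
  have hEq : ∫⁻ ζ in Ω, ‖deriv F ζ‖ₑ ^ 2 = ∫⁻ ζ in Ω', ‖deriv F ζ‖ₑ ^ 2 := by
    rw [← lintegral_indicator hΩ.measurableSet]
    have hmΩ' : MeasurableSet Ω' := by
      have ho : IsOpen Ω' := by
        have hc : ContinuousOn (deriv F) Ω := fun ζ hζ => (han ζ hζ).deriv.continuousAt.continuousWithinAt
        exact hc.isOpen_inter_preimage hΩ isOpen_compl_singleton
      exact ho.measurableSet
    rw [← lintegral_indicator hmΩ']
    congr 1
    ext ζ
    by_cases h1 : ζ ∈ Ω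
    · by_cases h2 : deriv F ζ = 0
      · rw [indicator_of_mem h1, indicator_of_notMem (fun h => h.2 h2), h2]; simp
      · rw [indicator_of_mem h1, indicator_of_mem (show ζ ∈ Ω' from ⟨h1, h2⟩)]
    · rw [indicator_of_notMem h1, indicator_of_notMem (fun h => h1 h.1)]
  rw [hEq]
  rcases t.eq_empty_or_nonempty with rfl | htn
  · have : Ω' = ∅ := by simpa using hcov
    rw [this]; simp
  obtain ⟨u, rfl⟩ := htc.exists_eq_range htn
  have huΩ : ∀ n, u n ∈ Ω' := fun n => ht (mem_range_self n)
  set A : ℕ → Set ℂ := disjointed (fun n => V (u n)) with hA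
  have hAm : ∀ n, MeasurableSet (A n) := fun n => MeasurableSet.disjointed (fun i => (hV2 _ (huΩ i)).measurableSet) n
  have hAV : ∀ n, A n ⊆ V (u n) := fun n => disjointed_subset _ n
  have hAd : Pairwise (Function.onFun Disjoint A) := disjoint_disjointed _
  have hsub : Ω' ⊆ ⋃ n, A n := by
    rw [hA, iUnion_disjointed]; simpa using hcov
  have hfd : ∀ n, ∀ ζ ∈ A n, HasFDerivWithinAt F ((ContinuousLinearMap.toSpanSingleton ℂ (deriv F ζ)).restrictScalars ℝ) (A n) ζ := by
    intro n ζ hζ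
    have := (han ζ (hV3 _ (huΩ n) (hAV n hζ))).differentiableAt.hasDerivAt.hasFDerivAt
    exact (this.restrictScalars ℝ).hasFDerivWithinAt
  have hinj : ∀ n, InjOn F (A n) := fun n => (hV4 _ (huΩ n)).mono (hAV n)
  have himg : ∀ n, MeasurableSet (F '' A n) := fun n => measurable_image_of_fderivWithin (hAm n) (hfd n) (hinj n)
  calc ∫⁻ ζ in Ω', ‖deriv F ζ‖ₑ ^ 2 ≤ ∫⁻ ζ in ⋃ n, A n, ‖deriv F ζ‖ₑ ^ 2 := lintegral_mono_set hsub
    _ = ∑' n, ∫⁻ ζ in A n, ‖deriv F ζ‖ₑ ^ 2 := lintegral_iUnion hAm hAd _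
    _ = ∑' n, volume (F '' A n) := by
      congr 1; ext n
      rw [← lintegral_abs_det_fderiv_eq_addHaar_image volume (hAm n) (hfd n) (hinj n)]
      congr 1; ext ζ
      rw [det_mulc, ENNReal.ofReal_pow (norm_nonneg _), ofReal_norm]
    _ = ∑' n, ∫⁻ w, (F '' A n).indicator 1 w := by
      congr 1; ext n; rw [lintegral_indicator_one (himg n)]
    _ = ∫⁻ w, ∑' n, (F '' A n).indicator 1 w := by
      rw [lintegral_tsum]; intro n; exact (measurable_one.indicator (himg n)).aemeasurable
    _ ≤ ∫⁻ w, B.indicator (fun _ => (N : ENNReal)) w := by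
      refine lintegral_mono fun w => ?_
      by_cases hw : w ∈ B
      · rw [indicator_of_mem hw]
        rw [ENNReal.tsum_eq_iSup_sum]
        refine iSup_le fun s => ?_
        have : ∑ n ∈ s, (F '' A n).indicator (1 : ℂ → ENNReal) w = ((s.filter fun n => w ∈ F '' A n).card : ENNReal) := by
          rw [Finset.card_filter, Nat.cast_sum]
          refine Finset.sum_congr rfl fun n _ => ?_
          by_cases h : w ∈ F '' A n
          · rw [indicator_of_mem h, if_pos h]; simp
          · rw [indicator_of_notMem h, if_neg h]; simp
        rw [this]
        have hp : ∀ n ∈ s.filter (fun n => w ∈ F '' A n), ∃ ζ ∈ A n, F ζ = w := fun n hn => (Finset.mem_filter.1 hn).2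
        choose! p hp1 hp2 using hp
        have h1 : ((s.filter fun n => w ∈ F '' A n) : Set ℕ).encard ≤ (Ω ∩ F ⁻¹' {w}).encard := by
          refine encard_le_encard_of_injOn (f := p) ?_ ?_
          · intro n hn
            exact ⟨hV3 _ (huΩ n) (hAV n (hp1 n hn)), hp2 n hn⟩
          · intro n hn m hm' e
            by_contra hnm
            exact (hAd hnm).le_bot ⟨hp1 n hn, e ▸ hp1 m hm'⟩
        have h2 := h1.trans (hN w)
        rw [encard_coe_eq_coe_finsetCard] at h2
        exact_mod_cast h2
      · have : ∀ n, w ∉ F '' A n := by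
          rintro n ⟨ζ, hζ, rfl⟩; exact hw (hm (hV3 _ (huΩ n) (hAV n hζ)))
        simp [indicator_of_notMem hw, indicator_of_notMem (this _)]
    _ = N * volume B := by rw [lintegral_indicator_const hB]
lemma first_exit {Ω : Set ℂ} (hΩ : IsOpen Ω) {F : ℂ → ℂ} {x : ℂ} {s : ℝ}
    (hbd : ∀ p ∈ closure Ω, p ∉ Ω → ∀ᶠ ζ in 𝓝[Ω] p, 3 / 2 * s < ‖F ζ - x‖)
    {p : ℝ → ℂ} (hp : Continuous p) {a b : ℝ} (hab : a ≤ b) (ha : p a ∈ Ω) (hb : p b ∉ Ω) :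
    ∃ b' ∈ Icc a b, (∀ θ ∈ Icc a b', p θ ∈ Ω) ∧ 3 / 2 * s < ‖F (p b') - x‖ := by
  have hS : IsCompact (Icc a b ∩ p ⁻¹' Ωᶜ) := isCompact_Icc.inter_right (hΩ.isClosed_compl.preimage hp)
  obtain ⟨c, hc, hmin⟩ := hS.exists_isLeast ⟨b, ⟨hab, le_rfl⟩, hb⟩
  have hac : a < c := lt_of_le_of_ne hc.1.1 (fun e => hc.2 (e ▸ ha))
  have hin : ∀ θ ∈ Ico a c, p θ ∈ Ω := by
    intro θ hθ
    by_contra hn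
    exact absurd (hmin ⟨⟨hθ.1, hθ.2.le.trans hc.1.2⟩, hn⟩) (not_le.2 hθ.2)
  have htend : Tendsto p (𝓝[<] c) (𝓝[Ω] (p c)) := by
    refine tendsto_nhdsWithin_iff.2 ⟨hp.continuousAt.mono_left nhdsWithin_le_nhds, ?_⟩
    filter_upwards [Ioo_mem_nhdsLT hac] with θ hθ using hin θ ⟨hθ.1.le, hθ.2⟩
  have hcl : p c ∈ closure Ω := by
    rw [mem_closure_iff_nhdsWithin_neBot]
    exact htend.neBot
  obtain ⟨b', h1, h2⟩ := ((htend.eventually (hbd _ hcl hc.2)).and (Ioo_mem_nhdsLT hac)).exists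
  exact ⟨b', ⟨h2.1.le, h2.2.le.trans hc.1.2⟩, fun θ hθ => hin θ ⟨hθ.1, hθ.2.trans_lt h2.2⟩, h1⟩

lemma first_exit' {Ω : Set ℂ} (hΩ : IsOpen Ω) {F : ℂ → ℂ} {x : ℂ} {s : ℝ}
    (hbd : ∀ p ∈ closure Ω, p ∉ Ω → ∀ᶠ ζ in 𝓝[Ω] p, 3 / 2 * s < ‖F ζ - x‖)
    {p : ℝ → ℂ} (hp : Continuous p) {a b : ℝ} (ha : p a ∈ Ω) (hb : p b ∉ Ω) :
    ∃ b' ∈ uIcc a b, (∀ θ ∈ uIcc a b', p θ ∈ Ω) ∧ 3 / 2 * s < ‖F (p b') - x‖ := by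
  rcases le_total a b with h | h
  · obtain ⟨b', h1, h2, h3⟩ := first_exit hΩ hbd hp h ha hb
    refine ⟨b', by rwa [uIcc_of_le h], by rwa [uIcc_of_le h1.1], h3⟩
  · obtain ⟨b', h1, h2, h3⟩ := first_exit hΩ hbd (p := fun θ => p (-θ)) (hp.comp continuous_neg) (neg_le_neg h) (by simpa using ha) (by simpa using hb)
    refine ⟨-b', ?_, ?_, h3⟩
    · rw [uIcc_of_ge h]; exact ⟨by linarith [h1.2], by linarith [h1.1]⟩
    · rw [uIcc_of_ge (by linarith [h1.1])]
      intro θ hθ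
      have := h2 (-θ) ⟨by linarith [hθ.2], by linarith [hθ.1]⟩
      simpa using this

lemma arc_len {Ω : Set ℂ} (hΩ : IsOpen Ω) {F : ℂ → ℂ} (hF : DifferentiableOn ℂ F Ω) {x : ℂ} {s t : ℝ}
    (hbd : ∀ p ∈ closure Ω, p ∉ Ω → ∀ᶠ ζ in 𝓝[Ω] p, 3 / 2 * s < ‖F ζ - x‖) (ht : 0 < t)
    (h1 : ∃ ζ ∈ Ω, ‖ζ‖ = t ∧ ‖F ζ - x‖ < s) (h2 : ∃ ζ, ζ ∉ Ω ∧ ‖ζ‖ = t) :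
    ENNReal.ofReal (s / 2) ≤ ∫⁻ θ in Ioo (-Real.pi) Real.pi, ENNReal.ofReal t * Ω.indicator (fun ζ => ‖deriv F ζ‖ₑ) (circleMap 0 t θ) := by
  obtain ⟨ζ1, hζ1, hn1, hs1⟩ := h1
  obtain ⟨ζ2, hζ2, hn2⟩ := h2
  have harg : ∀ ζ : ℂ, ‖ζ‖ = t → circleMap 0 t ζ.arg = ζ := by
    intro ζ h; rw [circleMap, zero_add, ← h, Complex.norm_mul_exp_arg_mul_I]
  have hIoc : ∀ ζ : ℂ, ζ.arg ∈ Ioc (-Real.pi) Real.pi := fun ζ => ⟨Complex.neg_pi_lt_arg _, Complex.arg_le_pi _⟩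
  obtain ⟨b, hb1, hb2, hb3⟩ := first_exit' hΩ hbd (p := circleMap 0 t) (continuous_circleMap 0 t) (a := ζ1.arg) (b := ζ2.arg)
    (by rwa [harg _ hn1]) (by rwa [harg _ hn2])
  have han : AnalyticOnNhd ℂ F Ω := hF.analyticOnNhd hΩ
  have hd : ∀ θ ∈ uIcc ζ1.arg b, HasDerivAt (fun θ => F (circleMap 0 t θ)) (deriv F (circleMap 0 t θ) * (circleMap 0 t θ * Complex.I)) θ := by
    intro θ hθ
    exact (han _ (hb2 θ hθ)).differentiableAt.hasDerivAt.comp_of_eq θ (hasDerivAt_circleMap 0 t θ) rfl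
  have hc : ContinuousOn (fun θ => deriv F (circleMap 0 t θ) * (circleMap 0 t θ * Complex.I)) (uIcc ζ1.arg b) := by
    intro θ hθ
    apply ContinuousAt.continuousWithinAt
    have := (han _ (hb2 θ hθ)).deriv.continuousAt
    have hcm := (continuous_circleMap 0 t).continuousAt (x := θ)
    exact (ContinuousAt.comp (g := deriv F) (f := circleMap 0 t) this hcm).mul (hcm.mul continuousAt_const)
  have hint := intervalIntegral.integral_eq_sub_of_hasDerivAt hd hc.intervalIntegrable
  have hsub : uIoc ζ1.arg b ⊆ Ioc (-Real.pi) Real.pi := by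
    have hb : b ∈ Ioc (-Real.pi) Real.pi := ordConnected_Ioc.uIcc_subset (hIoc ζ1) (hIoc ζ2) hb1
    exact uIoc_subset_uIcc.trans (ordConnected_Ioc.uIcc_subset (hIoc ζ1) hb)
  calc ENNReal.ofReal (s / 2) ≤ ENNReal.ofReal ‖F (circleMap 0 t b) - F (circleMap 0 t ζ1.arg)‖ := by
        apply ENNReal.ofReal_le_ofReal
        rw [harg _ hn1]
        have := norm_sub_norm_le (F (circleMap 0 t b) - x) (F ζ1 - x)
        rw [sub_sub_sub_cancel_right] at this
        linarith
    _ = ‖∫ θ in uIoc ζ1.arg b, deriv F (circleMap 0 t θ) * (circleMap 0 t θ * Complex.I)‖ₑ := by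
        rw [← hint, intervalIntegral.norm_integral_eq_norm_integral_uIoc, ofReal_norm]
    _ ≤ ∫⁻ θ in uIoc ζ1.arg b, ‖deriv F (circleMap 0 t θ) * (circleMap 0 t θ * Complex.I)‖ₑ := enorm_integral_le_lintegral_enorm _
    _ = ∫⁻ θ in uIoc ζ1.arg b, ENNReal.ofReal t * Ω.indicator (fun ζ => ‖deriv F ζ‖ₑ) (circleMap 0 t θ) := by
        refine setLIntegral_congr_fun measurableSet_uIoc fun θ hθ => ?_
        simp only [indicator_of_mem (hb2 θ (uIoc_subset_uIcc hθ))]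
        rw [← ofReal_norm, ← ofReal_norm, ← ENNReal.ofReal_mul ht.le, norm_mul, norm_mul, norm_circleMap_zero, Complex.norm_I, mul_one, mul_comm, abs_of_pos ht]
    _ ≤ ∫⁻ θ in Ioc (-Real.pi) Real.pi, ENNReal.ofReal t * Ω.indicator (fun ζ => ‖deriv F ζ‖ₑ) (circleMap 0 t θ) := lintegral_mono_set hsub
    _ = _ := by rw [setLIntegral_congr Ioo_ae_eq_Ioc]
end CSphere
end

noncomputable section
open Set Metric Topology Filter
namespace CSphere
open MeasureTheory

lemma amgm_e {t s : ℝ} (hs : 0 < s) (ht : 0 < t) (Ω : Set ℂ) (F : ℂ → ℂ) (ζ : ℂ) :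
    ENNReal.ofReal t * Ω.indicator (fun ζ => ‖deriv F ζ‖ₑ) ζ ≤
      ENNReal.ofReal (s / (8 * Real.pi)) + ENNReal.ofReal (2 * Real.pi / s * t) * (ENNReal.ofReal t * Ω.indicator (fun ζ => ‖deriv F ζ‖ₑ ^ 2) ζ) := by
  by_cases h : ζ ∈ Ω
  · rw [indicator_of_mem h, indicator_of_mem h]
    set a := ‖deriv F ζ‖ with ha
    have hp := Real.pi_pos
    rw [← ofReal_norm, ← ENNReal.ofReal_pow (norm_nonneg _), ← ENNReal.ofReal_mul ht.le, ← ENNReal.ofReal_mul ht.le, ← ENNReal.ofReal_mul (by positivity),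
      ← ENNReal.ofReal_add (by positivity) (by positivity)]
    apply ENNReal.ofReal_le_ofReal
    rw [← ha]
    have : s / (8 * Real.pi) + 2 * Real.pi / s * t * (t * a ^ 2) - t * a = (s - 4 * Real.pi * t * a) ^ 2 / (8 * Real.pi * s) := by
      field_simp; ring
    have h2 : 0 ≤ (s - 4 * Real.pi * t * a) ^ 2 / (8 * Real.pi * s) := by positivity
    linarith
  · rw [indicator_of_notMem h]; simp

lemma arc_area {Ω : Set ℂ} (hΩ : IsOpen Ω) {F : ℂ → ℂ} (hF : DifferentiableOn ℂ F Ω) {x : ℂ} {s t : ℝ}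
    (hbd : ∀ p ∈ closure Ω, p ∉ Ω → ∀ᶠ ζ in 𝓝[Ω] p, 3 / 2 * s < ‖F ζ - x‖) (ht : 0 < t) (hs : 0 < s)
    (h1 : ∃ ζ ∈ Ω, ‖ζ‖ = t ∧ ‖F ζ - x‖ < s) (h2 : ∃ ζ, ζ ∉ Ω ∧ ‖ζ‖ = t) :
    ENNReal.ofReal (s ^ 2 / (8 * Real.pi) * t⁻¹) ≤ ∫⁻ θ in Ioo (-Real.pi) Real.pi, ENNReal.ofReal t * Ω.indicator (fun ζ => ‖deriv F ζ‖ₑ ^ 2) (circleMap 0 t θ) := by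
  have h := arc_len hΩ hF hbd ht h1 h2
  have hp := Real.pi_pos
  set I := ∫⁻ θ in Ioo (-Real.pi) Real.pi, ENNReal.ofReal t * Ω.indicator (fun ζ => ‖deriv F ζ‖ₑ ^ 2) (circleMap 0 t θ) with hI
  have h3 : ENNReal.ofReal (s / 2) ≤ ENNReal.ofReal (s / 4) + ENNReal.ofReal (2 * Real.pi / s * t) * I := by
    refine h.trans ((lintegral_mono fun θ => amgm_e hs ht Ω F _).trans ?_)
    rw [lintegral_add_left measurable_const]
    rw [lintegral_const_mul' _ _ ENNReal.ofReal_ne_top]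
    gcongr
    rw [setLIntegral_const, Real.volume_Ioo, ← ENNReal.ofReal_mul (by positivity)]
    apply ENNReal.ofReal_le_ofReal
    apply le_of_eq; field_simp; ring
  by_cases hIt : I = ⊤
  · rw [hIt]; exact le_top
  rw [← ENNReal.ofReal_toReal hIt] at h3 ⊢
  rw [← ENNReal.ofReal_mul (by positivity), ← ENNReal.ofReal_add (by positivity) (by positivity)] at h3
  rw [ENNReal.ofReal_le_ofReal_iff (by positivity)] at h3
  apply ENNReal.ofReal_le_ofReal
  have e : s ^ 2 / (8 * Real.pi) * t⁻¹ = s / 4 / (2 * Real.pi / s * t) := by field_simp; ring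
  rw [e, div_le_iff₀ (by positivity)]
  linarith

lemma annulus_area {Ω : Set ℂ} (hΩ : IsOpen Ω) {F : ℂ → ℂ} (hF : DifferentiableOn ℂ F Ω) {x : ℂ} {s : ℝ}
    (hbd : ∀ p ∈ closure Ω, p ∉ Ω → ∀ᶠ ζ in 𝓝[Ω] p, 3 / 2 * s < ‖F ζ - x‖) (hs : 0 < s) {r K : ℝ} (hr : 0 < r) (hK : 1 < K)
    (h1 : ∀ t ∈ Ioo r (K * r), ∃ ζ ∈ Ω, ‖ζ‖ = t ∧ ‖F ζ - x‖ < s) (h2 : ∀ t ∈ Ioo r (K * r), ∃ ζ, ζ ∉ Ω ∧ ‖ζ‖ = t) :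
    ENNReal.ofReal (s ^ 2 / (8 * Real.pi) * Real.log K) ≤ ∫⁻ ζ in Ω, ‖deriv F ζ‖ₑ ^ 2 := by
  have hp := Real.pi_pos
  have hrK : r < K * r := by nlinarith
  rw [← lintegral_indicator hΩ.measurableSet, ← Complex.lintegral_comp_polarCoord_symm]
  rw [polarCoord_target]
  have hmeas : Measurable (Ω.indicator fun ζ => ‖deriv F ζ‖ₑ ^ 2) :=
    ((measurable_deriv F).enorm.pow_const 2).indicator hΩ.measurableSet
  have hcirc : ∀ p : ℝ × ℝ, Complex.polarCoord.symm p = circleMap 0 p.1 p.2 := by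
    intro p; rw [Complex.polarCoord_symm_apply, circleMap, zero_add, Complex.exp_mul_I]; 
    simp
  simp_rw [hcirc]
  rw [Measure.volume_eq_prod, setLIntegral_prod _ (by
    apply Measurable.aemeasurable
    apply Measurable.mul
    · exact measurable_fst.ennreal_ofReal
    · apply hmeas.comp
      apply Continuous.measurable
      unfold circleMap; fun_prop)]
  calc ENNReal.ofReal (s ^ 2 / (8 * Real.pi) * Real.log K) = ∫⁻ t in Ioo r (K * r), ENNReal.ofReal (s ^ 2 / (8 * Real.pi) * t⁻¹) := by
        rw [← setLIntegral_congr Ioo_ae_eq_Ioc.symm, ← ofReal_integral_eq_lintegral_ofReal]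
        · rw [integral_const_mul, ← intervalIntegral.integral_of_le hrK.le, integral_inv_of_pos hr (by positivity)]
          rw [mul_div_assoc, div_self hr.ne', mul_one]
        · have : IntervalIntegrable (fun t : ℝ => t⁻¹) volume r (K * r) := by
            apply ContinuousOn.intervalIntegrable
            apply ContinuousOn.inv₀ continuousOn_id
            intro t ht; rw [uIcc_of_le hrK.le] at ht; exact (hr.trans_le ht.1).ne'
          rw [intervalIntegrable_iff_integrableOn_Ioc_of_le hrK.le] at this
          exact this.const_mul _
        · refine (ae_restrict_iff' measurableSet_Ioc).2 (Eventually.of_forall fun t ht => ?_)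
          have := hr.trans ht.1
          simp only [Pi.zero_apply]; positivity
    _ ≤ ∫⁻ t in Ioo r (K * r), ∫⁻ θ in Ioo (-Real.pi) Real.pi, ENNReal.ofReal t * Ω.indicator (fun ζ => ‖deriv F ζ‖ₑ ^ 2) (circleMap 0 t θ) := by
        refine setLIntegral_mono' measurableSet_Ioo fun t ht => arc_area hΩ hF hbd (hr.trans ht.1) hs (h1 t ht) (h2 t ht)
    _ ≤ _ := lintegral_mono_set (fun t ht => hr.trans ht.1)

lemma good_circle (N : ℕ) : ∃ K : ℝ, 1 < K ∧ ∀ {Ω : Set ℂ} (_ : IsOpen Ω) {F : ℂ → ℂ} (_ : DifferentiableOn ℂ F Ω) {x : ℂ} {s : ℝ}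
    (_ : ∀ p ∈ closure Ω, p ∉ Ω → ∀ᶠ ζ in 𝓝[Ω] p, 3 / 2 * s < ‖F ζ - x‖) (_ : 0 < s) 
    (_ : ∀ w, (Ω ∩ F ⁻¹' {w}).encard ≤ N) (_ : MapsTo F Ω (ball x (2 * s))) {r : ℝ} (_ : 0 < r)
    (_ : ∀ t ∈ Ioo r (K * r), ∃ ζ ∈ Ω, ‖ζ‖ = t ∧ ‖F ζ - x‖ < s), ∃ t ∈ Ioo r (K * r), ∀ ζ : ℂ, ‖ζ‖ = t → ζ ∈ Ω := by
  have hp := Real.pi_pos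
  refine ⟨Real.exp (32 * Real.pi ^ 2 * N + 1), Real.one_lt_exp_iff.2 (by positivity), ?_⟩
  intro Ω hΩ F hF x s hbd hs hN hm r hr h1
  by_contra! hcon
  have h2 := annulus_area hΩ hF hbd hs hr (Real.one_lt_exp_iff.2 (by positivity)) h1 (fun t ht => by
    obtain ⟨ζ, h, h'⟩ := hcon t ht; exact ⟨ζ, h', h⟩)
  have h3 := area_mult hΩ hF hN measurableSet_ball hm
  have h4 := h2.trans h3
  rw [Complex.volume_ball, Real.log_exp] at h4
  have e : (N : ENNReal) * (ENNReal.ofReal (2 * s) ^ 2 * NNReal.pi) = ENNReal.ofReal (N * ((2 * s) ^ 2 * Real.pi)) := by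
    rw [ENNReal.ofReal_mul (p := (N:ℝ)) (by positivity), ENNReal.ofReal_natCast, ENNReal.ofReal_mul (p := (2 * s) ^ 2) (by positivity), ENNReal.ofReal_pow (by positivity)]
    congr 2
    rw [← ENNReal.ofReal_coe_nnreal]; rfl
  rw [e, ENNReal.ofReal_le_ofReal_iff (by positivity)] at h4
  have : s ^ 2 / (8 * Real.pi) * (32 * Real.pi ^ 2 * ↑N + 1) = N * ((2 * s) ^ 2 * Real.pi) + s ^ 2 / (8 * Real.pi) := by
    field_simp; ring
  have h5 : 0 < s ^ 2 / (8 * Real.pi) := by positivity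
  linarith
end CSphere
end

noncomputable section
open Set Metric Topology Filter
namespace CSphere

lemma ring_conn (x : ℂ) {S : Set ℝ} (hS : IsPreconnected S) (hp : ∀ t ∈ S, 0 ≤ t) : IsPreconnected {ζ : ℂ | ‖ζ - x‖ ∈ S} := by
  have : {ζ : ℂ | ‖ζ - x‖ ∈ S} = (fun p : ℝ × ℝ => circleMap x p.1 p.2) '' (S ×ˢ univ) := by
    ext ζ; constructor
    · intro h
      refine ⟨(‖ζ - x‖, (ζ - x).arg), ⟨h, mem_univ _⟩, ?_⟩
      simp only [circleMap]; rw [Complex.norm_mul_exp_arg_mul_I]; ring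
    · rintro ⟨p, hp', rfl⟩
      simp only [mem_ofPred_eq, circleMap, add_sub_cancel_left, norm_mul, Complex.norm_exp_ofReal_mul_I, mul_one,
        Complex.norm_real, Real.norm_eq_abs]
      rw [abs_of_nonneg (hp _ hp'.1)]; exact hp'.1
  rw [this]
  refine (hS.prod isPreconnected_univ).image _ (Continuous.continuousOn ?_)
  unfold circleMap; fun_prop

structure Pl (f : CSphere → CSphere) (c' : Cht) (x : ℂ) (s : ℝ) (N : ℕ) (V W : Set CSphere) : Prop where
  sp : 0 < s
  op : IsOpen W
  im : f '' W ⊆ c'.D x (2 * s)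
  cl : ∀ p ∈ closure W, f p ∈ c'.D x (2 * s) → p ∈ W
  nf : ∀ w, (W ∩ f ⁻¹' {w}).ncard ≤ N
  vw : V ⊆ W
  vc : IsPreconnected V
  vi : f '' V ⊆ c'.D x s

lemma meets_circle (c : Cht) {V : Set CSphere} (hV : IsPreconnected V) {t : ℝ} {e : CSphere} (he : e ∈ V)
    (he' : e ∈ c.D 0 t) (hn : ¬ V ⊆ c.D 0 t) : ∃ ζ : ℂ, ‖ζ‖ = t ∧ c.κ ζ ∈ V := by
  by_contra! h
  have hK : IsClosed (c.κ '' closedBall 0 t) := ((isCompact_closedBall _ _).image c.κ_cont).isClosed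
  apply hn
  refine hV.subset_left_of_subset_union (c.D_open 0 t) hK.isOpen_compl ?_ ?_ ⟨e, he, he'⟩
  · rw [Set.disjoint_compl_right_iff_subset]; exact image_mono ball_subset_closedBall
  · intro p hp
    by_cases hp' : p ∈ c.κ '' closedBall 0 t
    · left
      obtain ⟨ζ, hζ, rfl⟩ := hp'
      refine ⟨ζ, ?_, rfl⟩
      have h1 := h ζ
      simp at hζ ⊢
      exact lt_of_le_of_ne hζ (fun e => h1 e hp)
    · exact Or.inr hp'

def Kc (N : ℕ) : ℝ := (good_circle N).choose
lemma Kc_one (N : ℕ) : 1 < Kc N := (good_circle N).choose_spec.1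

lemma ring_pre {f : CSphere → CSphere} (hf : Hol f) {c' : Cht} {x : ℂ} {s r1 : ℝ} {W : Set CSphere}
    (op : IsOpen W) (cl : ∀ p ∈ closure W, f p ∈ c'.D x s → p ∈ W) (im : f '' W ⊆ c'.D x s) (hr0 : 0 ≤ r1) (hr : r1 < s)
    {C Q : Set CSphere} (hC : IsCompact C) (hCc : IsPreconnected C) (hQ : IsOpen Q) (hQC : Q ⊆ C)
    (hb : ∀ p ∈ C, p ∉ Q → p ∈ W ∧ ‖c'.τ (f p) - x‖ ≤ r1) (hne : ∃ p ∈ C, p ∉ Q) (hW : ¬ C ⊆ W)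
    {w : ℂ} (hw : ‖w - x‖ ∈ Ioo r1 s) : ∃ p ∈ Q ∩ W, f p = c'.κ w := by
  have hτ : ∀ p ∈ W, f p ≠ c'.pole ∧ ‖c'.τ (f p) - x‖ < s := fun p hp => c'.mem_D.1 (im ⟨p, hp, rfl⟩)
  set A := c'.κ '' {ζ : ℂ | ‖ζ - x‖ ∈ Ioo r1 s} with hA
  have hAc : IsPreconnected A := (ring_conn x isPreconnected_Ioo (fun t ht => hr0.trans ht.1.le)).image _ c'.κ_cont.continuousOn
  have hAD : A ⊆ c'.D x s := by
    rintro _ ⟨ζ, hζ, rfl⟩; exact c'.κ_mem_D.2 hζ.2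
  -- some point
  have h1 : ∃ p ∈ C ∩ W, r1 < ‖c'.τ (f p) - x‖ := by
    by_contra! hcon
    have hKc : IsClosed (f ⁻¹' (c'.κ '' closedBall x r1) ∩ closure W) :=
      (((isCompact_closedBall _ _).image c'.κ_cont).isClosed.preimage hf.cont).inter isClosed_closure
    have hsub : f ⁻¹' (c'.κ '' closedBall x r1) ∩ closure W ⊆ W := by
      rintro p ⟨⟨ζ, hζ, e⟩, h2⟩
      refine cl p h2 ?_
      rw [← e, c'.κ_mem_D]
      rw [mem_closedBall, dist_eq_norm] at hζ; linarith
    have hsub2 : C ∩ W ⊆ f ⁻¹' (c'.κ '' closedBall x r1) ∩ closure W := by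
      intro p hp
      refine ⟨⟨c'.τ (f p), ?_, c'.κτ (hτ p hp.2).1⟩, subset_closure hp.2⟩
      rw [mem_closedBall, dist_eq_norm]; exact hcon p hp
    obtain ⟨p, hp, hp'⟩ := hne
    obtain ⟨q, hq, hq'⟩ := not_subset.1 hW
    obtain ⟨y, hy, hy1, hy2⟩ := hCc W (f ⁻¹' (c'.κ '' closedBall x r1) ∩ closure W)ᶜ op hKc.isOpen_compl (fun y hy => by
        by_cases h : y ∈ W
        · exact Or.inl h
        · exact Or.inr (fun h' => h (hsub h'))) ⟨p, hp, (hb p hp hp').1⟩ ⟨q, hq, fun h => hq' (hsub h)⟩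
    exact hy2 (hsub2 ⟨hy, hy1⟩)
  have hopen : IsOpen (f '' (Q ∩ W)) := hf.isOpenMap _ (hQ.inter op)
  have hclosed : IsClosed (f '' (C ∩ closure W)) := ((hC.inter_right isClosed_closure).image hf.cont).isClosed
  have hkey : ∀ q ∈ A, q ∈ f '' (C ∩ closure W) → q ∈ f '' (Q ∩ W) := by
    rintro _ ⟨ζ, hζ, rfl⟩ ⟨p, hp, e⟩
    have hpW : p ∈ W := cl p hp.2 (by rw [e, c'.κ_mem_D]; exact hζ.2)
    refine ⟨p, ⟨?_, hpW⟩, e⟩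
    by_contra hpQ
    have := (hb p hp.1 hpQ).2
    rw [e, c'.τκ] at this
    exact absurd hζ.1 (not_lt.2 this)
  have hall : A ⊆ f '' (Q ∩ W) := by
    by_contra hcon
    obtain ⟨q, hq, hq'⟩ := not_subset.1 hcon
    obtain ⟨p, hp, hp'⟩ := h1
    have hpA : f p ∈ A := ⟨c'.τ (f p), ⟨hp', (hτ p hp.2).2⟩, c'.κτ (hτ p hp.2).1⟩
    obtain ⟨y, hy, hy1, hy2⟩ := hAc (f '' (Q ∩ W)) (f '' (C ∩ closure W))ᶜ hopen hclosed.isOpen_compl (fun y hy => by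
        by_cases h : y ∈ f '' (C ∩ closure W)
        · exact Or.inl (hkey y hy h)
        · exact Or.inr h) ⟨f p, hpA, hkey _ hpA ⟨p, ⟨hp.1, subset_closure hp.2⟩, rfl⟩⟩
        ⟨q, hq, fun h => hq' (hkey _ hq h)⟩
    refine hy2 (image_mono ?_ hy1)
    exact inter_subset_inter hQC subset_closure
  obtain ⟨p, hp, e⟩ := hall ⟨w, hw, rfl⟩
  exact ⟨p, hp, e⟩

lemma Pl.circle {f : CSphere → CSphere} (hf : Hol f) {c' : Cht} {x : ℂ} {s : ℝ} {N : ℕ} {V W : Set CSphere}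
    (h : Pl f c' x s N V W) (c : Cht) {r : ℝ} (hr : 0 < r) {e : CSphere} (he : e ∈ V) (he' : e ∈ c.D 0 r)
    (hn : ¬ V ⊆ c.D 0 (Kc N * r)) : ∃ t ∈ Ioo r (Kc N * r), ∀ ζ : ℂ, ‖ζ‖ = t → c.κ ζ ∈ W := by
  have hτ : ∀ p ∈ W, f p ≠ c'.pole ∧ ‖c'.τ (f p) - x‖ < 2 * s := fun p hp => c'.mem_D.1 (h.im ⟨p, hp, rfl⟩)
  refine (good_circle N).choose_spec.2 (Ω := c.κ ⁻¹' W) (h.op.preimage c.κ_cont) (F := fun ζ => c'.τ (f (c.κ ζ)))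
    (fun ζ hζ => (hf.anc c c' (hτ _ hζ).1).differentiableAt.differentiableWithinAt) (x := x) (s := s) ?_ h.sp ?_ ?_ hr ?_
  · intro p hp hp'
    have hpc : c.κ p ∈ closure W := by
      have := image_closure_subset_closure_image c.κ_cont (s := c.κ ⁻¹' W) ⟨p, hp, rfl⟩
      exact closure_mono (image_preimage_subset _ _) this
    have hfp : f (c.κ p) ∉ c'.κ '' closedBall x (3 / 2 * s) := by
      rintro ⟨ζ, hζ, e⟩
      apply hp'
      apply h.cl _ hpc
      rw [← e, c'.κ_mem_D]
      rw [mem_closedBall, dist_eq_norm] at hζ; linarith [h.sp]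
    have hcl : IsClosed (c'.κ '' closedBall x (3 / 2 * s)) := ((isCompact_closedBall _ _).image c'.κ_cont).isClosed
    have hev : ∀ᶠ ζ in 𝓝 p, f (c.κ ζ) ∉ c'.κ '' closedBall x (3 / 2 * s) :=
      (hf.cont.comp c.κ_cont).continuousAt.eventually (hcl.isOpen_compl.mem_nhds hfp)
    filter_upwards [nhdsWithin_le_nhds hev, self_mem_nhdsWithin] with ζ h1 h2
    by_contra h3
    apply h1
    refine ⟨c'.τ (f (c.κ ζ)), ?_, c'.κτ (hτ _ h2).1⟩
    rw [mem_closedBall, dist_eq_norm]; exact not_lt.1 h3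
  · intro w
    have hfi : (W ∩ f ⁻¹' {c'.κ w}).Finite := (hf.finfib _).subset inter_subset_right
    refine (encard_le_encard_of_injOn (f := c.κ) (t := W ∩ f ⁻¹' {c'.κ w}) ?_ c.κ_inj.injOn).trans ?_
    · rintro ζ ⟨h1, h2⟩
      refine ⟨h1, ?_⟩
      simp only [mem_preimage, mem_singleton_iff] at h2 ⊢
      rw [← h2, c'.κτ (hτ _ h1).1]
    · rw [← hfi.cast_ncard_eq]; exact_mod_cast h.nf _
  · intro ζ hζ; rw [mem_ball, dist_eq_norm]; exact (hτ _ hζ).2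
  · intro t ht
    have hsub1 : c.D 0 r ⊆ c.D 0 t := c.D_mono (ball_subset_ball ht.1.le)
    have hsub2 : c.D 0 t ⊆ c.D 0 (Kc N * r) := c.D_mono (ball_subset_ball ht.2.le)
    obtain ⟨ζ, h1, h2⟩ := meets_circle c h.vc he (hsub1 he') (fun h' => hn (h'.trans hsub2))
    exact ⟨ζ, h.vw h2, h1, (c'.mem_D.1 (h.vi ⟨_, h2, rfl⟩)).2⟩

lemma Pl.ring {f : CSphere → CSphere} (hf : Hol f) {c' : Cht} {x : ℂ} {s : ℝ} {N : ℕ} {V W : Set CSphere}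
    (h : Pl f c' x s N V W) (c : Cht) {r : ℕ → ℝ} (hr : ∀ i, 0 < r i) (hr' : ∀ i, Kc N * r (i + 1) < r i)
    {e : CSphere} (he : e ∈ V) (he' : e ∈ c.D 0 (r (N + 1)))
    (hn : ¬ V ⊆ c.D 0 (Kc N * r 0)) : ∃ i ≤ N, c.κ '' {ζ : ℂ | Kc N * r (i + 1) < ‖ζ‖ ∧ ‖ζ‖ < r i} ⊆ W := by
  have hK := Kc_one N
  have hτ : ∀ p ∈ W, f p ≠ c'.pole ∧ ‖c'.τ (f p) - x‖ < 2 * s := fun p hp => c'.mem_D.1 (h.im ⟨p, hp, rfl⟩)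
  have hanti : Antitone r := antitone_nat_of_succ_le fun i => by nlinarith [hr' i, hr (i + 1)]
  have hcirc : ∀ i : Fin (N + 2), ∃ t ∈ Ioo (r i) (Kc N * r i), ∀ ζ : ℂ, ‖ζ‖ = t → c.κ ζ ∈ W := by
    intro i
    refine h.circle hf c (hr i) he ((c.D_mono (ball_subset_ball (hanti (by omega)))) he') (fun h' => hn (h'.trans ?_))
    have := hanti (Nat.zero_le i)
    exact c.D_mono (ball_subset_ball (by gcongr))
  choose t ht1 ht2 using hcirc
  have htp : ∀ i, 0 < t i := fun i => (hr i).trans (ht1 i).1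
  -- compactness bound
  have hbnd : ∃ r1, 0 ≤ r1 ∧ r1 < 2 * s ∧ ∀ i, ∀ ζ : ℂ, ‖ζ‖ = t i → ‖c'.τ (f (c.κ ζ)) - x‖ ≤ r1 := by
    have hcomp : IsCompact (⋃ i, sphere (0:ℂ) (t i)) := isCompact_iUnion fun i => isCompact_sphere _ _
    have hcont : ContinuousOn (fun ζ => ‖c'.τ (f (c.κ ζ)) - x‖) (⋃ i, sphere (0:ℂ) (t i)) := by
      intro ζ hζ
      obtain ⟨i, hi⟩ := mem_iUnion.1 hζ
      have := (hf.anc c c' (hτ _ (ht2 i ζ (by simpa using hi))).1).continuousAt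
      exact (this.sub continuousAt_const).norm.continuousWithinAt
    obtain ⟨ζ, hζ, hmax⟩ := hcomp.exists_isMaxOn ⟨(t 0 : ℂ), mem_iUnion.2 ⟨0, by simp [abs_of_pos (htp 0)]⟩⟩ hcont
    obtain ⟨i, hi⟩ := mem_iUnion.1 hζ
    refine ⟨_, norm_nonneg _, (hτ _ (ht2 i ζ (by simpa using hi))).2, fun j ξ hξ => hmax (mem_iUnion.2 ⟨j, by simpa using hξ⟩)⟩
  obtain ⟨r1, hr0, hr1, hbd⟩ := hbnd
  by_contra! hcon
  set w : ℂ := x + ((r1 + 2 * s) / 2 : ℝ) with hw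
  have hwn : ‖w - x‖ ∈ Ioo r1 (2 * s) := by
    rw [hw, add_sub_cancel_left, Complex.norm_real, Real.norm_eq_abs, abs_of_nonneg (by linarith)]
    constructor <;> linarith
  have hpts : ∀ i : Fin (N + 1), ∃ ζ : ℂ, t i.succ < ‖ζ‖ ∧ ‖ζ‖ < t i.castSucc ∧ c.κ ζ ∈ W ∩ f ⁻¹' {c'.κ w} := by
    intro i
    have hlt : t i.succ < t i.castSucc := by
      have h1 := (ht1 i.succ).2; have h2 := (ht1 i.castSucc).1; have h3 := hr' i
      simp only [Fin.val_succ, Fin.val_castSucc] at h1 h2; linarith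
    have heq : c.κ '' {ζ : ℂ | ‖ζ - 0‖ ∈ Icc (t i.succ) (t i.castSucc)} = c.κ '' (closedBall 0 (t i.castSucc) ∩ {ζ : ℂ | t i.succ ≤ ‖ζ‖}) := by
      congr 1; ext ζ; simp [and_comm]
    obtain ⟨p, ⟨⟨ζ, hζ, rfl⟩, hpW⟩, hp⟩ := ring_pre hf (c' := c') (x := x) (s := 2 * s) (r1 := r1) h.op h.cl h.im hr0 hr1
      (C := c.κ '' {ζ : ℂ | ‖ζ - 0‖ ∈ Icc (t i.succ) (t i.castSucc)}) (Q := c.κ '' {ζ : ℂ | t i.succ < ‖ζ‖ ∧ ‖ζ‖ < t i.castSucc})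
      (by
        rw [heq]
        exact ((isCompact_closedBall _ _).inter_right (isClosed_le continuous_const continuous_norm)).image c.κ_cont)
      ((ring_conn 0 isPreconnected_Icc (fun u hu => (htp _).le.trans hu.1)).image _ c.κ_cont.continuousOn)
      (c.κ_open ((isOpen_lt continuous_const continuous_norm).inter (isOpen_lt continuous_norm continuous_const)))
      (image_mono (fun ζ hζ => by simp only [mem_ofPred_eq, sub_zero] at hζ ⊢; exact ⟨hζ.1.le, hζ.2.le⟩))
      (by
        rintro _ ⟨ζ, hζ, rfl⟩ hnot
        have : ‖ζ‖ = t i.succ ∨ ‖ζ‖ = t i.castSucc := by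
          by_contra! hc
          simp only [mem_ofPred_eq, sub_zero] at hζ
          exact hnot ⟨ζ, ⟨lt_of_le_of_ne hζ.1 hc.1.symm, lt_of_le_of_ne hζ.2 hc.2⟩, rfl⟩
        rcases this with h' | h'
        · exact ⟨ht2 _ ζ h', hbd _ ζ h'⟩
        · exact ⟨ht2 _ ζ h', hbd _ ζ h'⟩)
      (by
        have hn : ‖((t i.succ : ℝ) : ℂ)‖ = t i.succ := by simp [abs_of_pos (htp _)]
        refine ⟨c.κ (t i.succ : ℂ), ⟨_, ?_, rfl⟩, ?_⟩
        · simp only [mem_ofPred_eq, sub_zero, hn]; exact ⟨le_rfl, hlt.le⟩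
        · rintro ⟨ζ, hζ, e⟩
          rw [c.κ_inj e] at hζ
          simp only [mem_ofPred_eq, hn, lt_irrefl, false_and] at hζ)
      (by
        intro hsub
        refine hcon i (by omega) (Subset.trans (image_mono ?_) hsub)
        intro ζ hζ
        have h1 := (ht1 i.succ).2; have h2 := (ht1 i.castSucc).1
        simp only [Fin.val_succ, Fin.val_castSucc] at h1 h2
        simp only [mem_ofPred_eq, sub_zero] at hζ ⊢
        exact ⟨by linarith [hζ.1], by linarith [hζ.2]⟩) hwn
    exact ⟨ζ, hζ.1, hζ.2, hpW, hp⟩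
  choose ζ hζ1 hζ2 hζ3 using hpts
  have hord : ∀ i j : Fin (N + 1), i < j → ‖ζ j‖ < ‖ζ i‖ := by
    intro i j hij
    have h1 := hζ2 j
    have h2 := hζ1 i
    have htanti : t j.castSucc ≤ t i.succ := by
      rcases eq_or_lt_of_le (show (i : ℕ) + 1 ≤ j from hij) with e | e
      · have : i.succ = j.castSucc := by ext; simp [e]
        rw [this]
      · have h3 := (ht1 j.castSucc).2
        have h4 := (ht1 i.succ).1
        have h5 := hr' (i + 1)
        have h6 : r j ≤ r (i + 1 + 1) := hanti (by omega)
        simp only [Fin.val_succ, Fin.val_castSucc] at h3 h4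
        nlinarith
    linarith
  have hinj : Function.Injective (fun i => c.κ (ζ i)) := by
    intro i j hij
    have := c.κ_inj hij
    rcases lt_trichotomy i j with h' | h' | h'
    · have := hord i j h'; simp_all
    · exact h'
    · have := hord j i h'; simp_all
  have hfi : (W ∩ f ⁻¹' {c'.κ w}).Finite := (hf.finfib _).subset inter_subset_right
  have h1 : (range fun i => c.κ (ζ i)).ncard = N + 1 := by
    rw [← image_univ, ncard_image_of_injective _ hinj, ncard_univ]; simp
  have h2 : (range fun i => c.κ (ζ i)).ncard ≤ (W ∩ f ⁻¹' {c'.κ w}).ncard :=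
    ncard_le_ncard (range_subset_iff.2 hζ3) hfi
  have := h.nf (c'.κ w)
  omega

lemma comp_closed {f : CSphere → CSphere} {D : Set CSphere} {y : CSphere}
    {p : CSphere} (hp : p ∈ closure (connectedComponentIn (f ⁻¹' D) y)) (hpD : f p ∈ D) : p ∈ connectedComponentIn (f ⁻¹' D) y := by
  by_cases hy : y ∈ f ⁻¹' D
  · have h1 : IsPreconnected (insert p (connectedComponentIn (f ⁻¹' D) y)) :=
      isPreconnected_connectedComponentIn.subset_closure (subset_insert _ _) (insert_subset hp subset_closure)
    exact h1.subset_connectedComponentIn (mem_insert_of_mem _ (mem_connectedComponentIn hy))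
      (insert_subset hpD (connectedComponentIn_subset _ _)) (mem_insert _ _)
  · rw [connectedComponentIn_eq_empty hy] at hp; simp at hp

lemma comp_sub {f : CSphere → CSphere} {D : Set CSphere} {y : CSphere} {V : Set CSphere} (hV : IsPreconnected V)
    (hD : f '' V ⊆ D) (hy : y ∈ V) : V ⊆ connectedComponentIn (f ⁻¹' D) y :=
  hV.subset_connectedComponentIn hy (image_subset_iff.1 hD)

lemma mkPl {f : CSphere → CSphere} (hf : Hol f) {c' : Cht} {x : ℂ} {s : ℝ} {N : ℕ} {V : Set CSphere} (hs : 0 < s)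
    (hV : IsPreconnected V) (hVi : f '' V ⊆ c'.D x s) {e : CSphere} (he : e ∈ V)
    (hN : ∀ w, (connectedComponentIn (f ⁻¹' c'.D x (2 * s)) e ∩ f ⁻¹' {w}).ncard ≤ N) :
    Pl f c' x s N V (connectedComponentIn (f ⁻¹' c'.D x (2 * s)) e) where
  sp := hs
  op := ((c'.D_open _ _).preimage hf.cont).connectedComponentIn
  im := image_subset_iff.2 (connectedComponentIn_subset _ _)
  cl := fun _ => comp_closed
  nf := hN
  vw := comp_sub hV (hVi.trans (c'.D_mono (ball_subset_ball (by linarith)))) he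
  vc := hV
  vi := hVi

lemma small_of_sub {ε : ℝ} {e : CSphere} {V : Set CSphere} (h : V ⊆ ball e (ε / 2)) : Small ε V := by
  intro x hx y hy
  have h1 := h hx; have h2 := h hy
  rw [mem_ball] at h1 h2
  linarith [dist_triangle_right x y e]

lemma Tprime {g : CSphere → CSphere} (hg : Hol g) (c' : Cht) (N : ℕ) {n : ℕ → ℕ} {V W : ℕ → Set CSphere} {x : ℕ → ℂ} {s : ℕ → ℝ}
    (h : ∀ k, Pl (g^[n k]) c' (x k) (s k) N (V k) (W k)) {ek : ℕ → CSphere} {e : CSphere} (he : ∀ k, ek k ∈ V k)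
    (ht : Tendsto ek atTop (𝓝 e)) (hac : ∀ O ∈ 𝓝 e, ∃ p ∈ O, p ∈ Ju g ∧ p ≠ e) {ε : ℝ} (hε : 0 < ε) (hV : ∀ k, ¬ Small ε (V k)) :
    ∃ O, IsOpen O ∧ (O ∩ Ju g).Nonempty ∧ ∃ᶠ k in atTop, g^[n k] '' O ⊆ c'.D (x k) (2 * s k) := by
  obtain ⟨c, rfl⟩ := exists_chart e
  have hK := Kc_one N
  have hstep : ∀ r : ℝ, 0 < r → ∃ r', 0 < r' ∧ Kc N * r' < r ∧ ∃ p : ℂ, c.κ p ∈ Ju g ∧ Kc N * r' < ‖p‖ ∧ ‖p‖ < r := by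
    intro r hr
    obtain ⟨p, hp, hpJ, hpe⟩ := hac _ (c.D_nhds (u := 0) hr)
    obtain ⟨p, hp, rfl⟩ := hp
    have hp0 : 0 < ‖p‖ := norm_pos_iff.2 (fun h => hpe (by rw [h]))
    have hpr : ‖p‖ < r := by simpa using hp
    have : Kc N * (‖p‖ / (2 * Kc N)) = ‖p‖ / 2 := by field_simp
    exact ⟨‖p‖ / (2 * Kc N), by positivity, by rw [this]; linarith, p, hpJ, by rw [this]; linarith, hpr⟩
  choose! r' h1 h2 h3 using hstep
  obtain ⟨ρ, hρ, hρs⟩ := c.D_basis (ball_mem_nhds (c.κ 0) (half_pos hε))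
  set r : ℕ → ℝ := fun i => r'^[i] (ρ / Kc N) with hr
  have hrs : ∀ i, r (i + 1) = r' (r i) := fun i => Function.iterate_succ_apply' _ _ _
  have hrp : ∀ i, 0 < r i := by
    intro i; induction i with
    | zero => simp only [hr, Function.iterate_zero, id]; positivity
    | succ i ih => rw [hrs]; exact h1 _ ih
  have hev : ∀ᶠ k in atTop, ∃ i ∈ Finset.range (N + 1), c.κ '' {ζ : ℂ | Kc N * r (i + 1) < ‖ζ‖ ∧ ‖ζ‖ < r i} ⊆ W k := by
    filter_upwards [ht.eventually (c.D_nhds (hrp (N + 1)))] with k hk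
    obtain ⟨i, hi, h⟩ := (h k).ring (hg.iter _) c hrp (fun i => by rw [hrs]; exact h2 _ (hrp i)) (he k) hk (fun hsub => hV k (by
      have e0 : Kc N * r 0 = ρ := by simp only [hr, Function.iterate_zero, id]; field_simp
      rw [e0] at hsub
      exact small_of_sub (hsub.trans hρs)))
    exact ⟨i, Finset.mem_range.2 (by omega), h⟩
  have hfr : ∃ i ∈ Finset.range (N + 1), ∃ᶠ k in atTop, c.κ '' {ζ : ℂ | Kc N * r (i + 1) < ‖ζ‖ ∧ ‖ζ‖ < r i} ⊆ W k := by
    by_contra! hcon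
    have hcon' : ∀ i ∈ Finset.range (N + 1), ∀ᶠ k in atTop, ¬ c.κ '' {ζ : ℂ | Kc N * r (i + 1) < ‖ζ‖ ∧ ‖ζ‖ < r i} ⊆ W k :=
      fun i hi => by simpa [Filter.not_frequently] using hcon i hi
    obtain ⟨k, ⟨i, hi, hk1⟩, hk2⟩ := (hev.and ((Filter.eventually_all_finset _).2 hcon')).exists
    exact hk2 i hi hk1
  obtain ⟨i, -, hi⟩ := hfr
  obtain ⟨p, hp1, hp2, hp3⟩ := h3 _ (hrp i)
  refine ⟨c.κ '' {ζ : ℂ | Kc N * r (i + 1) < ‖ζ‖ ∧ ‖ζ‖ < r i},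
    c.κ_open ((isOpen_lt continuous_const continuous_norm).inter (isOpen_lt continuous_norm continuous_const)),
    ⟨c.κ p, ⟨p, ⟨by rw [hrs]; exact hp2, hp3⟩, rfl⟩, hp1⟩, hi.mono fun k hk => (image_mono hk).trans (h k).im⟩
end CSphere
end

noncomputable section
open Set Metric Topology Filter
namespace CSphere

structure PC (g : CSphere → CSphere) (z : CSphere) (c : Cht) (lam : ℂ) : Prop where
  hg : Hol g
  cz : c.κ 0 = z
  fix : g z = z
  der : HasDerivAt (fun u => c.τ (g (c.κ u))) lam 0
  nl : ‖lam‖ = 1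
  nr : ∀ n : ℕ, 0 < n → lam ^ n ≠ 1
  zJ : z ∈ Ju g
  sh : ∃ B ∈ 𝓝 z, ∀ p ∈ B, p ∈ Ju g → p ≠ z → SHt g p
  pre : ∀ a, g a = z → a ≠ z → SHt g a

def Cht.inv (c : Cht) : Cht :=
  ⟨c.M ∘ sphInv, sphInv ∘ c.Mi, c.hM.comp hol_sphInv, hol_sphInv.comp c.hMi, fun x => by simp [c.l, sphInv_sphInv],
    fun x => by simp [c.r, sphInv_sphInv]⟩
lemma Cht.inv_pole (c : Cht) : c.inv.pole = c.κ 0 := by simp [Cht.inv, Cht.pole, Cht.κ]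
lemma Cht.inv_κ (c : Cht) {u : ℂ} (h : u ≠ 0) : c.inv.κ u = c.κ u⁻¹ := by
  simp [Cht.inv, Cht.κ, sphInv_ofC h]
lemma Cht.inv_τ (c : Cht) {x : CSphere} (h : x ≠ c.pole) (h0 : c.τ x ≠ 0) : c.inv.τ x = (c.τ x)⁻¹ := by
  have h1 : c.inv.κ (c.τ x)⁻¹ = x := by rw [c.inv_κ (inv_ne_zero h0), inv_inv, c.κτ h]
  rw [← c.inv.τκ (c.τ x)⁻¹, h1]

lemma tinv : Tendsto (fun u : ℂ => u⁻¹) (cocompact ℂ) (𝓝[≠] 0) := by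
  rw [← Metric.cobounded_eq_cocompact]
  exact Filter.tendsto_inv₀_cobounded' (α := ℂ)

namespace PC
variable {g : CSphere → CSphere} {z : CSphere} {c : Cht} {lam : ℂ}

lemma lam_ne (h : PC g z c lam) : lam ≠ 0 := norm_pos_iff.1 (by rw [h.nl]; exact one_pos)

lemma fixn (h : PC g z c lam) (n : ℕ) : g^[n] z = z := Function.iterate_fixed h.fix n

lemma z_ne (h : PC g z c lam) : z ≠ c.pole := h.cz ▸ c.κ_ne 0
lemma τz (h : PC g z c lam) : c.τ z = 0 := by rw [← h.cz]; simp

lemma dern (h : PC g z c lam) : ∀ n : ℕ, HasDerivAt (fun u => c.τ (g^[n] (c.κ u))) (lam ^ n) 0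
  | 0 => by
    have := hasDerivAt_id (0:ℂ)
    refine (by simpa using this : HasDerivAt id ((lam) ^ 0) (0:ℂ)).congr_of_eventuallyEq (Eventually.of_forall fun u => by simp)
  | n + 1 => by
    have h1 := h.dern n
    have h2 : HasDerivAt (fun u => c.τ (g (c.κ u))) lam (c.τ (g^[n] (c.κ 0))) := by
      rw [h.cz, h.fixn, h.τz]; exact h.der
    have h3 := h2.comp 0 h1
    rw [pow_succ, mul_comm]
    refine h3.congr_of_eventuallyEq ?_
    have hne : ∀ᶠ u in 𝓝 (0:ℂ), g^[n] (c.κ u) ≠ c.pole := by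
      refine ((h.hg.iter n).cont.comp c.κ_cont).continuousAt.eventually_ne ?_
      simp only [Function.comp]; rw [h.cz, h.fixn]; exact h.z_ne
    filter_upwards [hne] with u hu
    simp only [Function.comp]
    rw [c.κτ hu, Function.iterate_succ_apply']

lemma exists_pre (h : PC g z c lam) : ∃ a, g a = z ∧ a ≠ z := by
  by_contra! hcon
  set d := c.inv with hd
  have hpole : d.pole = z := by rw [hd, c.inv_pole, h.cz]
  set φ : ℂ → ℂ := fun u => d.τ (g (d.κ u)) with hφ
  have hne : ∀ u, g (d.κ u) ≠ d.pole := fun u e => d.κ_ne u ((hcon _ (e.trans hpole)).trans hpole.symm)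
  have hdiff : Differentiable ℂ φ := fun u => (h.hg.anc d d (hne u)).differentiableAt
  have hφκ : ∀ u, g (d.κ u) = d.κ (φ u) := fun u => (d.κτ (hne u)).symm
  set F : ℂ → ℂ := fun u => c.τ (g (c.κ u)) with hF
  have hF0 : F 0 = 0 := by simp only [hF]; rw [h.cz, h.fix, h.τz]
  have hslope : Tendsto (fun v => F v / v) (𝓝[≠] 0) (𝓝 lam) := by
    have := h.der.tendsto_slope
    refine this.congr fun v => ?_
    rw [slope_def_field, sub_zero]; show (F v - F 0) / v = _; rw [hF0, sub_zero]
  -- φ u / u → 1/lam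
  have hinf : Tendsto (fun u => φ u / u) (cocompact ℂ) (𝓝 lam⁻¹) := by
    have h1 : Tendsto (fun u : ℂ => (F u⁻¹ / u⁻¹)⁻¹) (cocompact ℂ) (𝓝 lam⁻¹) :=
      (hslope.comp tinv).inv₀ h.lam_ne
    refine h1.congr' ?_
    have hev : ∀ᶠ v in 𝓝[≠] (0:ℂ), g (c.κ v) ≠ c.pole ∧ v ≠ 0 := by
      refine Eventually.and (nhdsWithin_le_nhds ((h.hg.cont.comp c.κ_cont).continuousAt.eventually_ne ?_)) self_mem_nhdsWithin
      simp only [Function.comp]; rw [h.cz, h.fix]; exact h.z_ne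
    filter_upwards [tinv.eventually hev] with u hu
    have hu0 : u ≠ 0 := by simpa using hu.2
    have hne2 : c.τ (g (c.κ u⁻¹)) ≠ 0 := by
      intro e
      have : g (c.κ u⁻¹) = z := by rw [← c.κτ hu.1, e, h.cz]
      have := hcon _ this
      rw [← h.cz] at this
      exact hu.2 (c.κ_inj this)
    simp only [hφ]
    rw [hd, c.inv_κ hu0, c.inv_τ hu.1 hne2]
    simp only [hF]; field_simp
  have hds : Tendsto (dslope φ 0) (cocompact ℂ) (𝓝 lam⁻¹) := by
    have h1 : Tendsto (fun u : ℂ => φ u / u - φ 0 * u⁻¹) (cocompact ℂ) (𝓝 (lam⁻¹ - φ 0 * 0)) :=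
      hinf.sub ((tinv.mono_right nhdsWithin_le_nhds).const_mul _)
    rw [mul_zero, sub_zero] at h1
    refine h1.congr' ?_
    have : ∀ᶠ u in cocompact ℂ, u ≠ 0 := by
      have := (isCompact_singleton (x := (0:ℂ))).compl_mem_cocompact
      exact this
    filter_upwards [this] with u hu
    rw [dslope_of_ne _ hu, slope_def_field]; simp; field_simp
  have hdd : Differentiable ℂ (dslope φ 0) := by
    intro u
    have := (Complex.differentiableOn_dslope (c := (0:ℂ)) (s := univ) univ_mem).2 hdiff.differentiableOn
    exact (this u (mem_univ u)).differentiableAt univ_mem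
  have hconst := fun u => hdd.apply_eq_of_tendsto_cocompact u hds
  have haff : ∀ u, φ u = φ 0 + lam⁻¹ * u := by
    intro u
    have := sub_smul_dslope φ 0 u
    rw [hconst u] at this
    simp at this
    linear_combination -this
  have hl1 : lam⁻¹ ≠ 1 := fun e => h.nr 1 one_pos (by rw [pow_one]; exact inv_eq_one.1 e)
  set p := φ 0 / (1 - lam⁻¹) with hp
  have hl2 : 1 - lam⁻¹ ≠ 0 := sub_ne_zero.2 (Ne.symm hl1)
  have hrot : ∀ u, φ u - p = lam⁻¹ * (u - p) := by
    intro u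
    have : p * (1 - lam⁻¹) = φ 0 := by rw [hp]; exact div_mul_cancel₀ _ hl2
    rw [haff u]; linear_combination (-1 : ℂ) * this
  have hnorm : ∀ u, ‖φ u - p‖ = ‖u - p‖ := fun u => by rw [hrot, norm_mul, norm_inv, h.nl]; simp
  set B : Set CSphere := (d.κ '' closedBall p 1)ᶜ with hB
  have hBo : IsOpen B := (((isCompact_closedBall _ _).image d.κ_cont).isClosed).isOpen_compl
  have hinv : ∀ x ∈ B, g x ∈ B := by
    intro x hx
    by_cases hxz : x = z
    · rw [hxz, h.fix, ← hpole]; rintro ⟨u, _, e⟩; exact d.κ_ne u e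
    · have hx' : d.κ (d.τ x) = x := d.κτ (by rwa [hpole])
      rw [← hx', hφκ]
      rintro ⟨u, hu, e⟩
      have := d.κ_inj e
      apply hx
      refine ⟨d.τ x, ?_, hx'⟩
      rw [mem_closedBall, dist_eq_norm, ← hnorm, ← this]
      rwa [mem_closedBall, dist_eq_norm] at hu
  have hinvn : ∀ n : ℕ, ∀ x ∈ B, g^[n] x ∈ B := by
    intro n; induction n with
    | zero => exact fun x hx => hx
    | succ n ih => intro x hx; rw [Function.iterate_succ_apply]; exact ih _ (hinv _ hx)
  have := sub_Fa h.hg hBo (d.D_open p 1) ⟨d.κ p, d.κ_mem_D.2 (by simp)⟩ 0 (fun n _ x hx hO =>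
    hinvn n x hx (image_mono ball_subset_closedBall hO))
  have hzB : z ∈ B := by rw [← hpole]; rintro ⟨u, _, e⟩; exact d.κ_ne u e
  exact h.zJ (this hzB)

/-- data of the preimage -/
lemma pre_iter (h : PC g z c lam) {a : CSphere} (ha : g a = z) {i : ℕ} (hi : 0 < i) : g^[i] a = z := by
  obtain ⟨j, rfl⟩ : ∃ j, i = j + 1 := ⟨i - 1, by omega⟩
  rw [Function.iterate_succ_apply, ha, h.fixn]

lemma pre_J (h : PC g z c lam) {a : CSphere} (ha : g a = z) : a ∈ Ju g := by
  rw [← Ju_iff h.hg 1]; simpa [ha] using h.zJ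

lemma once (h : PC g z c lam) {a : CSphere} (ha : g a = z) (haz : a ≠ z) {x : CSphere} {m n : ℕ} (hm : g^[m] x = a) (hn : g^[n] x = a) :
    m = n := by
  wlog hmn : m ≤ n generalizing m n
  · exact (this hn hm (by omega)).symm
  by_contra hne
  obtain ⟨i, rfl⟩ := Nat.exists_eq_add_of_le hmn
  rw [add_comm, Function.iterate_add_apply, hm, h.pre_iter ha (by omega)] at hn
  exact haz hn.symm
end PC

lemma fixN_small {f : CSphere → CSphere} (hf : Hol f) (p : CSphere) {ε : ℝ} (hε : 0 < ε) :
    ∃ O, IsOpen O ∧ p ∈ O ∧ ∀ V, IsPreconnected V → f '' V ⊆ O → Small ε V := by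
  obtain ⟨O, h1, h2, h3⟩ := fixN hf p (half_pos hε)
  refine ⟨O, h1, h2, fun V hV hO => ?_⟩
  obtain ⟨a, -, h⟩ := h3 V hV hO
  exact small_of_sub h

lemma fixN_ev {g : CSphere → CSphere} (hg : Hol g) (p : CSphere) {ε : ℝ} (hε : 0 < ε) {n : ℕ → ℕ} {V : ℕ → Set CSphere}
    (hV : ∀ k, IsPreconnected (V k)) (hs : ∀ k, ¬ Small ε (V k)) (hp : ∀ O ∈ 𝓝 p, ∀ᶠ k in atTop, g^[n k] '' V k ⊆ O) :
    Tendsto n atTop atTop := by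
  rw [Filter.tendsto_atTop]
  intro N
  have h1 : ∀ m ∈ Finset.range N, ∀ᶠ k in atTop, n k ≠ m := by
    intro m _
    obtain ⟨O, h1, h2, h3⟩ := fixN_small (hg.iter m) p hε
    filter_upwards [hp O (h1.mem_nhds h2)] with k hk e
    exact hs k (h3 _ (hV k) (e ▸ hk))
  filter_upwards [(Filter.eventually_all_finset _).2 h1] with k hk
  by_contra! hlt
  exact hk (n k) (Finset.mem_range.2 hlt) rfl
end CSphere
end

noncomputable section
open Set Metric Topology Filter
namespace CSphere

lemma not_small_mono {ε : ℝ} {V W : Set CSphere} (h : V ⊆ W) (hn : ¬ Small ε V) : ¬ Small ε W :=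
  fun hW => hn fun x hx y hy => hW x (h hx) y (h hy)

lemma not_small_ne {ε : ℝ} {V : Set CSphere} (hn : ¬ Small ε V) : V.Nonempty := by
  rw [nonempty_iff_ne_empty]; rintro rfl; exact hn (fun x hx => hx.elim)

/-- enlarge to a component which contains a preimage of the given point -/
lemma enlarge {f : CSphere → CSphere} (hf : Hol f) {D : Set CSphere} (hD : IsOpen D) (hDc : IsPreconnected D) {V : Set CSphere}
    (hV : IsPreconnected V) (hVD : f '' V ⊆ D) (hne : V.Nonempty) {p : CSphere} (hp : p ∈ D) :
    ∃ V', V ⊆ V' ∧ IsPreconnected V' ∧ f '' V' ⊆ D ∧ ∃ e ∈ V', f e = p := by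
  obtain ⟨y, hy⟩ := hne
  obtain ⟨e, he, he'⟩ := comp_onto hf hD hDc (hVD ⟨y, hy, rfl⟩) hp
  exact ⟨connectedComponentIn (f ⁻¹' D) y, comp_sub hV hVD hy, isPreconnected_connectedComponentIn,
    image_subset_iff.2 (connectedComponentIn_subset _ _), e, he, he'⟩

lemma SHt.disc {g : CSphere → CSphere} {p : CSphere} (h : SHt g p) (c' : Cht) (hc : c'.κ 0 = p) {B' : Set CSphere} (hB' : B' ∈ 𝓝 p) :
    ∃ N : ℕ, ∃ s > 0, c'.D 0 (2 * s) ⊆ B' ∧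
    ∀ n V, IsPreconnected V → g^[n] '' V ⊆ c'.D 0 (2 * s) → ∀ w, (V ∩ g^[n] ⁻¹' {w}).ncard ≤ N := by
  obtain ⟨N, B, hB, hpB, hN⟩ := h
  obtain ⟨r, hr, hrB⟩ := c'.D_basis (O := B ∩ B') (by rw [hc]; exact inter_mem (hB.mem_nhds hpB) hB')
  refine ⟨N, r / 2, half_pos hr, ?_⟩
  rw [mul_div_cancel₀ _ two_ne_zero]
  exact ⟨fun x hx => (hrB hx).2, fun n V hV hD => hN n V hV (hD.trans fun x hx => (hrB hx).1)⟩

namespace PC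
variable {g : CSphere → CSphere} {z : CSphere} {c : Cht} {lam : ℂ}

lemma C1 (h : PC g z c lam) {a : CSphere} (ha : g a = z) (haz : a ≠ z) {ε : ℝ} (hε : 0 < ε) :
    ∃ O, IsOpen O ∧ a ∈ O ∧ ∀ n V, IsPreconnected V → g^[n] '' V ⊆ O → Small ε V := by
  obtain ⟨c', hc'⟩ := exists_chart a
  obtain ⟨N, ρ, hρ, -, hN⟩ := (h.pre a ha haz).disc c' hc' univ_mem
  by_contra! hcon
  set s : ℕ → ℝ := fun k => ρ / (k + 1) with hs
  have hsp : ∀ k, 0 < s k := fun k => by positivity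
  have hsle : ∀ k, s k ≤ ρ := fun k => div_le_self hρ.le (by linarith [Nat.cast_nonneg (α := ℝ) k])
  have hs0 : Tendsto s atTop (𝓝 0) := by
    have := (tendsto_one_div_add_atTop_nhds_zero_nat (𝕜 := ℝ)).const_mul ρ
    rw [mul_zero] at this
    exact this.congr fun k => by simp only [hs]; ring
  have hex : ∀ k, ∃ n V e, IsPreconnected V ∧ g^[n] '' V ⊆ c'.D 0 (s k) ∧ ¬ Small ε V ∧ e ∈ V ∧ g^[n] e = a := by
    intro k
    obtain ⟨n, V, h1, h2, h3⟩ := hcon (c'.D 0 (s k)) (c'.D_open _ _) (by rw [← hc']; exact c'.κ_mem_D.2 (by simpa using hsp k))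
    obtain ⟨V', h4, h5, h6, e, h7, h8⟩ := enlarge (h.hg.iter n) (c'.D_open _ _) (c'.D_conn _ _) h1 h2 (not_small_ne h3) (p := a)
      (by rw [← hc']; exact c'.κ_mem_D.2 (by simpa using hsp k))
    exact ⟨n, V', e, h5, h6, not_small_mono h4 h3, h7, h8⟩
  choose n V e h1 h2 h3 h4 h5 using hex
  have hDev : ∀ O ∈ 𝓝 a, ∀ᶠ k in atTop, c'.D 0 (2 * s k) ⊆ O := by
    intro O hO
    obtain ⟨r, hr, hrO⟩ := c'.D_basis (u := 0) (by rwa [hc'])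
    filter_upwards [hs0.eventually (gt_mem_nhds (half_pos hr))] with k hk
    exact (c'.D_mono (ball_subset_ball (by linarith))).trans hrO
  have hn : Tendsto n atTop atTop := by
    refine fixN_ev h.hg a hε h1 h3 fun O hO => ?_
    filter_upwards [hDev O hO] with k hk
    exact ((h2 k).trans (c'.D_mono (ball_subset_ball (by linarith [hsp k])))).trans hk
  have heJ : ∀ k, e k ∈ Ju g := fun k => by rw [← Ju_iff h.hg (n k), h5]; exact h.pre_J ha
  obtain ⟨e0, φ, hφ, he0⟩ := CompactSpace.tendsto_subseq e
  have hac : ∀ O ∈ 𝓝 e0, ∃ p ∈ O, p ∈ Ju g ∧ p ≠ e0 := by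
    intro O hO
    by_contra! hc
    obtain ⟨k, hk⟩ := eventually_atTop.1 (he0.eventually hO)
    have h6 : ∀ j ≥ k, e (φ j) = e0 := fun j hj => hc _ (hk j hj) (heJ _)
    obtain ⟨j, hj⟩ := ((hn.comp hφ.tendsto_atTop).eventually (eventually_gt_atTop (n (φ k)))).and (eventually_ge_atTop k) |>.exists
    have h7 := h5 (φ k); have h8 := h5 (φ j)
    rw [h6 k le_rfl] at h7; rw [h6 j hj.2] at h8
    have := h.once ha haz h7 h8
    simp only [Function.comp] at hj; omega
  obtain ⟨O, hO, hOJ, hfr⟩ := Tprime h.hg c' N (n := n ∘ φ) (V := V ∘ φ) (x := fun _ => 0) (s := s ∘ φ)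
    (fun k => mkPl (h.hg.iter _) (hsp _) (h1 _) (h2 _) (h4 (φ k)) (hN _ _ isPreconnected_connectedComponentIn (by
      refine image_subset_iff.2 ((connectedComponentIn_subset _ _).trans (preimage_mono (c'.D_mono (ball_subset_ball ?_))))
      linarith [hsle (φ k)]))) (fun k => h4 (φ k)) he0 hac hε (fun k => h3 (φ k))
  obtain ⟨i, hi, x, hx, hx'⟩ := dense_orbit h.hg hO hOJ hO (hOJ.mono inter_subset_left) 1
  have hzne : g^[i] a ≠ a := by rw [h.pre_iter ha (by omega)]; exact haz.symm
  obtain ⟨u, v, hu, hv, hau, hav, huv⟩ := t2_separation hzne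
  have hmem : u ∈ 𝓝 (g^[i] a) := hu.mem_nhds hau
  have hO' : (g^[i] ⁻¹' u) ∩ v ∈ 𝓝 a := inter_mem ((h.hg.iter i).cont.continuousAt hmem) (hv.mem_nhds hav)
  obtain ⟨k, hk1, hk2⟩ := (hfr.and_eventually (hφ.tendsto_atTop.eventually (hDev _ hO'))).exists
  have h6 := (hk2 (hk1 ⟨x, hx, rfl⟩)).1
  have h7 := (hk2 (hk1 ⟨_, hx', rfl⟩)).2
  simp only [Function.comp, mem_preimage] at h6 h7
  rw [← Function.iterate_add_apply, add_comm, Function.iterate_add_apply] at h6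
  exact huv.le_bot ⟨h6, h7⟩

lemma C2' (h : PC g z c lam) {a : CSphere} (ha : g a = z) (haz : a ≠ z) {B : Set CSphere} (hB : IsOpen B) (hJ : (B ∩ Ju g).Nonempty)
    (M : ℕ) : ∃ i ≥ M, ∃ q ∈ B, g^[i] q = a := by
  obtain ⟨b, hb, hbJ⟩ := hJ
  obtain ⟨ε, hε, hεB⟩ := Metric.isOpen_iff.1 hB b hb
  obtain ⟨O, hO, haO, hsm⟩ := h.C1 ha haz (half_pos hε)
  obtain ⟨c', hc'⟩ := exists_chart a
  obtain ⟨r, hr, hrO⟩ := c'.D_basis (u := 0) (by rw [hc']; exact hO.mem_nhds haO)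
  have haD : a ∈ c'.D 0 r := by rw [← hc']; exact c'.κ_mem_D.2 (by simpa using hr)
  obtain ⟨n, hn, x, hx, hx'⟩ := dense_orbit h.hg (isOpen_ball (x := b) (ε := ε / 2)) ⟨b, by simp [hε], hbJ⟩
    (c'.D_open 0 r) ⟨a, haD⟩ M
  obtain ⟨q, hq, hq'⟩ := comp_onto (h.hg.iter n) (c'.D_open 0 r) (c'.D_conn 0 r) hx' haD
  refine ⟨n, hn, q, hεB ?_, hq'⟩
  have := hsm n _ isPreconnected_connectedComponentIn
    ((image_subset_iff.2 (connectedComponentIn_subset _ _)).trans hrO) q hq x (mem_connectedComponentIn hx')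
  rw [mem_ball] at hx ⊢
  linarith [dist_triangle q x b]

lemma C2 (h : PC g z c lam) {B : Set CSphere} (hB : IsOpen B) (hJ : (B ∩ Ju g).Nonempty) :
    ∃ i, ∀ n > i, z ∈ g^[n] '' B := by
  obtain ⟨a, ha, haz⟩ := h.exists_pre
  obtain ⟨i, -, q, hq, hq'⟩ := h.C2' ha haz hB hJ 0
  refine ⟨i, fun n hn => ⟨q, hq, ?_⟩⟩
  obtain ⟨j, rfl⟩ := Nat.exists_eq_add_of_le hn.le
  rw [add_comm, Function.iterate_add_apply, hq', h.pre_iter ha (by omega)]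

lemma perfect (h : PC g z c lam) {e : CSphere} (he : e ∈ Ju g) : ∀ O ∈ 𝓝 e, ∃ p ∈ O, p ∈ Ju g ∧ p ≠ e := by
  intro O hO
  obtain ⟨a, ha, haz⟩ := h.exists_pre
  by_contra! hc
  have hJ : (interior O ∩ Ju g).Nonempty := ⟨e, mem_interior_iff_mem_nhds.2 hO, he⟩
  have key : ∀ M, ∃ i ≥ M, g^[i] e = a := by
    intro M
    obtain ⟨i, hi, q, hq, hq'⟩ := h.C2' ha haz isOpen_interior hJ M
    have hqJ : q ∈ Ju g := by rw [← Ju_iff h.hg i, hq']; exact h.pre_J ha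
    exact ⟨i, hi, by rw [← hc q (interior_subset hq) hqJ, hq']⟩
  obtain ⟨i, _, hi⟩ := key 0
  obtain ⟨j, hj, hj'⟩ := key (i + 1)
  have := h.once ha haz hi hj'
  omega

lemma C3 (h : PC g z c lam) {p : CSphere} (hp : p ∈ Ju g) (hpz : p ≠ z) (hs : SHt g p) :
    ∃ O, IsOpen O ∧ p ∈ O ∧ ∀ ε > 0, ∃ N : ℕ, ∀ n ≥ N, ∀ V, IsPreconnected V → g^[n] '' V ⊆ O → Small ε V := by
  obtain ⟨c', hc'⟩ := exists_chart p
  obtain ⟨N, s, hs, hsz, hN⟩ := hs.disc c' hc' (isOpen_compl_singleton.mem_nhds hpz)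
  have hpD : p ∈ c'.D 0 s := by rw [← hc']; exact c'.κ_mem_D.2 (by simpa using hs)
  refine ⟨c'.D 0 s, c'.D_open _ _, hpD, fun ε hε => ?_⟩
  by_contra! hcon
  have hex : ∀ k, ∃ n V e, k ≤ n ∧ IsPreconnected V ∧ g^[n] '' V ⊆ c'.D 0 s ∧ ¬ Small ε V ∧ e ∈ V ∧ g^[n] e = p := by
    intro k
    obtain ⟨n, hn, V, h1, h2, h3⟩ := hcon k
    obtain ⟨V', h4, h5, h6, e, h7, h8⟩ := enlarge (h.hg.iter n) (c'.D_open _ _) (c'.D_conn _ _) h1 h2 (not_small_ne h3) hpD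
    exact ⟨n, V', e, hn, h5, h6, not_small_mono h4 h3, h7, h8⟩
  choose n V e h0 h1 h2 h3 h4 h5 using hex
  have heJ : ∀ k, e k ∈ Ju g := fun k => by rw [← Ju_iff h.hg (n k), h5]; exact hp
  obtain ⟨e0, φ, hφ, he0⟩ := CompactSpace.tendsto_subseq e
  have he0J : e0 ∈ Ju g := Ju_closed.mem_of_tendsto he0 (Eventually.of_forall fun k => heJ _)
  obtain ⟨O, hO, hOJ, hfr⟩ := Tprime h.hg c' N (n := n ∘ φ) (V := V ∘ φ) (x := fun _ => 0) (s := fun _ => s)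
    (fun k => mkPl (h.hg.iter _) hs (h1 _) (h2 _) (h4 (φ k)) (hN _ _ isPreconnected_connectedComponentIn
      (image_subset_iff.2 (connectedComponentIn_subset _ _)))) (fun k => h4 (φ k)) he0 (h.perfect he0J) hε (fun k => h3 (φ k))
  obtain ⟨i, hi⟩ := h.C2 hO hOJ
  obtain ⟨k, hk1, hk2⟩ := (hfr.and_eventually (eventually_gt_atTop i)).exists
  have h6 : i < (n ∘ φ) k := by
    have := h0 (φ k); have := hφ.id_le k; simp only [Function.comp]; simp at this; omega
  exact hsz (hk1 (hi _ h6)) rfl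

lemma C4 (h : PC g z c lam) {O : Set CSphere} (hO : IsOpen O) (hJ : (O ∩ Ju g).Nonempty) {n : ℕ → ℕ} {x : ℕ → ℂ} {s : ℕ → ℝ}
    (hn : Tendsto n atTop atTop) (hx : Tendsto x atTop (𝓝 0)) (hs : Tendsto s atTop (𝓝 0))
    (hfr : ∃ᶠ k in atTop, g^[n k] '' O ⊆ c.D (x k) (2 * s k)) : False := by
  obtain ⟨i, hi⟩ := h.C2 hO hJ
  have hzi := hi (i + 1) (by omega)
  obtain ⟨ρ, hρ, hρs⟩ := c.D_basis (u := 0) (O := g^[i + 1] '' O) (by rw [h.cz]; exact ((h.hg.iter _).isOpenMap _ hO).mem_nhds hzi)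
  have hev : ∀ᶠ k in atTop, ‖x k‖ < ρ / 4 ∧ s k < ρ / 8 ∧ i + 1 ≤ n k :=
    ((by simpa using hx.norm : Tendsto (fun k => ‖x k‖) atTop (𝓝 0)).eventually (gt_mem_nhds (by positivity))).and
      ((hs.eventually (gt_mem_nhds (by positivity))).and (hn.eventually (eventually_ge_atTop _)))
  obtain ⟨k, hk, h1, h2, h3⟩ := (hfr.and_eventually hev).exists
  obtain ⟨m, hm⟩ := Nat.exists_eq_add_of_le h3
  have hmap : ∀ u ∈ ball (0:ℂ) ρ, g^[m] (c.κ u) ≠ c.pole ∧ ‖c.τ (g^[m] (c.κ u))‖ < ρ / 2 := by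
    intro u hu
    obtain ⟨o, ho, e⟩ := hρs ⟨u, hu, rfl⟩
    have : g^[n k] o = g^[m] (c.κ u) := by rw [hm, add_comm, Function.iterate_add_apply, e]
    have h4 := c.mem_D.1 (hk ⟨o, ho, rfl⟩)
    rw [this] at h4
    refine ⟨h4.1, ?_⟩
    have := norm_sub_norm_le (c.τ (g^[m] (c.κ u))) (x k)
    linarith [h4.2]
  have h0 : c.τ (g^[m] (c.κ 0)) = 0 := by rw [h.cz, h.fixn, h.τz]
  have := Complex.norm_deriv_le_div_of_mapsTo_ball (f := fun u => c.τ (g^[m] (c.κ u))) (c := 0) (R₁ := ρ) (R₂ := ρ / 2)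
    (fun u hu => ((h.hg.iter m).anc c c (hmap u hu).1).differentiableAt.differentiableWithinAt)
    (fun u hu => by rw [h0, mem_closedBall, dist_zero_right]; exact (hmap u hu).2.le) hρ
  rw [(h.dern m).deriv, norm_pow, h.nl, one_pow, div_div, mul_comm, ← div_div, div_self hρ.ne'] at this
  norm_num at this
end PC
end CSphere
end

noncomputable section
open Set Metric Topology Filter
namespace CSphere

lemma near_J {g : CSphere → CSphere} (hg : Hol g) {w : CSphere} (hw : w ∈ Ju g) {O : Set CSphere} (hO : IsOpen O) (hwO : w ∈ O)
    (hsh : ∀ ε > 0, ∃ N : ℕ, ∀ n ≥ N, ∀ V, IsPreconnected V → g^[n] '' V ⊆ O → Small ε V) {y : CSphere}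
    (hy : ∀ O' ∈ 𝓝 w, ∃ᶠ n in atTop, g^[n] y ∈ O') : y ∈ Ju g := by
  rw [← Ju_closed.closure_eq, Metric.mem_closure_iff]
  intro ε hε
  obtain ⟨N, hN⟩ := hsh (ε / 2) (half_pos hε)
  obtain ⟨c', hc'⟩ := exists_chart w
  obtain ⟨r, hr, hrO⟩ := c'.D_basis (u := 0) (by rw [hc']; exact hO.mem_nhds hwO)
  have hwD : w ∈ c'.D 0 r := by rw [← hc']; exact c'.κ_mem_D.2 (by simpa using hr)
  obtain ⟨n, hn, hnN⟩ := ((hy _ ((c'.D_open 0 r).mem_nhds hwD)).and_eventually (eventually_ge_atTop N)).exists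
  obtain ⟨q, hq, hq'⟩ := comp_onto (hg.iter n) (c'.D_open 0 r) (c'.D_conn 0 r) hn hwD
  refine ⟨q, by rw [← Ju_iff hg n, hq']; exact hw, ?_⟩
  have := hN n hnN _ isPreconnected_connectedComponentIn
    ((image_subset_iff.2 (connectedComponentIn_subset _ _)).trans hrO) y (mem_connectedComponentIn hn) q hq
  linarith

namespace PC
variable {g : CSphere → CSphere} {z : CSphere} {c : Cht} {lam : ℂ}

lemma C5 (h : PC g z c lam) {y : CSphere} (hy : y ∈ Fa g) (hcl : ∀ O ∈ 𝓝 z, ∃ᶠ n in atTop, g^[n] y ∈ O) :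
    Tendsto (fun n => g^[n] y) atTop (𝓝 z) := by
  by_contra hnot
  obtain ⟨B, hB, hBs⟩ := h.sh
  obtain ⟨R1, hR1, hR1B⟩ := Metric.mem_nhds_iff.1 hB
  have hη : ∃ η > 0, ∃ᶠ n in atTop, η ≤ dist (g^[n] y) z := by
    by_contra! hc
    apply hnot
    rw [Metric.tendsto_nhds]
    intro ε hε
    simpa [not_frequently] using hc ε hε
  obtain ⟨η, hη, hfrη⟩ := hη
  obtain ⟨R, hR, hRη, hRB⟩ : ∃ R > 0, 2 * R ≤ η ∧ closedBall z R ⊆ B := by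
    refine ⟨min (η / 2) (R1 / 2), by positivity, by linarith [min_le_left (η / 2) (R1 / 2)], fun x hx => hR1B ?_⟩
    rw [mem_closedBall] at hx; rw [mem_ball]; linarith [min_le_right (η / 2) (R1 / 2)]
  have hfar : ∃ᶠ n in atTop, 2 * R ≤ dist (g^[n] y) z := hfrη.mono fun n hn => hRη.trans hn
  have hp : ∀ j : ℕ, ∃ p ≥ j, R ≤ dist (g^[p] y) z ∧ ∀ i, 1 ≤ i → i ≤ j → dist (g^[p + i] y) z < R := by
    intro j
    obtain ⟨p0, hp0, hp0j⟩ := (hfar.and_eventually (eventually_ge_atTop j)).exists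
    have hO : ∀ᶠ x in 𝓝 z, ∀ i ∈ Finset.range (j + 1), g^[i] x ∈ ball z R := by
      rw [Filter.eventually_all_finset]
      intro i _
      exact (h.hg.iter i).cont.continuousAt.eventually_mem (by rw [h.fixn]; exact ball_mem_nhds _ hR)
    obtain ⟨t, ht, htp⟩ := ((hcl _ hO).and_eventually (eventually_ge_atTop p0)).exists
    classical
    set P : ℕ → Prop := fun n => R ≤ dist (g^[n] y) z with hP
    set p := Nat.findGreatest P t with hpd
    have hPp0 : P p0 := by simp only [hP]; linarith
    have hp1 : P p := Nat.findGreatest_spec htp hPp0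
    have hp2 : p0 ≤ p := Nat.le_findGreatest htp hPp0
    refine ⟨p, hp0j.trans hp2, hp1, fun i hi1 hi2 => ?_⟩
    by_cases hle : p + i ≤ t
    · have := Nat.findGreatest_is_greatest (P := P) (n := t) (k := p + i) (by omega) hle
      exact not_le.1 this
    · have hpt : p ≤ t := Nat.findGreatest_le t
      have h1 := ht (p + i - t) (Finset.mem_range.2 (by omega))
      rw [← Function.iterate_add_apply, show p + i - t + t = p + i by omega] at h1
      exact h1
  choose p hp1 hp2 hp3 using hp
  obtain ⟨ζ, φ, hφ, hζ⟩ := CompactSpace.tendsto_subseq (fun j => g^[p j] y)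
  have hζR : R ≤ dist ζ z := ge_of_tendsto' (hζ.dist tendsto_const_nhds) (fun j => hp2 _)
  have hiζ : ∀ i, Tendsto (fun j => g^[p (φ j) + i] y) atTop (𝓝 (g^[i] ζ)) := by
    intro i
    have := ((h.hg.iter i).cont.tendsto ζ).comp hζ
    refine this.congr fun j => ?_
    simp only [Function.comp]; rw [← Function.iterate_add_apply, add_comm]
  have hζi : ∀ i, 1 ≤ i → g^[i] ζ ∈ closedBall z R := by
    intro i hi
    rw [mem_closedBall]
    refine le_of_tendsto ((hiζ i).dist tendsto_const_nhds) ?_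
    filter_upwards [eventually_ge_atTop i] with j hj
    exact (hp3 (φ j) i hi (hj.trans (hφ.id_le j))).le
  have hpinf : Tendsto (fun j => p (φ j)) atTop atTop :=
    tendsto_atTop_mono (fun j => (hφ.id_le j).trans (hp1 _)) tendsto_id
  have hfr : ∀ i, ∀ O' ∈ 𝓝 (g^[i] ζ), ∃ᶠ n in atTop, g^[n] y ∈ O' := by
    intro i O' hO'
    have h1 := (hiζ i).eventually hO'
    have h2 : Tendsto (fun j => p (φ j) + i) atTop atTop :=
      tendsto_atTop_mono (fun j => Nat.le_add_right _ _) hpinf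
    exact h2.frequently (p := fun n => g^[n] y ∈ O') h1.frequently
  by_cases hζJ : ζ ∈ Ju g
  · have hζz : ζ ≠ z := fun e => by rw [e, dist_self] at hζR; linarith
    have key : ∃ i, g^[i] ζ ≠ z ∧ SHt g (g^[i] ζ) := by
      by_cases hg1 : g ζ = z
      · exact ⟨0, hζz, h.pre ζ hg1 hζz⟩
      · exact ⟨1, hg1, hBs _ (hRB (hζi 1 le_rfl)) ((Ju_iff h.hg 1).2 hζJ) hg1⟩
    obtain ⟨i, hi1, hi2⟩ := key
    have hiJ := (Ju_iff h.hg i).2 hζJ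
    obtain ⟨O, hO, hOm, hsh⟩ := h.C3 hiJ hi1 hi2
    exact near_J h.hg hiJ hO hOm hsh (hfr i) hy
  · have heq := Fa_eq (not_Ju.1 hζJ)
    rw [Metric.equicontinuousAt_iff_right] at heq
    obtain ⟨j, hj⟩ := (hζ.eventually (heq (R / 2) (half_pos hR))).exists
    obtain ⟨n, hn, hn'⟩ := (hfar.and_eventually (eventually_ge_atTop (p (φ j) + 1))).exists
    have h1 := hj (n - p (φ j))
    simp only [Function.comp] at h1
    rw [← Function.iterate_add_apply, show n - p (φ j) + p (φ j) = n by omega] at h1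
    have h2 := hζi (n - p (φ j)) (by omega)
    rw [mem_closedBall] at h2
    have := dist_triangle_left (g^[n] y) z (g^[n - p (φ j)] ζ)
    linarith
end PC
end CSphere
end

noncomputable section
open Set Metric Topology Filter
namespace CSphere

lemma covers {f : ℂ → ℂ} {p : ℂ} {ρ M : ℝ} (hρ : 0 < ρ) (hf : DifferentiableOn ℂ f (ball p ρ))
    (hM : ∀ x ∈ ball p ρ, ‖deriv f x‖ ≤ M) (ha : 0 < ‖deriv f p‖) :
    ball (f p) (‖deriv f p‖ ^ 2 * ρ / (16 * M)) ⊆ f '' ball p ρ := by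
  set a := ‖deriv f p‖ with hadef
  have haM : a ≤ M := hM p (mem_ball_self hρ)
  have hMp : 0 < M := ha.trans_le haM
  set t := ρ * a / (4 * M) with ht
  have htp : 0 < t := by positivity
  have htρ : t < ρ := by
    rw [ht, div_lt_iff₀ (by positivity)]; nlinarith
  have hsub : closedBall p t ⊆ ball p ρ := closedBall_subset_ball htρ
  have hd1 : DifferentiableOn ℂ (deriv f) (ball p ρ) := hf.deriv isOpen_ball
  have hder : ∀ x ∈ closedBall p t, ‖deriv f x - deriv f p‖ ≤ a / 2 := by
    intro x hx
    have h1 := Complex.dist_le_div_mul_dist_of_mapsTo_ball (R₂ := 2 * M) hd1 (fun y hy => by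
      rw [mem_closedBall, dist_eq_norm]
      have := norm_sub_le (deriv f y) (deriv f p)
      have := hM y hy
      linarith) (hsub hx)
    rw [dist_eq_norm] at h1
    refine h1.trans ?_
    have : dist x p ≤ t := hx
    calc 2 * M / ρ * dist x p ≤ 2 * M / ρ * t := by gcongr
      _ = a / 2 := by rw [ht]; field_simp; ring
  have hfd : ∀ x ∈ closedBall p t, HasDerivAt f (deriv f x) x := fun x hx =>
    (hf.differentiableAt (isOpen_ball.mem_nhds (hsub hx))).hasDerivAt
  have hlow : ∀ x ∈ sphere p t, a * t / 2 ≤ ‖f x - f p‖ := by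
    intro x hx
    have h1 := (convex_closedBall p t).norm_image_sub_le_of_norm_hasDerivWithin_le (f := fun x => f x - deriv f p * x)
      (f' := fun x => deriv f x - deriv f p) (C := a / 2) (fun y hy =>
        ((hfd y hy).sub (by simpa using (hasDerivAt_id y).const_mul (deriv f p))).hasDerivWithinAt) hder
        (mem_closedBall_self htp.le) (sphere_subset_closedBall hx)
    have hxp : ‖x - p‖ = t := by rw [← dist_eq_norm]; exact hx
    rw [hxp] at h1
    have h2 : ‖deriv f p * (x - p)‖ = a * t := by rw [norm_mul, hxp]
    have h3 : deriv f p * (x - p) = (f x - f p) - (f x - deriv f p * x - (f p - deriv f p * p)) := by ring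
    rw [h3] at h2
    have := norm_sub_le (f x - f p) (f x - deriv f p * x - (f p - deriv f p * p))
    nlinarith
  have hne : ∃ᶠ z in 𝓝 p, f z ≠ f p := by
    intro hev
    have hev' : f =ᶠ[𝓝 p] fun _ => f p := by filter_upwards [hev] with z hz; exact not_not.1 hz
    have := hev'.deriv_eq
    simp at this
    rw [hadef, this, norm_zero] at ha; exact lt_irrefl _ ha
  have hdc : DiffContOnCl ℂ f (ball p t) := by
    refine (hf.mono hsub).diffContOnCl_ball subset_rfl
  have := hdc.ball_subset_image_closedBall htp hlow hne
  refine Subset.trans ?_ (this.trans (image_mono hsub))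
  refine ball_subset_ball (le_of_eq ?_)
  rw [ht]; field_simp; ring

lemma bloch {f : ℂ → ℂ} {p : ℂ} {r R : ℝ} (hr : 0 < r) (hrR : r < R) (hf : DifferentiableOn ℂ f (ball p R)) (h0 : 0 < ‖deriv f p‖) :
    ∃ x ∈ ball p r, ball (f x) (‖deriv f p‖ * r / 64) ⊆ f '' ball p r := by
  have hd1 : DifferentiableOn ℂ (deriv f) (ball p R) := hf.deriv isOpen_ball
  have hsub : closedBall p r ⊆ ball p R := closedBall_subset_ball hrR
  obtain ⟨x, hx, hmax⟩ := (isCompact_closedBall p r).exists_isMaxOn ⟨p, mem_closedBall_self hr.le⟩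
    (f := fun x => ‖deriv f x‖ * (r - dist x p))
    (((hd1.continuousOn.mono hsub).norm).mul (by fun_prop))
  have hm := hmax (mem_closedBall_self hr.le)
  simp only [mem_ofPred_eq, dist_self, sub_zero] at hm
  have hx' : dist x p ≤ r := hx
  have hpos : 0 < ‖deriv f p‖ * r := by positivity
  have hxr : dist x p < r := by
    rcases hx'.lt_or_eq with h | h
    · exact h
    · rw [h, sub_self, mul_zero] at hm; linarith
  set ρ := (r - dist x p) / 2 with hρ
  have hρp : 0 < ρ := by rw [hρ]; linarith
  have hb : ball x ρ ⊆ ball p r := ball_subset_ball' (by linarith)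
  have ha : 0 < ‖deriv f x‖ := by
    rcases (norm_nonneg (deriv f x)).lt_or_eq with h | h
    · exact h
    · rw [← h, zero_mul] at hm; linarith
  have := covers (M := 2 * ‖deriv f x‖) hρp (hf.mono ((hb.trans ball_subset_closedBall).trans hsub)) (fun y hy => ?_) ha
  · refine ⟨x, hxr, Subset.trans ?_ (this.trans (image_mono hb))⟩
    refine ball_subset_ball ?_
    rw [le_div_iff₀ (by positivity)]
    have : r - dist x p = 2 * ρ := by rw [hρ]; ring
    rw [this] at hm
    nlinarith
  · have h1 := hmax (ball_subset_closedBall (hb hy))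
    simp only [mem_ofPred_eq] at h1
    have h2 : dist y p ≤ dist y x + dist x p := dist_triangle _ _ _
    have h3 : dist y x < ρ := hy
    have h4 : ρ ≤ r - dist y p := by linarith
    have h5 : r - dist x p = 2 * ρ := by rw [hρ]; ring
    rw [h5] at h1
    have h6 : ‖deriv f y‖ * ρ ≤ ‖deriv f y‖ * (r - dist y p) := by gcongr
    have h7 : ‖deriv f y‖ * ρ ≤ (2 * ‖deriv f x‖) * ρ := by linarith
    exact le_of_mul_le_mul_right h7 hρp

lemma exists_log {f : ℂ → ℂ} {p : ℂ} {r : ℝ} (hr : 0 < r) (hf : DifferentiableOn ℂ f (ball p r)) (h0 : ∀ x ∈ ball p r, f x ≠ 0) :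
    ∃ L : ℂ → ℂ, DifferentiableOn ℂ L (ball p r) ∧ ∀ x ∈ ball p r, f x = Complex.exp (L x) := by
  have hd1 : DifferentiableOn ℂ (deriv f) (ball p r) := hf.deriv isOpen_ball
  obtain ⟨L, hL⟩ := (hd1.div hf h0).isExactOn_ball.with_val_at p (Complex.log (f p))
  have hp := mem_ball_self hr (x := p)
  refine ⟨L, fun x hx => (hL.2 x hx).differentiableAt.differentiableWithinAt, fun x hx => ?_⟩
  have hder : ∀ y ∈ ball p r, HasDerivAt (fun y => f y * Complex.exp (-L y)) 0 y := by
    intro y hy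
    have h1 := (hf.differentiableAt (isOpen_ball.mem_nhds hy)).hasDerivAt.mul (hL.2 y hy).neg.cexp
    have h2 : deriv f y * Complex.exp (-L y) + f y * (Complex.exp (-L y) * -(deriv f y / f y)) = 0 := by
      have := h0 y hy
      field_simp
      ring
    have h3 : HasDerivAt (fun y => f y * Complex.exp (-L y))
      (deriv f y * Complex.exp (-L y) + f y * (Complex.exp (-L y) * -(deriv f y / f y))) y := h1
    rwa [h2] at h3
  have hc := (convex_ball p r).is_const_of_fderivWithin_eq_zero (𝕜 := ℂ) (f := fun y => f y * Complex.exp (-L y))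
    (fun y hy => (hder y hy).differentiableAt.differentiableWithinAt) (fun y hy => ?_) hx hp
  · rw [hL.1, Complex.exp_neg, Complex.exp_neg, Complex.exp_log (h0 p hp), mul_inv_cancel₀ (h0 p hp),
      mul_inv_eq_one₀ (Complex.exp_ne_zero _)] at hc
    exact hc
  · rw [fderivWithin_of_isOpen isOpen_ball hy]
    have := (hder y hy).hasFDerivAt.fderiv
    rw [this]; ext; simp

lemma harnack {f : ℂ → ℂ} {p q : ℂ} {r : ℝ} (hr : 0 < r) (hf : DifferentiableOn ℂ f (ball p r)) (h0 : ∀ x ∈ ball p r, f x ≠ 0)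
    (h1 : ∀ x ∈ ball p r, ‖f x‖ < 1) (hq : dist q p ≤ r / 2) : ‖f q‖ ^ 3 ≤ ‖f p‖ := by
  obtain ⟨L, hL, hfL⟩ := exists_log hr hf h0
  have hq' : q ∈ ball p r := by rw [mem_ball]; linarith
  have hp := mem_ball_self hr (x := p)
  have hre : ∀ x ∈ ball p r, (L x).re < 0 := by
    intro x hx
    have := h1 x hx
    rwa [hfL x hx, Complex.norm_exp, Real.exp_lt_one_iff] at this
  rw [hfL q hq', hfL p hp, Complex.norm_exp, Complex.norm_exp, ← Real.exp_nat_mul, Real.exp_le_exp]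
  set c := (starRingEnd ℂ) (L p) with hc
  have hcre : c.re = (L p).re := Complex.conj_re _
  have hne : ∀ x ∈ ball p r, L x + c ≠ 0 := by
    intro x hx e
    have := congrArg Complex.re e
    rw [Complex.add_re, hcre, Complex.zero_re] at this
    linarith [hre x hx, hre p hp]
  have hdist := Complex.dist_le_div_mul_dist_of_mapsTo_ball (R₂ := 1) (f := fun x => (L x - L p) / (L x + c)) (c := p)
    ((hL.sub_const _).div (hL.add_const _) hne) (fun x hx => by
      rw [mem_closedBall, dist_eq_norm]
      simp only [sub_self, zero_div, sub_zero, norm_div]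
      rw [div_le_one (norm_pos_iff.2 (hne x hx)), ← sq_le_sq₀ (norm_nonneg _) (norm_nonneg _), ← Complex.normSq_eq_norm_sq,
        ← Complex.normSq_eq_norm_sq, Complex.normSq_apply, Complex.normSq_apply]
      simp only [Complex.sub_re, Complex.sub_im, Complex.add_re, Complex.add_im, hc, Complex.conj_im, Complex.conj_re]
      nlinarith [mul_pos_of_neg_of_neg (hre x hx) (hre p hp)]) hq'
  rw [dist_eq_norm] at hdist
  simp only [sub_self, zero_div, sub_zero, norm_div] at hdist
  have h2 : ‖L q - L p‖ ≤ 1 / 2 * ‖L q + c‖ := by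
    rw [← div_le_iff₀ (norm_pos_iff.2 (hne q hq'))]
    refine hdist.trans ?_
    rw [one_div, inv_mul_le_iff₀ hr]; linarith
  have h3 : ‖L q - L p‖ ^ 2 ≤ 1 / 4 * ‖L q + c‖ ^ 2 := by
    have := norm_nonneg (L q - L p); nlinarith
  rw [← Complex.normSq_eq_norm_sq, ← Complex.normSq_eq_norm_sq, Complex.normSq_apply, Complex.normSq_apply] at h3
  simp only [Complex.sub_re, Complex.sub_im, Complex.add_re, Complex.add_im, hc, Complex.conj_im, Complex.conj_re] at h3
  have h4 := hre q hq'
  have h5 := hre p hp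
  push_cast
  by_contra! h6
  nlinarith [sq_nonneg ((L q).im - (L p).im), mul_pos (sub_pos.2 h6) (neg_pos.2 h5), mul_pos_of_neg_of_neg h4 h5]

open Real in
lemma lam_dense {lam : ℂ} (nl : ‖lam‖ = 1) (nr : ∀ n : ℕ, 0 < n → lam ^ n ≠ 1) {η : ℝ} (hη : 0 < η) :
    ∃ q : ℕ, ∀ ω : ℂ, ‖ω‖ = 1 → ∃ i ≤ q, ‖lam ^ i * ω - 1‖ < η := by
  have : Fact (0 < 2 * π) := ⟨by positivity⟩
  set θ : AddCircle (2 * π) := ((lam.arg : ℝ) : AddCircle (2 * π)) with hθ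
  have hcir : ∀ n : ℕ, ((AddCircle.homeomorphCircle' (n • θ) : Circle) : ℂ) = lam ^ n := by
    intro n
    have : (n • θ : AddCircle (2 * π)) = ((n * lam.arg : ℝ) : AddCircle (2 * π)) := by
      rw [hθ, ← AddCircle.coe_nsmul, nsmul_eq_mul]
    rw [this, AddCircle.homeomorphCircle'_apply_mk, Circle.coe_exp]
    have h2 : lam = Complex.exp (lam.arg * Complex.I) := by
      have := Complex.norm_mul_exp_arg_mul_I lam
      rw [nl, Complex.ofReal_one, one_mul] at this; exact this.symm
    conv_rhs => rw [h2]
    rw [← Complex.exp_nat_mul]; push_cast; ring_nf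
  have hord : addOrderOf θ = 0 := by
    rw [addOrderOf_eq_zero_iff']
    intro n hn e
    have := hcir n
    rw [e] at this
    refine nr n hn (this.symm.trans ?_)
    have : (0 : AddCircle (2 * π)) = ((0 : ℝ) : AddCircle (2 * π)) := rfl
    rw [this, AddCircle.homeomorphCircle'_apply_mk]; simp
  have hden := denseRange_zsmul_iff_nsmul.1 (AddCircle.denseRange_zsmul_iff.2 hord)
  have hden2 := AddCircle.homeomorphCircle'.surjective.denseRange.comp hden AddCircle.homeomorphCircle'.continuous
  have hpt : ∀ ω : ℂ, ‖ω‖ = 1 → ∃ i : ℕ, ‖lam ^ i * ω - 1‖ < η := by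
    intro ω hω
    have hω0 : ω ≠ 0 := norm_pos_iff.1 (by rw [hω]; exact one_pos)
    obtain ⟨ζ, hζ⟩ : ∃ ζ : Circle, (ζ : ℂ) = ω⁻¹ := ⟨⟨ω⁻¹, mem_sphere_zero_iff_norm.2 (by simp [hω])⟩, rfl⟩
    obtain ⟨i, hi⟩ := hden2.exists_dist_lt ζ hη
    refine ⟨i, ?_⟩
    replace hi : dist (ζ : ℂ) ((AddCircle.homeomorphCircle' (i • θ) : Circle) : ℂ) < η := hi
    rw [hcir, hζ, dist_comm, dist_eq_norm] at hi
    calc ‖lam ^ i * ω - 1‖ = ‖(lam ^ i - ω⁻¹) * ω‖ := by congr 1; field_simp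
      _ = ‖lam ^ i - ω⁻¹‖ := by rw [norm_mul, hω, mul_one]
      _ < η := hi
  obtain ⟨t, ht⟩ := (isCompact_sphere (0:ℂ) 1).elim_finite_subcover (fun i : ℕ => {ω : ℂ | ‖lam ^ i * ω - 1‖ < η})
    (fun i => isOpen_lt (by fun_prop) continuous_const) (fun ω hω => by
      obtain ⟨i, hi⟩ := hpt ω (by simpa using hω)
      exact mem_iUnion.2 ⟨i, hi⟩)
  refine ⟨t.sup id, fun ω hω => ?_⟩
  have := ht (by simpa using hω : ω ∈ sphere (0:ℂ) 1)
  simp only [mem_iUnion] at this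
  obtain ⟨i, hi, hi'⟩ := this
  exact ⟨i, Finset.le_sup (f := id) hi, hi'⟩

lemma inv_an {χ F : ℂ → ℂ} {u0 : ℂ} (hχ : ∀ᶠ u in 𝓝 u0, ContinuousAt χ u) (hF : AnalyticAt ℂ F (χ u0)) (h : ∀ᶠ u in 𝓝 u0, F (χ u) = u) :
    AnalyticAt ℂ χ u0 := by
  have hc0 := hχ.self_of_nhds
  have hFan := hF.eventually_analyticAt
  have hd : ∀ᶠ v in 𝓝[≠] (χ u0), deriv F v ≠ 0 := by
    rcases hF.deriv.eventually_eq_zero_or_eventually_ne_zero with h1 | h1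
    · exfalso
      have hd0 : deriv F =ᶠ[𝓝 (χ u0)] 0 := h1
      have hconst : ∀ᶠ v in 𝓝 (χ u0), F v = F (χ u0) := by
        obtain ⟨r, hr, hb⟩ := Metric.eventually_nhds_iff_ball.1 (h1.and hFan)
        filter_upwards [ball_mem_nhds _ hr] with v hv
        refine (convex_ball _ r).is_const_of_fderivWithin_eq_zero (𝕜 := ℂ) (fun y hy => (hb y hy).2.differentiableAt.differentiableWithinAt)
          (fun y hy => ?_) hv (mem_ball_self hr)
        rw [fderivWithin_of_isOpen isOpen_ball hy]
        have := (hb y hy).2.differentiableAt.hasDerivAt.hasFDerivAt.fderiv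
        rw [this, (hb y hy).1]; ext; simp
      have h2 : ∀ᶠ u in 𝓝 u0, u = u0 := by
        filter_upwards [hc0.eventually hconst, h] with u h3 h4
        rw [← h4, h3, h.self_of_nhds]
      have h3 : ∀ᶠ u in 𝓝[≠] u0, False := by
        filter_upwards [nhdsWithin_le_nhds h2, self_mem_nhdsWithin] with u h5 h6
        exact h6 h5
      exact (NeBot.ne inferInstance : 𝓝[≠] u0 ≠ ⊥) (by simpa using h3)
    · exact h1
  refine Complex.analyticAt_of_differentiable_on_punctured_nhds_of_continuousAt ?_ hc0
  have htend : Tendsto χ (𝓝[≠] u0) (𝓝[≠] (χ u0)) := by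
    refine tendsto_nhdsWithin_iff.2 ⟨hc0.mono_left nhdsWithin_le_nhds, ?_⟩
    filter_upwards [nhdsWithin_le_nhds h, self_mem_nhdsWithin] with u h1 h2 e
    exact h2 (by rw [mem_singleton_iff, ← h1, e, h.self_of_nhds])
  filter_upwards [htend.eventually hd, nhdsWithin_le_nhds (hc0.eventually hFan), nhdsWithin_le_nhds hχ,
    nhdsWithin_le_nhds h.eventually_nhds] with u h1 h2 h3 h4
  exact (HasDerivAt.of_local_left_inverse h3 h2.differentiableAt.hasDerivAt h1 h4).differentiableAt

end CSphere
end

noncomputable section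
open Set Metric Topology Filter
namespace CSphere
namespace PC
variable {g : CSphere → CSphere} {z : CSphere} {c : Cht} {lam : ℂ}

lemma Fa_ne (h : PC g z c lam) {x : CSphere} (hx : x ∈ Fa g) (n : ℕ) : g^[n] x ≠ z := fun e =>
  h.zJ (e ▸ (Fa_iff h.hg n).2 hx)

lemma τ_ne (h : PC g z c lam) {x : CSphere} (hx : x ∈ Fa g) (n : ℕ) (hp : g^[n] x ≠ c.pole) : c.τ (g^[n] x) ≠ 0 := fun e =>
  h.Fa_ne hx n (by rw [← c.κτ hp, e, h.cz])

lemma R1 (h : PC g z c lam) {x : CSphere} (hx : x ∈ Fa g) (ht : Tendsto (fun n => g^[n] x) atTop (𝓝 z)) (c' : Cht) (hc : c'.κ 0 = x) :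
    ∃ r > 0, c'.D 0 r ⊆ Fa g ∧ ∀ η > 0, ∀ᶠ n in atTop, g^[n] '' c'.D 0 r ⊆ c.D 0 η := by
  have hDz : c.D 0 1 ∈ 𝓝 z := h.cz ▸ c.D_nhds one_pos
  obtain ⟨ε, hε, hεD⟩ := Metric.mem_nhds_iff.1 hDz
  have heq := Fa_eq hx
  rw [Metric.equicontinuousAt_iff_right] at heq
  have hO : {y | y ∈ Fa g ∧ ∀ n : ℕ, dist (g^[n] x) (g^[n] y) < ε / 2} ∈ 𝓝 (c'.κ 0) := by
    rw [hc]; exact Filter.inter_mem (Fa_open.mem_nhds hx) (heq _ (half_pos hε))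
  obtain ⟨r, hr, hrO⟩ := c'.D_basis hO
  refine ⟨r / 2, half_pos hr, fun y hy => (hrO (c'.D_mono (ball_subset_ball (by linarith)) hy)).1, fun η hη => ?_⟩
  have h1 := ht.eventually (ball_mem_nhds z (half_pos hε))
  have h2 : Tendsto (fun n => ‖c.τ (g^[n] x)‖) atTop (𝓝 0) := by
    have := ((c.τ_cont h.z_ne).tendsto.comp ht).norm
    rwa [h.τz, norm_zero] at this
  filter_upwards [h1, h2.eventually (gt_mem_nhds (pow_pos hη 3))] with n hn1 hn2
  have hin : ∀ v ∈ ball (0:ℂ) r, g^[n] (c'.κ v) ∈ c.D 0 1 := fun v hv => hεD (by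
    have := (hrO ⟨v, hv, rfl⟩).2 n
    rw [mem_ball]
    replace hn1 : dist (g^[n] x) z < ε / 2 := hn1
    have := dist_triangle_left (g^[n] (c'.κ v)) z (g^[n] x)
    linarith)
  rintro _ ⟨_, ⟨v, hv, rfl⟩, rfl⟩
  have hv' : v ∈ ball (0:ℂ) r := ball_subset_ball (by linarith) hv
  have hh := harnack (f := fun v => c.τ (g^[n] (c'.κ v))) (p := 0) (q := v) hr (fun w hw =>
      ((h.hg.iter n).anc c' c (c.mem_D.1 (hin w hw)).1).differentiableAt.differentiableWithinAt)
      (fun w hw => h.τ_ne (hrO ⟨w, hw, rfl⟩).1 n (c.mem_D.1 (hin w hw)).1)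
      (fun w hw => by simpa using (c.mem_D.1 (hin w hw)).2) (by rw [mem_ball] at hv; exact hv.le)
  rw [hc] at hh
  refine c.mem_D.2 ⟨(c.mem_D.1 (hin v hv')).1, ?_⟩
  rw [sub_zero]
  exact lt_of_pow_lt_pow_left₀ 3 hη.le (hh.trans_lt hn2)

lemma R3 (h : PC g z c lam) {B : Set CSphere} (hB : ∀ η > 0, ∀ᶠ n in atTop, g^[n] '' B ⊆ c.D 0 η) {d : ℝ} (hd : 0 < d)
    (hfr : ∃ᶠ n in atTop, ∃ v : ℂ, v ≠ 0 ∧ ∀ ζ : ℂ, ‖ζ‖ < d → c.κ (v * Complex.exp ζ) ∈ g^[n] '' B) : False := by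
  -- good radius
  obtain ⟨η, hη, hηg⟩ : ∃ η > 0, ∀ u : ℂ, ‖u‖ ≤ η → g (c.κ u) ≠ c.pole := by
    have h1 : ∀ᶠ u in 𝓝 (0:ℂ), g (c.κ u) ≠ c.pole :=
      (h.hg.cont.comp c.κ_cont).continuousAt.eventually_ne (by simp only [Function.comp]; rw [h.cz, h.fix]; exact h.z_ne)
    obtain ⟨r, hr, hb⟩ := Metric.eventually_nhds_iff_ball.1 h1
    exact ⟨r / 2, half_pos hr, fun u hu => hb u (by rw [mem_ball_zero_iff]; linarith)⟩
  obtain ⟨δ, hδ, hlog⟩ : ∃ δ > 0, ∀ w : ℂ, ‖w - 1‖ < δ → w ≠ 0 ∧ ‖Complex.log w‖ < d := by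
    have h1 : ∀ᶠ w in 𝓝 (1:ℂ), w ≠ 0 ∧ ‖Complex.log w‖ < d := by
      refine (eventually_ne_nhds one_ne_zero).and ?_
      have : ContinuousAt (fun w => ‖Complex.log w‖) 1 := (continuousAt_clog (by simp)).norm
      refine this.eventually (gt_mem_nhds (by simpa using hd))
    obtain ⟨r, hr, hb⟩ := Metric.eventually_nhds_iff_ball.1 h1
    exact ⟨r, hr, fun w hw => hb w (by rwa [mem_ball, dist_eq_norm])⟩
  have hlam := h.lam_ne
  obtain ⟨q, hq⟩ := lam_dense (lam := lam⁻¹) (by rw [norm_inv, h.nl, inv_one]) (fun n hn e => h.nr n hn (by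
    rwa [inv_pow, inv_eq_one] at e)) (half_pos hδ)
  have hψ : ∀ i, ∃ ψ : ℂ → ℂ, ∀ᶠ u in 𝓝 (0:ℂ), g^[i] (c.κ (ψ u)) = c.κ u ∧ ‖ψ u - lam⁻¹ ^ i * u‖ ≤ δ / 2 * ‖u‖ := by
    intro i
    have hF0 : c.τ (g^[i] (c.κ 0)) = 0 := by rw [h.cz, h.fixn, h.τz]
    have han := (h.hg.iter i).anc c c (u := 0) (by rw [h.cz, h.fixn]; exact h.z_ne)
    have hs := han.hasStrictDerivAt
    rw [(h.dern i).deriv] at hs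
    have hli := hs.to_localInverse (pow_ne_zero i hlam)
    have hri := hs.eventually_right_inverse (pow_ne_zero i hlam)
    have hψ0 := HasStrictFDerivAt.localInverse_apply_image (hs.hasStrictFDerivAt_equiv (pow_ne_zero i hlam))
    rw [hF0] at hli hri hψ0
    refine ⟨hs.localInverse _ _ _ (pow_ne_zero i hlam), ?_⟩
    set ψ := hs.localInverse _ _ _ (pow_ne_zero i hlam) with hψ
    replace hψ0 : ψ 0 = 0 := hψ0
    have h1 := hli.hasDerivAt.isLittleO.def (half_pos hδ)
    have h2 : ∀ᶠ u in 𝓝 (0:ℂ), g^[i] (c.κ (ψ u)) ≠ c.pole := by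
      have : ContinuousAt (fun u => g^[i] (c.κ (ψ u))) 0 :=
        ((h.hg.iter i).cont.comp c.κ_cont).continuousAt.comp hli.hasDerivAt.continuousAt
      exact this.eventually_ne (by rw [hψ0, h.cz, h.fixn]; exact h.z_ne)
    filter_upwards [h1, h2, hri] with u h1 h2 h3
    refine ⟨by rw [← h3, c.κτ h2, h3], ?_⟩
    simp only [hψ0, sub_zero, smul_eq_mul] at h1
    rwa [inv_pow, mul_comm _ u]
  choose ψ hψ using hψ
  have hall := (Filter.eventually_all_finset (Finset.range (q + 1))).2 fun i _ => hψ i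
  obtain ⟨ρ, hρ, hρb⟩ := Metric.eventually_nhds_iff_ball.1 hall
  obtain ⟨n0, hn0⟩ := eventually_atTop.1 (hB η hη)
  obtain ⟨n, ⟨v, hv0, hv⟩, hn1, hn2⟩ := (hfr.and_eventually ((hB (min ρ η) (lt_min hρ hη)).and (eventually_ge_atTop n0))).exists
  have hvn : ‖v‖ < min ρ η := by
    have := hn1 (hv 0 (by simpa using hd))
    rw [Complex.exp_zero, mul_one, c.κ_mem_D, sub_zero] at this; exact this
  have hvp : 0 < ‖v‖ := norm_pos_iff.2 hv0
  have hcirc : ∀ u : ℂ, ‖u‖ = ‖v‖ → ∀ m, g^[m] (c.κ u) ∈ c.D 0 η := by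
    intro u hu m
    obtain ⟨i, hi, hi'⟩ := hq (u / v) (by rw [norm_div, hu, div_self hvp.ne'])
    obtain ⟨h1, h2⟩ := hρb u (by rw [mem_ball_zero_iff, hu]; exact hvn.trans_le (min_le_left _ _)) i (Finset.mem_range.2 (by omega))
    have h3 : ‖ψ i u / v - 1‖ < δ := by
      have e : ψ i u / v - 1 = (ψ i u - lam⁻¹ ^ i * u) / v + (lam⁻¹ ^ i * (u / v) - 1) := by field_simp; ring
      rw [e]
      refine (norm_add_le _ _).trans_lt ?_
      rw [norm_div]
      have : ‖ψ i u - lam⁻¹ ^ i * u‖ / ‖v‖ ≤ δ / 2 := by rw [div_le_iff₀ hvp, ← hu]; exact h2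
      linarith
    obtain ⟨h4, h5⟩ := hlog _ h3
    obtain ⟨b, hb, hb'⟩ := hv _ h5
    rw [Complex.exp_log h4, mul_div_cancel₀ _ hv0] at hb'
    rw [← h1, ← hb', ← Function.iterate_add_apply, ← Function.iterate_add_apply]
    exact hn0 _ (by omega) ⟨b, hb, rfl⟩
  have hind : ∀ m, ∀ u ∈ closedBall (0:ℂ) ‖v‖, g^[m] (c.κ u) ≠ c.pole ∧ ‖c.τ (g^[m] (c.κ u))‖ ≤ η := by
    intro m
    induction m with
    | zero =>
      intro u hu
      refine ⟨c.κ_ne u, ?_⟩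
      rw [mem_closedBall_zero_iff] at hu
      simpa using hu.trans (hvn.le.trans (min_le_right _ _))
    | succ m ih =>
      have hne : ∀ u ∈ closedBall (0:ℂ) ‖v‖, g^[m+1] (c.κ u) ≠ c.pole := by
        intro u hu
        rw [Function.iterate_succ_apply', ← c.κτ (ih u hu).1]
        exact hηg _ (ih u hu).2
      intro u hu
      refine ⟨hne u hu, ?_⟩
      have hcl : closure (ball (0:ℂ) ‖v‖) = closedBall 0 ‖v‖ := closure_ball _ hvp.ne'
      have hdiff : DifferentiableOn ℂ (fun u => c.τ (g^[m+1] (c.κ u))) (closedBall 0 ‖v‖) := fun w hw =>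
        ((h.hg.iter (m+1)).anc c c (hne w hw)).differentiableAt.differentiableWithinAt
      refine Complex.norm_le_of_forall_mem_frontier_norm_le (U := ball (0:ℂ) ‖v‖) isBounded_ball
        (f := fun u => c.τ (g^[m+1] (c.κ u))) (hdiff.diffContOnCl_ball subset_rfl) (fun w hw => ?_) (hcl ▸ hu)
      rw [frontier_ball _ hvp.ne', mem_sphere_zero_iff_norm] at hw
      simpa using (c.mem_D.1 (hcirc w hw (m+1))).2.le
  refine h.zJ (sub_Fa h.hg (c.D_open 0 ‖v‖) (O := c.κ '' (closedBall 0 η)ᶜ) (c.κ_open isClosed_closedBall.isOpen_compl)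
    ?_ 0 ?_ (h.cz ▸ mem_of_mem_nhds (c.D_nhds hvp)))
  · refine ⟨c.κ ((η + 1 : ℝ) : ℂ), mem_image_of_mem _ ?_⟩
    rw [mem_compl_iff, mem_closedBall_zero_iff, Complex.norm_real, Real.norm_eq_abs, abs_of_pos (by linarith)]
    linarith
  · rintro m - _ ⟨u, hu, rfl⟩ ⟨w, hw, hw'⟩
    have := (hind m u (ball_subset_closedBall hu)).2
    rw [← hw', c.τκ] at this
    exact hw (by simpa using this)

lemma R2 (h : PC g z c lam) {x : CSphere} (hx : x ∈ Fa g) (ht : Tendsto (fun n => g^[n] x) atTop (𝓝 z)) :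
    ∀ᶠ y in 𝓝 x, y ∈ Fa g ∧ Tendsto (fun n => g^[n] y) atTop (𝓝 z) ∧
      Tendsto (fun n => c.τ (g^[n] y) / c.τ (g^[n] x)) atTop (𝓝 1) := by
  obtain ⟨c', hc⟩ := exists_chart x
  obtain ⟨r, hr, hrF, hru⟩ := h.R1 hx ht c' hc
  have hD : c'.D 0 (r / 4) ∈ 𝓝 x := hc ▸ c'.D_nhds (by positivity)
  filter_upwards [hD] with y hy
  have hy' : y ∈ c'.D 0 r := c'.D_mono (ball_subset_ball (by linarith)) hy
  refine ⟨hrF hy', ?_, ?_⟩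
  · rw [Filter.tendsto_def]
    intro O hO
    obtain ⟨η, hη, hηO⟩ := c.D_basis (u := 0) (h.cz.symm ▸ hO)
    filter_upwards [hru η hη] with n hn
    exact hηO (hn ⟨y, hy', rfl⟩)
  · by_contra hnt
    rw [Metric.tendsto_nhds] at hnt
    push Not at hnt
    obtain ⟨η, hη, hfr⟩ := hnt
    obtain ⟨δ, hδ, hexp⟩ : ∃ δ > 0, ∀ ζ : ℂ, ‖ζ‖ < δ → ‖Complex.exp ζ - 1‖ < η := by
      have : ContinuousAt (fun ζ : ℂ => ‖Complex.exp ζ - 1‖) 0 := by fun_prop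
      have := this.eventually (gt_mem_nhds (show ‖Complex.exp 0 - 1‖ < η by simpa using hη))
      obtain ⟨δ, hδ, hb⟩ := Metric.eventually_nhds_iff_ball.1 this
      exact ⟨δ, hδ, fun ζ hζ => hb ζ (by simpa using hζ)⟩
    refine h.R3 hru (d := δ / 128) (by positivity) ((hfr.and_eventually (hru 1 one_pos)).mono ?_)
    rintro n ⟨hn, hn1⟩
    obtain ⟨v0, hv0, rfl⟩ := hy
    have hne : ∀ v ∈ ball (0:ℂ) r, g^[n] (c'.κ v) ≠ c.pole := fun v hv => (c.mem_D.1 (hn1 ⟨_, ⟨v, hv, rfl⟩, rfl⟩)).1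
    obtain ⟨L, hL, hfL⟩ := exists_log (f := fun v => c.τ (g^[n] (c'.κ v))) (p := 0) hr (fun w hw =>
      ((h.hg.iter n).anc c' c (hne w hw)).differentiableAt.differentiableWithinAt)
      (fun w hw => h.τ_ne (hrF ⟨w, hw, rfl⟩) n (hne w hw))
    have h0 : (0:ℂ) ∈ ball (0:ℂ) r := mem_ball_self hr
    have hv0r : v0 ∈ ball (0:ℂ) r := ball_subset_ball (by linarith) hv0
    have hbig : δ ≤ ‖L v0 - L 0‖ := by
      by_contra! hlt
      have := hexp _ hlt
      rw [Complex.exp_sub, ← hfL _ hv0r, ← hfL _ h0] at this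
      simp only [hc] at this
      rw [dist_eq_norm] at hn
      linarith
    obtain ⟨v1, hv1, hv1d⟩ : ∃ v1 ∈ ball (0:ℂ) (r / 4), δ / r ≤ ‖deriv L v1‖ := by
      by_contra! hcon
      have h1 := (convex_ball (0:ℂ) (r/4)).norm_image_sub_le_of_norm_hasDerivWithin_le (f := L) (f' := deriv L) (C := δ / r)
        (fun w hw => (hL.differentiableAt (isOpen_ball.mem_nhds (ball_subset_ball (by linarith) hw))).hasDerivAt.hasDerivWithinAt)
        (fun w hw => (hcon w hw).le) (mem_ball_self (by positivity)) hv0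
      rw [sub_zero] at h1
      rw [mem_ball_zero_iff] at hv0
      have : δ / r * ‖v0‖ < δ / r * r := by gcongr; linarith
      rw [div_mul_cancel₀ _ hr.ne'] at this
      linarith
    rw [mem_ball_zero_iff] at hv1
    have hs1 : ball v1 (3 * r / 4) ⊆ ball (0:ℂ) r := ball_subset_ball' (by rw [dist_zero_right]; linarith)
    have hs2 : ball v1 (r / 2) ⊆ ball (0:ℂ) r := (ball_subset_ball (by linarith)).trans hs1
    obtain ⟨y, hy, hyb⟩ := bloch (r := r / 2) (R := 3 * r / 4) (by positivity) (by linarith) (hL.mono hs1)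
      ((by positivity : 0 < δ / r).trans_le hv1d)
    refine ⟨Complex.exp (L y), Complex.exp_ne_zero _, fun ζ hζ => ?_⟩
    have hd2 : δ / 128 ≤ ‖deriv L v1‖ * (r / 2) / 64 := by
      rw [div_le_iff₀ hr] at hv1d; linarith
    obtain ⟨w, hw, hw'⟩ := hyb (show L y + ζ ∈ _ by rw [mem_ball, dist_eq_norm, add_sub_cancel_left]; linarith)
    refine ⟨c'.κ w, ⟨w, hs2 hw, rfl⟩, ?_⟩
    rw [← Complex.exp_add, ← hw', ← hfL w (hs2 hw), c.κτ (hne w (hs2 hw))]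

lemma Bz_closed {x : CSphere} (hx : x ∈ Fa g) (hcl : ∀ O ∈ 𝓝 x, ∃ y ∈ O, Tendsto (fun n => g^[n] y) atTop (𝓝 z)) :
    Tendsto (fun n => g^[n] x) atTop (𝓝 z) := by
  rw [Metric.tendsto_nhds]
  intro ε hε
  have heq := Fa_eq hx
  rw [Metric.equicontinuousAt_iff_right] at heq
  obtain ⟨y, hy, hyt⟩ := hcl _ (heq (ε / 2) (half_pos hε))
  filter_upwards [(Metric.tendsto_nhds.1 hyt) (ε / 2) (half_pos hε)] with n hn
  have := hy n
  have := dist_triangle (g^[n] x) (g^[n] y) z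
  linarith

lemma ratio (h : PC g z c lam) {Q : Set CSphere} (hQ : IsPreconnected Q) (hQF : Q ⊆ Fa g) {x y : CSphere} (hx : x ∈ Q) (hy : y ∈ Q)
    (ht : Tendsto (fun n => g^[n] x) atTop (𝓝 z)) : Tendsto (fun n => g^[n] y) atTop (𝓝 z) ∧
      Tendsto (fun n => c.τ (g^[n] y) / c.τ (g^[n] x)) atTop (𝓝 1) := by
  have hpole : ∀ {w}, Tendsto (fun n => g^[n] w) atTop (𝓝 z) → ∀ᶠ n in atTop, g^[n] w ≠ c.pole := fun hw =>
    hw.eventually_ne h.z_ne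
  refine hQ.induction₂' (fun x y => Tendsto (fun n => g^[n] x) atTop (𝓝 z) → Tendsto (fun n => g^[n] y) atTop (𝓝 z) ∧
      Tendsto (fun n => c.τ (g^[n] y) / c.τ (g^[n] x)) atTop (𝓝 1)) (fun x hx => ?_) ?_ hx hy ht
  · refine nhdsWithin_le_nhds ?_
    by_cases hxt : Tendsto (fun n => g^[n] x) atTop (𝓝 z)
    · filter_upwards [h.R2 (hQF hx) hxt] with y hy
      refine ⟨fun _ => hy.2, fun _ => ⟨hxt, ?_⟩⟩
      simpa using hy.2.2.inv₀ one_ne_zero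
    · have : ∃ O ∈ 𝓝 x, ∀ y ∈ O, ¬ Tendsto (fun n => g^[n] y) atTop (𝓝 z) := by
        by_contra! hcon
        exact hxt (Bz_closed (hQF hx) hcon)
      obtain ⟨O, hO, hOn⟩ := this
      filter_upwards [hO] with y hy
      exact ⟨fun hh => absurd hh hxt, fun hh => absurd hh (hOn y hy)⟩
  · intro a b d _ hb hd hab hbd hat
    obtain ⟨h1, h2⟩ := hab hat
    obtain ⟨h3, h4⟩ := hbd h1
    refine ⟨h3, ?_⟩
    have := h4.mul h2
    rw [one_mul] at this
    refine this.congr' ?_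
    filter_upwards [hpole h1] with n hn
    rw [div_mul_div_cancel₀ (h.τ_ne (hQF hb) n hn)]

lemma wander (h : PC g z c lam) {y : CSphere} (hy : y ∈ Fa g) (ht : Tendsto (fun n => g^[n] y) atTop (𝓝 z))
    {Q : Set CSphere} (hQ : IsPreconnected Q) (hQF : Q ⊆ Fa g) {m n : ℕ} (hm : g^[m] y ∈ Q) (hn : g^[n] y ∈ Q) : m = n := by
  wlog hmn : m ≤ n generalizing m n
  · exact (this hn hm (by omega)).symm
  by_contra hne
  obtain ⟨p, rfl⟩ := Nat.exists_eq_add_of_le hmn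
  have ht' : Tendsto (fun k => g^[k] (g^[m] y)) atTop (𝓝 z) := by
    have := ht.comp (tendsto_add_atTop_nat m)
    refine this.congr fun k => ?_
    simp only [Function.comp]; rw [Function.iterate_add_apply]
  have h1 := (h.ratio hQ hQF hm hn ht').2
  have hτ : Tendsto (fun k => c.τ (g^[k] (g^[m] y))) atTop (𝓝[≠] 0) := by
    refine tendsto_nhdsWithin_iff.2 ⟨?_, ?_⟩
    · have := (c.τ_cont h.z_ne).tendsto.comp ht'
      rwa [h.τz] at this
    · filter_upwards [ht'.eventually_ne h.z_ne] with k hk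
      exact h.τ_ne (hQF hm) k hk
  have h2 := (h.dern p).tendsto_slope.comp hτ
  refine h.nr p (by omega) (tendsto_nhds_unique (h2.congr' ?_) h1)
  filter_upwards [ht'.eventually_ne h.z_ne] with k hk
  simp only [Function.comp, slope_def_field, sub_zero]
  rw [c.κτ hk, h.cz, h.fixn, h.τz, sub_zero, ← Function.iterate_add_apply, ← Function.iterate_add_apply, ← Function.iterate_add_apply,
    ← Function.iterate_add_apply, show k + (m + p) = p + k + m by omega]
end PC
end CSphere
end

noncomputable section
open Set Metric Topology Filter
namespace CSphere

lemma section_ex {f : CSphere → CSphere} (hf : Hol f) (c : Cht) {w : ℂ} {d : ℝ} (hd : 0 < d) {y : CSphere} (hy : f y = c.κ w)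
    (hinj : ∀ x ∈ connectedComponentIn (f ⁻¹' c.D w d) y, ∃ O ∈ 𝓝 x, InjOn f O) :
    ∃ χ : ℂ → CSphere, ContinuousOn χ (ball w d) ∧ χ w = y ∧
      ∀ u ∈ ball w d, χ u ∈ connectedComponentIn (f ⁻¹' c.D w d) y ∧ f (χ u) = c.κ u := by
  set P := connectedComponentIn (f ⁻¹' c.D w d) y with hP
  have hPo : IsOpen P := ((c.D_open _ _).preimage hf.cont).connectedComponentIn
  have hPD : P ⊆ f ⁻¹' c.D w d := connectedComponentIn_subset _ _
  have hyP : y ∈ P := mem_connectedComponentIn (by rw [mem_preimage, hy]; exact c.κ_mem_D.2 (by simpa using hd))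
  let p : P → ball w d := fun x => ⟨c.τ (f x), by simpa [dist_eq_norm] using (c.mem_D.1 (hPD x.2)).2⟩
  have hκ : ∀ x : P, c.κ (p x) = f x := fun x => c.κτ (c.mem_D.1 (hPD x.2)).1
  have hpx : ∀ (x : P) (u : ball w d), p x = u ↔ f x = c.κ u := fun x u =>
    ⟨fun e => by rw [← e, hκ], fun e => Subtype.ext (c.κ_inj (by rw [hκ, e]))⟩
  have hpc : Continuous p := by
    refine Continuous.subtype_mk (continuous_iff_continuousAt.2 fun x => ?_) _
    exact ContinuousAt.comp (g := c.τ) (f := fun x : P => f x) (c.τ_cont (c.mem_D.1 (hPD x.2)).1) (hf.cont.comp continuous_subtype_val).continuousAt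
  have hcl : IsClosedMap p := by
    intro C hC
    obtain ⟨C', hC', rfl⟩ := isClosed_induced_iff.1 hC
    have hK : IsClosed (f '' (closure P ∩ C')) := ((isClosed_closure.inter hC').isCompact.image hf.cont).isClosed
    have : p '' (Subtype.val ⁻¹' C') = (fun u : ball w d => c.κ u) ⁻¹' (f '' (closure P ∩ C')) := by
      ext u
      constructor
      · rintro ⟨x, hx, rfl⟩
        exact ⟨x, ⟨subset_closure x.2, hx⟩, (hκ x).symm⟩
      · rintro ⟨x, ⟨hx, hxC⟩, e⟩
        have hxP : x ∈ P := comp_closed hx (by rw [e]; exact ⟨u, u.2, rfl⟩)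
        exact ⟨⟨x, hxP⟩, hxC, (hpx _ _).2 e⟩
    rw [this]
    exact hK.preimage (c.κ_cont.comp continuous_subtype_val)
  have hop : IsOpenMap p := by
    intro C hC
    have : p '' C = (fun u : ball w d => c.κ u) ⁻¹' (f '' (Subtype.val '' C)) := by
      ext u
      constructor
      · rintro ⟨x, hx, rfl⟩
        exact ⟨x, ⟨x, hx, rfl⟩, (hκ x).symm⟩
      · rintro ⟨_, ⟨x, hx, rfl⟩, e⟩
        exact ⟨x, hx, (hpx _ _).2 e⟩
    rw [this]
    exact (hf.isOpenMap _ (hPo.isOpenMap_subtype_val _ hC)).preimage (c.κ_cont.comp continuous_subtype_val)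
  have hlh : IsLocalHomeomorph p := by
    rw [isLocalHomeomorph_iff_isOpenEmbedding_restrict]
    intro x
    obtain ⟨O, hO, hOi⟩ := hinj x x.2
    obtain ⟨O', hO'O, hO', hxO'⟩ := _root_.mem_nhds_iff.1 hO
    have hUo : IsOpen (Subtype.val ⁻¹' O' : Set P) := hO'.preimage continuous_subtype_val
    refine ⟨Subtype.val ⁻¹' O', hUo.mem_nhds hxO', .of_continuous_injective_isOpenMap ?_ ?_ ?_⟩
    · exact hpc.comp continuous_subtype_val
    · rintro ⟨a, ha⟩ ⟨b, hb⟩ e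
      have e' : p a = p b := e
      refine Subtype.ext (Subtype.ext (hOi (hO'O ha) (hO'O hb) ?_))
      rw [← hκ, ← hκ, e']
    · exact hop.comp hUo.isOpenMap_subtype_val
  have hcov : IsCoveringMap p := by
    rw [isCoveringMap_iff_isCoveringMapOn_univ]
    refine hcl.isCoveringMapOn_of_isLocalHomeomorphOn (fun u _ => ?_) (fun x _ => hlh x)
    refine Finite.of_finite_image (f := Subtype.val) ((hf.finfib (c.κ u)).subset ?_) Subtype.val_injective.injOn
    rintro _ ⟨x, hx, rfl⟩
    exact (hpx _ _).1 hx
  have : ContractibleSpace (ball w d) := (convex_ball w d).contractibleSpace ⟨w, mem_ball_self hd⟩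
  have : LocallyPathConnectedSpace (ball w d) := (convex_ball w d).locallyPathConnectedSpace
  obtain ⟨F, ⟨hF0, hF⟩, -⟩ := hcov.existsUnique_continuousMap_lifts (ContinuousMap.id _) ⟨w, mem_ball_self hd⟩ ⟨y, hyP⟩ ((hpx _ _).2 hy)
  classical
  refine ⟨fun u => if hu : u ∈ ball w d then F ⟨u, hu⟩ else y, ?_, ?_, ?_⟩
  · rw [continuousOn_iff_continuous_domRestrict]
    refine (continuous_subtype_val.comp F.continuous).congr fun u => ?_
    simp [Set.domRestrict]
  · simp [hd, hF0]
  · intro u hu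
    simp only [dif_pos hu]
    exact ⟨(F ⟨u, hu⟩).2, (hpx _ _).1 (congrFun hF ⟨u, hu⟩)⟩

lemma sec_an {f : CSphere → CSphere} (hf : Hol f) (c c' : Cht) {w : ℂ} {d : ℝ} {χ : ℂ → CSphere} (hχ : ContinuousOn χ (ball w d))
    (h : ∀ u ∈ ball w d, f (χ u) = c.κ u) {u0 : ℂ} (hu : u0 ∈ ball w d) (hne : χ u0 ≠ c'.pole) :
    AnalyticAt ℂ (fun u => c'.τ (χ u)) u0 := by
  have hc : ∀ u ∈ ball w d, ContinuousAt χ u := fun u hu => hχ.continuousAt (isOpen_ball.mem_nhds hu)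
  have hb : ∀ᶠ u in 𝓝 u0, u ∈ ball w d := isOpen_ball.mem_nhds hu
  have hp : ∀ᶠ u in 𝓝 u0, χ u ≠ c'.pole := (hc u0 hu).eventually_ne hne
  refine inv_an (F := fun v => c.τ (f (c'.κ v))) ?_ (hf.anc c' c ?_) ?_
  · filter_upwards [hb, hp] with u h1 h2
    exact ContinuousAt.comp (g := c'.τ) (f := χ) (c'.τ_cont h2) (hc u h1)
  · rw [c'.κτ hne, h u0 hu]; exact c.κ_ne _
  · filter_upwards [hb, hp] with u h1 h2
    rw [c'.κτ h2, h u h1, c.τκ]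

def Crit (f : CSphere → CSphere) : Set CSphere := {x | ¬ ∃ O ∈ 𝓝 x, InjOn f O}

lemma inj_chart {f : CSphere → CSphere} (c c' : Cht) (hf : Hol f) {u : ℂ} (hp : f (c.κ u) ≠ c'.pole)
    (hd : deriv (fun v => c'.τ (f (c.κ v))) u ≠ 0) : ∃ O ∈ 𝓝 (c.κ u), InjOn f O := by
  have hs := (hf.anc c c' hp).hasStrictDerivAt
  have h1 := (hs.hasStrictFDerivAt_equiv hd).eventually_left_inverse
  refine ⟨_, c.κ_emb.image_mem_nhds.2 h1, ?_⟩
  rintro _ ⟨a, ha, rfl⟩ _ ⟨b, hb, rfl⟩ e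
  rw [mem_ofPred_eq] at ha hb
  rw [← ha, ← hb]
  simp only [e]

lemma crit_fin {f : CSphere → CSphere} (hf : Hol f) : (Crit f).Finite := by
  by_contra hinf
  obtain ⟨x, hx⟩ := Set.Infinite.exists_accPt_principal hinf
  rw [accPt_iff_frequently_nhdsNE] at hx
  obtain ⟨c, rfl⟩ := exists_chart x
  obtain ⟨c', hc'⟩ := exists_chart (f (c.κ 0))
  have hp : ∀ᶠ u in 𝓝 (0:ℂ), f (c.κ u) ≠ c'.pole :=
    (hf.cont.comp c.κ_cont).continuousAt.eventually_ne (by rw [Function.comp, ← hc']; exact c'.κ_ne 0)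
  have han := hf.anc c c' hp.self_of_nhds
  have hd : ∀ᶠ u in 𝓝[≠] (0:ℂ), deriv (fun v => c'.τ (f (c.κ v))) u ≠ 0 := by
    rcases han.deriv.eventually_eq_zero_or_eventually_ne_zero with h1 | h1
    · exfalso
      obtain ⟨r, hr, hb⟩ := Metric.eventually_nhds_iff_ball.1 (h1.and (hp.and han.eventually_analyticAt))
      have hcst : ∀ u ∈ ball (0:ℂ) r, c'.τ (f (c.κ u)) = c'.τ (f (c.κ 0)) := fun u hu =>
        isOpen_ball.is_const_of_deriv_eq_zero (convex_ball _ _).isPreconnected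
          (fun v hv => (hb v hv).2.2.differentiableAt.differentiableWithinAt) (fun v hv => (hb v hv).1) hu (mem_ball_self hr)
      refine nebot_ne (c.κ 0) (c.D 0 r) (c.D_nhds hr) ((hf.finfib (f (c.κ 0))).subset ?_)
      rintro _ ⟨u, hu, rfl⟩
      rw [mem_preimage, mem_singleton_iff, ← c'.κτ (hb u hu).2.1, hcst u hu, c'.κτ hp.self_of_nhds]
    · exact h1
  refine hx ?_
  have key : ∀ᶠ u in 𝓝[≠] (0:ℂ), c.κ u ∉ Crit f := by
    filter_upwards [hd, nhdsWithin_le_nhds hp] with u h1 h2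
    exact not_not.2 (inj_chart c c' hf h2 h1)
  rw [eventually_nhdsWithin_iff] at key ⊢
  obtain ⟨s, hs, hsk⟩ := eventually_iff_exists_mem.1 key
  filter_upwards [c.κ_emb.image_mem_nhds.2 hs]
  rintro _ ⟨u, hu, rfl⟩ hne
  exact hsk u hu (fun e => hne (by rw [e]; rfl))
end CSphere
end

noncomputable section
open Set Metric Topology Filter
namespace CSphere

lemma ncard_fib {S T : Set CSphere} {φ : CSphere → CSphere} {a b : ℕ} (hS : S.Finite) (hT : T.Finite) (hm : MapsTo φ S T)
    (hTb : T.ncard ≤ b) (hf : ∀ w, (S ∩ φ ⁻¹' {w}).ncard ≤ a) : S.ncard ≤ a * b := by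
  classical
  rw [ncard_eq_toFinset_card S hS]
  rw [ncard_eq_toFinset_card T hT] at hTb
  refine (Finset.card_le_mul_card_image_of_maps_to (t := hT.toFinset) (f := φ) (n := a) (fun x hx => ?_) fun w _ => ?_).trans (Nat.mul_le_mul_left a hTb)
  · simpa using hm (by simpa using hx)
  · refine le_trans (le_of_eq ?_) (hf w)
    rw [← ncard_coe_finset]
    congr 1
    ext x; simp

structure DC (g : CSphere → CSphere) (c : Cht) (R ε0 : ℝ) (N : ℕ) (F : Set CSphere) : Prop where
  Rp : 0 < R
  ep : 0 < ε0
  inj : InjOn g (c.D 0 R)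
  Fc : IsCompact F
  FF : F ⊆ Fa g
  deg : ∀ n V, IsPreconnected V → g^[n] '' V ⊆ c.D 0 R → (∀ i, 1 ≤ i → i < n → Small ε0 (g^[i] '' V) ∧ Disjoint (g^[i] '' V) F) →
    ∀ w, (V ∩ g^[n] ⁻¹' {w}).ncard ≤ N

lemma SHt_unif {g : CSphere → CSphere} {K : Set CSphere} (hK : IsCompact K) (h : ∀ p ∈ K, SHt g p) :
    ∃ N : ℕ, ∃ δ > 0, ∀ p ∈ K, ∀ n V, IsPreconnected V → g^[n] '' V ⊆ ball p δ → ∀ w, (V ∩ g^[n] ⁻¹' {w}).ncard ≤ N := by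
  refine hK.induction_on (p := fun K => ∃ N : ℕ, ∃ δ > 0, ∀ p ∈ K, ∀ n V, IsPreconnected V → g^[n] '' V ⊆ ball p δ → ∀ w, (V ∩ g^[n] ⁻¹' {w}).ncard ≤ N)
    ⟨0, 1, one_pos, fun p hp => hp.elim⟩ ?_ ?_ ?_
  · rintro s t hst ⟨N, δ, hδ, h⟩; exact ⟨N, δ, hδ, fun p hp => h p (hst hp)⟩
  · rintro s t ⟨N, δ, hδ, h⟩ ⟨N', δ', hδ', h'⟩
    refine ⟨max N N', min δ δ', lt_min hδ hδ', ?_⟩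
    rintro p (hp | hp) n V hV hVb w
    · exact (h p hp n V hV (hVb.trans (ball_subset_ball (min_le_left _ _))) w).trans (le_max_left _ _)
    · exact (h' p hp n V hV (hVb.trans (ball_subset_ball (min_le_right _ _))) w).trans (le_max_right _ _)
  · intro p hp
    obtain ⟨N, B, hB, hpB, hN⟩ := h p hp
    obtain ⟨δ, hδ, hδB⟩ := Metric.isOpen_iff.1 hB p hpB
    refine ⟨ball p (δ / 2), mem_nhdsWithin_of_mem_nhds (ball_mem_nhds _ (half_pos hδ)), N, δ / 2, half_pos hδ, ?_⟩
    intro q hq n V hV hVb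
    exact hN n V hV (hVb.trans ((ball_subset_ball' (by rw [mem_ball] at hq; linarith)).trans hδB))

lemma PC.exists_DC {g : CSphere → CSphere} {z : CSphere} {c : Cht} {lam : ℂ} (h : PC g z c lam) :
    ∃ R ε0 N F, DC g c R ε0 N F := by
  obtain ⟨d, hd⟩ := h.hg.fib
  obtain ⟨B, hB, hBs⟩ := h.sh
  obtain ⟨O1, hO1, hO1i⟩ := inj_chart c c h.hg (u := 0) (by rw [h.cz, h.fix]; exact h.z_ne) (by rw [h.der.deriv]; exact h.lam_ne)
  obtain ⟨R1, hR1, hR1O⟩ := c.D_basis hO1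
  choose Na Ba hBao haB hNa using h.pre
  let P : Set CSphere := interior B ∪ {x | ∃ a, ∃ (h1 : g a = z) (h2 : a ≠ z), x ∈ Ba a h1 h2}
  have hPo : IsOpen P := by
    refine isOpen_interior.union (isOpen_iff_mem_nhds.2 ?_)
    rintro x ⟨a, h1, h2, hx⟩
    exact mem_of_superset ((hBao a h1 h2).mem_nhds hx) fun y hy => ⟨a, h1, h2, hy⟩
  obtain ⟨O2, hO2, hzO2, hO2P⟩ := exists_nhds_preimage h.hg.cont (p := z) hPo (by
    intro a ha
    by_cases haz : a = z
    · rw [haz]; exact Or.inl (mem_interior_iff_mem_nhds.2 hB)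
    · exact Or.inr ⟨a, ha, haz, haB a ha haz⟩)
  obtain ⟨R2, hR2, hR2O⟩ := c.D_basis (u := 0) (O := O2) (by rw [h.cz]; exact hO2.mem_nhds hzO2)
  set R := min R1 R2 / 2 with hR
  have hRp : 0 < R := by have := lt_min hR1 hR2; positivity
  have hRR1 : R < R1 := by have := min_le_left R1 R2; rw [hR]; have := lt_min hR1 hR2; linarith
  have hRR2 : R < R2 := by have := min_le_right R1 R2; rw [hR]; have := lt_min hR1 hR2; linarith
  have hinj : InjOn g (c.D 0 R) := hO1i.mono ((c.D_mono (ball_subset_ball hRR1.le)).trans hR1O)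
  set X : Set CSphere := g ⁻¹' (c.κ '' closedBall 0 R) ∩ (c.D 0 (R / 2))ᶜ with hX
  have hXc : IsClosed X := (((isCompact_closedBall _ _).image c.κ_cont).isClosed.preimage h.hg.cont).inter (c.D_open _ _).isClosed_compl
  have hKS : ∀ p ∈ X ∩ Ju g, SHt g p := by
    rintro p ⟨⟨hp1, hp2⟩, hpJ⟩
    have hpP : p ∈ P := hO2P (hR2O ((image_mono (closedBall_subset_ball hRR2)) hp1))
    rcases hpP with hpB | ⟨a, h1, h2, hpa⟩
    · refine hBs p (interior_subset hpB) hpJ fun e => hp2 ?_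
      rw [e, ← h.cz]; exact c.κ_mem_D.2 (by simpa using half_pos hRp)
    · exact ⟨Na a h1 h2, Ba a h1 h2, hBao a h1 h2, hpa, hNa a h1 h2⟩
  obtain ⟨N0, δ, hδ, hN0⟩ := SHt_unif (hXc.inter Ju_closed).isCompact hKS
  set F : Set CSphere := X ∩ {x | ∀ p ∈ X ∩ Ju g, δ / 2 ≤ dist x p} with hF
  have hFc : IsClosed F := by
    refine hXc.inter ?_
    simp only [Set.ofPred_forall]
    exact isClosed_biInter fun p _ => isClosed_le continuous_const (by fun_prop)
  have raw : ∀ n V, IsPreconnected V → g^[n] '' V ⊆ c.D 0 R → (∀ i, i < n → Small (δ / 4) (g^[i] '' V) ∧ Disjoint (g^[i] '' V) F) →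
      ∀ w, (V ∩ g^[n] ⁻¹' {w}).ncard ≤ N0 * d + 1 := by
    intro n
    induction n with
    | zero =>
      intro V _ _ _ w
      have : (V ∩ g^[0] ⁻¹' {w}).ncard ≤ ({w} : Set CSphere).ncard := ncard_le_ncard (fun x hx => hx.2)
      rw [ncard_singleton] at this; omega
    | succ n ih =>
      intro V hV hVD hi w
      have hfin : ∀ m w, (V ∩ g^[m] ⁻¹' {w}).Finite := fun m w => ((h.hg.iter m).finfib w).subset inter_subset_right
      by_cases hmeet : (g^[n] '' V ∩ X).Nonempty
      · obtain ⟨x, hxV, hxX⟩ := hmeet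
        obtain ⟨hsm, hdis⟩ := hi n (by omega)
        have hxF : x ∉ F := fun hxF => disjoint_left.1 hdis hxV hxF
        have : ∃ p ∈ X ∩ Ju g, dist x p < δ / 2 := by
          by_contra! hc; exact hxF ⟨hxX, hc⟩
        obtain ⟨p, hp, hxp⟩ := this
        have hb := hN0 p hp n V hV (fun y hy => by
          have := hsm y hy x hxV
          have := dist_triangle y x p
          rw [mem_ball]; linarith)
        refine (ncard_fib (φ := g^[n]) (T := g ⁻¹' {w}) (hfin (n+1) w) (h.hg.finfib w) (fun x hx => ?_) (hd w).2 (a := N0) fun v => ?_).trans (by omega)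
        · have := hx.2; rwa [mem_preimage, Function.iterate_succ_apply'] at this
        · exact (ncard_le_ncard (inter_subset_inter_left _ inter_subset_left) (hfin n v)).trans (hb v)
      · have hsub : g^[n] '' V ⊆ c.D 0 R := by
          intro y hy
          by_contra hcon
          refine hmeet ⟨y, hy, ?_, fun h2 => hcon (c.D_mono (ball_subset_ball (by linarith)) h2)⟩
          obtain ⟨x, hx, rfl⟩ := hy
          have := hVD ⟨x, hx, rfl⟩
          rw [Function.iterate_succ_apply'] at this
          exact image_mono ball_subset_closedBall this
        rcases (V ∩ g^[n+1] ⁻¹' {w}).eq_empty_or_nonempty with he | ⟨x, hxV, hx⟩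
        · rw [he]; simp
        · refine (ncard_le_ncard (t := V ∩ g^[n] ⁻¹' {g^[n] x}) ?_ (hfin n _)).trans (ih V hV hsub (fun i hin => hi i (by omega)) _)
          rintro y ⟨hyV, hy⟩
          refine ⟨hyV, hinj (hsub ⟨y, hyV, rfl⟩) (hsub ⟨x, hxV, rfl⟩) ?_⟩
          rw [← Function.iterate_succ_apply' g, ← Function.iterate_succ_apply' g]
          exact (mem_singleton_iff.1 hy).trans (mem_singleton_iff.1 hx).symm
  refine ⟨R, δ / 4, d * (N0 * d + 1) + 1, F, hRp, by positivity, hinj, hFc.isCompact, ?_, ?_⟩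
  · rintro x ⟨hx, hx'⟩
    by_contra hxJ
    have := hx' x ⟨hx, hxJ⟩
    rw [dist_self] at this; linarith
  · intro n V hV hVD hi w
    cases n with
    | zero =>
      have := raw 0 V hV hVD (fun i hi => by omega) w
      refine this.trans ?_
      have : (V ∩ g^[0] ⁻¹' {w}).ncard ≤ ({w} : Set CSphere).ncard := ncard_le_ncard (fun x hx => hx.2)
      rcases Nat.eq_zero_or_pos d with h0 | h0
      · have h1 := (hd (g w)).2
        rw [h0, Nat.le_zero, ncard_eq_zero (hd (g w)).1] at h1
        exact absurd (show w ∈ g ⁻¹' {g w} from rfl) (by rw [h1]; simp)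
      · nlinarith
    | succ n =>
      have e : ∀ i, g^[i] '' (g '' V) = g^[i + 1] '' V := fun i => by rw [image_image]; rfl
      have hb := raw n (g '' V) (hV.image _ h.hg.cont.continuousOn) (by rw [e]; exact hVD) (fun i hin => by
        rw [e]; exact hi (i + 1) (by omega) (by omega))
      refine (ncard_fib (φ := g) (T := g '' V ∩ g^[n] ⁻¹' {w}) (((h.hg.iter (n+1)).finfib w).subset inter_subset_right)
        (((h.hg.iter n).finfib w).subset inter_subset_right) (fun x hx => ⟨⟨x, hx.1, rfl⟩, hx.2⟩) (hb w) (a := d) fun v => ?_).trans (by omega)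
      exact (ncard_le_ncard inter_subset_right (hd v).1).trans (hd v).2
end CSphere
end

noncomputable section
open Set Metric Topology Filter
namespace CSphere

def Good (g : CSphere → CSphere) (c : Cht) (ε : ℝ) (x : ℂ) (s : ℝ) (n : ℕ) : Prop :=
  ∀ V, IsPreconnected V → g^[n] '' V ⊆ c.D x s → Small ε V

structure DE (g : CSphere → CSphere) (c : Cht) (R ε0 : ℝ) (N : ℕ) (F : Set CSphere) (ε : ℝ) : Prop extends DC g c R ε0 N F where
  e0 : 0 < ε
  ee : ε ≤ ε0
  eF : ∀ x ∈ F, ∀ p ∈ Ju g, ε < dist x p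

lemma iter_img {g : CSphere → CSphere} {n i : ℕ} (h : i ≤ n) (V : Set CSphere) : g^[n - i] '' (g^[i] '' V) = g^[n] '' V := by
  rw [← image_comp, ← Function.iterate_add, Nat.sub_add_cancel h]

lemma Small.mono {ε ε' : ℝ} {V W : Set CSphere} (h : Small ε W) (hV : V ⊆ W) (he : ε ≤ ε') : Small ε' V :=
  fun x hx y hy => (h x (hV hx) y (hV hy)).trans he

/-- degree bound from goodness -/
lemma DE.deg' {g : CSphere → CSphere} {c : Cht} {R ε0 ε : ℝ} {N : ℕ} {F : Set CSphere} (hd : DE g c R ε0 N F ε) (hg : Hol g) {x : ℂ} {s : ℝ} {m : ℕ}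
    (hG : ∀ n ≤ m, Good g c ε x s n) (hD : c.D x s ⊆ c.D 0 R) {V : Set CSphere} (hV : IsPreconnected V) (hVD : g^[m] '' V ⊆ c.D x s)
    {j : CSphere} (hj : j ∈ V) (hjJ : j ∈ Ju g) (w : CSphere) : (V ∩ g^[m] ⁻¹' {w}).ncard ≤ N := by
  refine hd.deg m V hV (hVD.trans hD) (fun i _ hi => ?_) w
  have hS : Small ε (g^[i] '' V) := hG (m - i) (Nat.sub_le _ _) _ (hV.image _ (hg.iter i).cont.continuousOn) (by rw [iter_img hi.le]; exact hVD)
  refine ⟨hS.mono subset_rfl hd.ee, disjoint_left.2 fun p hp hpF => ?_⟩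
  have := hS p hp _ ⟨j, hj, rfl⟩
  have h2 := hd.eF p hpF (g^[i] j) ((Ju_iff hg i).2 hjJ)
  linarith

lemma PC.tiny {g : CSphere → CSphere} {z : CSphere} {c : Cht} {lam : ℂ} (h : PC g z c lam) {R ε0 ε : ℝ} {N : ℕ} {F : Set CSphere}
    (hd : DE g c R ε0 N F ε) {η : ℝ} (hη : 0 < η) : ∃ r > 0, ∀ m x s, c.κ x ∈ Ju g → ‖x‖ < r → 0 < s → s < r →
      (∀ n ≤ m, Good g c ε x s n) → Good g c η x (s / 2) m := by
  by_contra! hcon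
  have hr : ∀ k : ℕ, 0 < R / 2 * (1 / ((k : ℝ) + 1)) := fun k => by have := hd.Rp; positivity
  choose m x s hxJ hx hs0 hs hG hbad using fun k : ℕ => hcon _ (hr k)
  have ht : Tendsto (fun k : ℕ => R / 2 * (1 / ((k : ℝ) + 1))) atTop (𝓝 0) := by
    simpa using tendsto_one_div_add_atTop_nhds_zero_nat.const_mul (R / 2)
  have hle : ∀ k : ℕ, R / 2 * (1 / ((k : ℝ) + 1)) ≤ R / 2 := fun k => by
    refine mul_le_of_le_one_right (by have := hd.Rp; positivity) ?_
    rw [div_le_one (by positivity)]; have : (0 : ℝ) ≤ k := by positivity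
    linarith
  have hx0 : Tendsto x atTop (𝓝 0) := squeeze_zero_norm (fun k => (hx k).le) ht
  have hs00 : Tendsto s atTop (𝓝 0) := squeeze_zero (fun k => (hs0 k).le) (fun k => (hs k).le) ht
  unfold Good at hbad
  push Not at hbad
  choose V0 hV0 hV0D hV0S using hbad
  have hen := fun k => enlarge (h.hg.iter (m k)) (c.D_open (x k) (s k / 2)) (c.D_conn _ _) (hV0 k) (hV0D k) (not_small_ne (hV0S k))
    (p := c.κ (x k)) (c.κ_mem_D.2 (by simpa using half_pos (hs0 k)))
  choose V hVV hV hVD e he hex using hen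
  have hVS : ∀ k, ¬ Small η (V k) := fun k => not_small_mono (hVV k) (hV0S k)
  have heJ : ∀ k, e k ∈ Ju g := fun k => (Ju_iff h.hg (m k)).1 (by rw [hex]; exact hxJ k)
  have h2s : ∀ k, 2 * (s k / 2) = s k := fun k => by ring
  have hDD : ∀ k, c.D (x k) (s k) ⊆ c.D 0 R := fun k => c.D_mono (ball_subset_ball' (by
    rw [dist_zero_right]; linarith [hx k, hs k, hle k]))
  have hpl : ∀ k, Pl (g^[m k]) c (x k) (s k / 2) N (V k) (connectedComponentIn (g^[m k] ⁻¹' c.D (x k) (2 * (s k / 2))) (e k)) := fun k => by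
    refine mkPl (h.hg.iter _) (half_pos (hs0 k)) (hV k) (hVD k) (he k) ?_
    rw [h2s]
    have hsub : connectedComponentIn (g^[m k] ⁻¹' c.D (x k) (s k)) (e k) ⊆ g^[m k] ⁻¹' c.D (x k) (s k) := connectedComponentIn_subset _ _
    exact hd.deg' h.hg (hG k) (hDD k) isPreconnected_connectedComponentIn (image_subset_iff.2 hsub)
      (mem_connectedComponentIn (by rw [mem_preimage, hex]; exact c.κ_mem_D.2 (by simpa using hs0 k))) (heJ k)
  obtain ⟨e0, φ, hφ, he0⟩ := CompactSpace.tendsto_subseq e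
  have he0J : e0 ∈ Ju g := Ju_closed.mem_of_tendsto he0 (Eventually.of_forall fun k => heJ _)
  have hmt : Tendsto m atTop atTop := by
    refine fixN_ev h.hg z hη hV hVS fun O hO => ?_
    obtain ⟨r, hr, hrO⟩ := c.D_basis (u := 0) (O := O) (by rw [h.cz]; exact hO)
    filter_upwards [ht.eventually (gt_mem_nhds (half_pos hr))] with k hk
    refine (hVD k).trans ((c.D_mono (ball_subset_ball' ?_)).trans hrO)
    rw [dist_zero_right]; linarith [hx k, hs k, hs0 k]
  obtain ⟨O, hO, hOJ, hfr⟩ := Tprime h.hg c N (fun k => hpl (φ k)) (fun k => he (φ k)) he0 (h.perfect he0J) hη (fun k => hVS (φ k))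
  have hhalf : Tendsto (fun k => s (φ k) / 2) atTop (𝓝 0) := by simpa using (hs00.comp hφ.tendsto_atTop).div_const 2
  exact h.C4 hO hOJ (hmt.comp hφ.tendsto_atTop) (hx0.comp hφ.tendsto_atTop) hhalf hfr

end CSphere
end

noncomputable section
open Set Metric Topology Filter
namespace CSphere

lemma harnack_chain : ∃ n : ℕ, n ≠ 0 ∧ ∀ (w w' : ℂ) (d : ℝ) (f : ℂ → ℂ), 0 < d → dist w w' = d → DifferentiableOn ℂ f (ball w d) →
    (∀ x ∈ ball w d, f x ≠ 0) → (∀ x ∈ ball w d, ‖f x‖ < 1) → ‖f w‖ ^ n ≤ ‖f (w' + (1 / 64 : ℂ) * (w - w'))‖ := by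
  refine ⟨3 ^ 126, by positivity, fun w w' d f hd hw hf h0 h1 => ?_⟩
  let p : ℕ → ℂ := fun i => w' + ((2 + i : ℝ) / 128 : ℝ) * (w - w')
  have hww : ‖w - w'‖ = d := by rw [← hw, dist_eq_norm]
  have key : ∀ i : ℕ, i ≤ 126 → ‖f (p i)‖ ^ (3 ^ i) ≤ ‖f (p 0)‖ := by
    intro i
    induction i with
    | zero => intro _; simp
    | succ i ih =>
      intro hi
      have hi' : (i : ℝ) + 1 ≤ 126 := by exact_mod_cast hi
      have hsub : ball (p i) (d / 64) ⊆ ball w d := by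
        refine ball_subset_ball' ?_
        have : p i - w = ((i - 126 : ℝ) / 128 : ℝ) * (w - w') := by simp only [p]; push_cast; ring
        rw [dist_eq_norm, this, norm_mul, hww, Complex.norm_real, Real.norm_eq_abs, abs_of_nonpos (by linarith)]
        nlinarith
      have hst := harnack (p := p i) (q := p (i + 1)) (r := d / 64) (by positivity) (hf.mono hsub) (fun x hx => h0 x (hsub hx))
        (fun x hx => h1 x (hsub hx)) (by
          have : p (i + 1) - p i = (1 / 128 : ℝ) * (w - w') := by simp only [p]; push_cast; ring
          rw [dist_eq_norm, this, norm_mul, hww, Complex.norm_real, Real.norm_eq_abs, abs_of_nonneg (by norm_num)]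
          linarith)
      calc ‖f (p (i + 1))‖ ^ (3 ^ (i + 1)) = (‖f (p (i + 1))‖ ^ 3) ^ (3 ^ i) := by rw [← pow_mul, pow_succ' 3 i]
        _ ≤ ‖f (p i)‖ ^ (3 ^ i) := pow_le_pow_left₀ (by positivity) hst _
        _ ≤ _ := ih (by omega)
  have e1 : p 126 = w := by simp only [p]; push_cast; ring
  have e2 : p 0 = w' + (1 / 64 : ℂ) * (w - w') := by simp only [p]; push_cast; ring
  have := key 126 le_rfl
  rwa [e1, e2] at this

lemma core_inst : ∃ n : ℕ, n ≠ 0 ∧ ∀ (g : CSphere → CSphere) (c c' : Cht) (q : ℕ) (y : CSphere) (w w' : ℂ) (M : ℝ), Hol g → 0 ≤ M →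
    g^[q] y = c.κ w → 0 < dist w w' → c.κ w' ∈ Ju g → (∀ u ∈ ball w (dist w w'), c.κ u ∉ Ju g) →
    (∀ x ∈ connectedComponentIn (g^[q] ⁻¹' c.D w (dist w w')) y, (∃ O ∈ 𝓝 x, InjOn g^[q] O) ∧ x ≠ c'.pole ∧ ‖c'.τ x‖ ≤ M) →
    ∃ a j, a ≠ c'.pole ∧ a ∈ connectedComponentIn (g^[q] ⁻¹' c.D w (dist w w')) y ∧ ‖c'.τ a‖ ≤ M ∧ j ∈ Ju g ∧ (∀ η, Good g c η w' (dist w w' / 16 / 2) q → dist a j ≤ η) ∧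
      (j ≠ c'.pole → ‖c'.τ j‖ < M + 1 → (‖c'.τ y - c'.τ j‖ / (2 * M + 2)) ^ n ≤ ‖c'.τ a - c'.τ j‖ / (2 * M + 2)) := by
  obtain ⟨n, hn, hH⟩ := harnack_chain
  refine ⟨n, hn, fun g c c' q y w w' M hg hM hy hd hw' hJ hP => ?_⟩
  set d := dist w w' with hdd
  obtain ⟨χ, hχ, hχw, hχP⟩ := section_ex (hg.iter q) c hd hy fun x hx => (hP x hx).1
  set w2 := w' + (1 / 64 : ℂ) * (w - w') with hw2
  have hnn : ‖w - w'‖ = d := by rw [hdd, dist_eq_norm]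
  have h1 : dist w2 w' < d / 16 / 2 := by
    rw [hw2, dist_eq_norm, add_sub_cancel_left, norm_mul, hnn]; norm_num; linarith
  have h2 : w2 ∈ ball w d := by
    have : w2 - w = -(63 / 64 : ℂ) * (w - w') := by rw [hw2]; ring
    rw [mem_ball, dist_eq_norm, this, norm_mul, hnn]; norm_num; linarith
  have ha := hχP w2 h2
  have haD : g^[q] (χ w2) ∈ c.D w' (d / 16 / 2) := by rw [ha.2]; exact c.κ_mem_D.2 (by rwa [← dist_eq_norm])
  obtain ⟨j, hj, hjw⟩ := comp_onto (hg.iter q) (c.D_open w' (d / 16 / 2)) (c.D_conn _ _) (y := χ w2) haD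
    (w := c.κ w') (c.κ_mem_D.2 (by simpa using hd))
  have hjJ : j ∈ Ju g := (Ju_iff hg q).1 (by rw [hjw]; exact hw')
  refine ⟨χ w2, j, (hP _ ha.1).2.1, ha.1, (hP _ ha.1).2.2, hjJ, fun η hη => ?_, fun hjp hjM => ?_⟩
  · have hsub : connectedComponentIn (g^[q] ⁻¹' c.D w' (d / 16 / 2)) (χ w2) ⊆ g^[q] ⁻¹' c.D w' (d / 16 / 2) := connectedComponentIn_subset _ _
    exact hη _ isPreconnected_connectedComponentIn (image_subset_iff.2 hsub) _ (mem_connectedComponentIn haD) _ hj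
  · have hpos : 0 < 2 * M + 2 := by linarith
    have := hH w w' d (fun u => (c'.τ (χ u) - c'.τ j) / ((2 * M + 2 : ℝ) : ℂ)) hd rfl ?_ ?_ ?_
    · simp only [norm_div, Complex.norm_real, Real.norm_eq_abs, abs_of_pos hpos, hχw] at this
      exact this
    · intro u hu
      have h3 := sec_an (hg.iter q) c c' hχ (fun u hu => (hχP u hu).2) hu (hP _ (hχP u hu).1).2.1
      exact ((h3.differentiableAt.sub_const _).div_const _).differentiableWithinAt
    · intro u hu h0
      rw [div_eq_zero_iff, sub_eq_zero] at h0
      rcases h0 with h0 | h0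
      · have : χ u = j := by rw [← c'.κτ (hP _ (hχP u hu).1).2.1, h0, c'.κτ hjp]
        refine hJ u hu ?_
        rw [← (hχP u hu).2, this]; exact (Ju_iff hg q).2 hjJ
      · exact hpos.ne' (by exact_mod_cast h0)
    · intro u hu
      simp only [norm_div, Complex.norm_real, Real.norm_eq_abs, abs_of_pos hpos]
      rw [div_lt_one hpos]
      have := norm_sub_le (c'.τ (χ u)) (c'.τ j)
      have := (hP _ (hχP u hu).1).2.2
      linarith

lemma locinj_iter {g : CSphere → CSphere} (hg : Hol g) {x : CSphere} {n : ℕ} (h : ∀ i < n, g^[i] x ∉ Crit g) :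
    ∃ O ∈ 𝓝 x, InjOn g^[n] O := by
  induction n with
  | zero => exact ⟨univ, univ_mem, fun a _ b _ e => e⟩
  | succ n ih =>
    obtain ⟨O, hO, hi⟩ := ih fun i hi => h i (by omega)
    have h1 := h n (by omega)
    simp only [Crit, mem_ofPred_eq, not_not] at h1
    obtain ⟨O', hO', hi'⟩ := h1
    refine ⟨O ∩ g^[n] ⁻¹' O', inter_mem hO ((hg.iter n).cont.continuousAt hO'), fun a ha b hb e => ?_⟩
    rw [Function.iterate_succ_apply', Function.iterate_succ_apply'] at e
    exact hi ha.1 hb.1 (hi' ha.2 hb.2 e)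

/-- eventually no critical points in the orbit of the component -/
lemma PC.no_crit {g : CSphere → CSphere} {z : CSphere} {c : Cht} {lam : ℂ} (h : PC g z c lam) {y : CSphere} (hy : y ∈ Fa g)
    (ht : Tendsto (fun n => g^[n] y) atTop (𝓝 z)) : ∃ T : ℕ, ∀ i ≥ T, ∀ Q, IsPreconnected Q → Q ⊆ Fa g → g^[i] y ∈ Q → Disjoint Q (Crit g) := by
  have h1 : ∀ ξ : CSphere, ∃ T : ℕ, ∀ i ≥ T, ∀ Q, IsPreconnected Q → Q ⊆ Fa g → g^[i] y ∈ Q → ξ ∉ Q := by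
    intro ξ
    by_contra! hc
    obtain ⟨i, -, Q, hQ, hQF, hi, hξ⟩ := hc 0
    obtain ⟨i', hi', Q', hQ', hQF', hii', hξ'⟩ := hc (i + 1)
    have := h.wander hy ht (hQ.union ξ hξ hξ' hQ') (union_subset hQF hQF') (Or.inl hi) (Or.inr hii')
    omega
  choose T hT using h1
  refine ⟨(crit_fin h.hg).toFinset.sup T, fun i hi Q hQ hQF hiQ => disjoint_right.2 fun ξ hξ => hT ξ i (le_trans ?_ hi) Q hQ hQF hiQ⟩
  exact Finset.le_sup (f := T) (by simpa using hξ)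

end CSphere
end

noncomputable section
open Set Metric Topology Filter
namespace CSphere

lemma PC.Lp {g : CSphere → CSphere} {z : CSphere} {c : Cht} {lam : ℂ} (h : PC g z c lam) {R ε0 ε : ℝ} {N : ℕ} {F : Set CSphere}
    (hd : DE g c R ε0 N F ε) {y : CSphere} (hy : y ∈ Fa g) : ∃ O ∈ 𝓝 y, ∃ η > 0, ∀ y' ∈ O, ∀ q w w', g^[q] y' = c.κ w → ‖w‖ < η →
      c.κ w' ∈ Ju g → dist w w' = infDist w (c.κ ⁻¹' Ju g) → ∃ q' < q, ¬ Good g c ε w' (dist w w' / 16) q' := by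
  by_contra! hcon
  have hr : ∀ k : ℕ, (0 : ℝ) < 1 / ((k : ℝ) + 1) := fun k => by positivity
  choose yk hyk q w w' hq hw hw'J hw'd hG using fun k : ℕ => hcon (ball y (1 / ((k : ℝ) + 1))) (ball_mem_nhds _ (hr k)) _ (hr k)
  have ht0 := tendsto_one_div_add_atTop_nhds_zero_nat (𝕜 := ℝ)
  have hyt : Tendsto yk atTop (𝓝 y) := by
    rw [tendsto_iff_dist_tendsto_zero]
    exact squeeze_zero (fun _ => dist_nonneg) (fun k => (mem_ball.1 (hyk k)).le) ht0
  have hwt : Tendsto w atTop (𝓝 0) := squeeze_zero_norm (fun k => (hw k).le) ht0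
  have hκt : Tendsto (fun k => g^[q k] (yk k)) atTop (𝓝 z) := by
    simp_rw [hq, ← h.cz]; exact c.κ_cont.continuousAt.tendsto.comp hwt
  have hJ0 : (0 : ℂ) ∈ c.κ ⁻¹' Ju g := by rw [mem_preimage, h.cz]; exact h.zJ
  have hdw : ∀ k, dist (w k) (w' k) ≤ ‖w k‖ := fun k => by
    rw [hw'd, ← dist_zero_right]; exact infDist_le_dist_of_mem hJ0
  -- q → ∞
  have hqt : Tendsto q atTop atTop := by
    rw [Filter.tendsto_atTop]
    intro m
    have h1 : ∀ i ∈ Finset.range m, ∀ᶠ k in atTop, q k ≠ i := by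
      intro i _
      by_contra hc
      have hc' : ∃ᶠ k in atTop, q k = i := by simpa [Filter.Frequently] using hc
      have h2 : Tendsto (fun k => g^[i] (yk k)) atTop (𝓝 (g^[i] y)) := (h.hg.iter i).cont.continuousAt.tendsto.comp hyt
      obtain ⟨U1, U2, hU1, hU2, hz1, hz2, hdis⟩ := t2_separation (h.Fa_ne hy i)
      obtain ⟨k, hk1, hk2, hk3⟩ := (hc'.and_eventually ((h2.eventually (hU1.mem_nhds hz1)).and (hκt.eventually (hU2.mem_nhds hz2)))).exists
      rw [hk1] at hk3
      exact disjoint_left.1 hdis hk2 hk3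
    filter_upwards [(Filter.eventually_all_finset _).2 h1] with k hk
    by_contra hlt
    exact hk (q k) (Finset.mem_range.2 (by omega)) rfl
  -- the orbit of y tends to z
  have hyz : Tendsto (fun n => g^[n] y) atTop (𝓝 z) := by
    refine h.C5 hy fun O hO => ?_
    obtain ⟨δ, hδ, hδO⟩ := Metric.mem_nhds_iff.1 hO
    have heq : EquicontinuousAt (fun n : ℕ => g^[n]) y := interior_subset hy
    have h1 := Metric.equicontinuousAt_iff_right.1 heq (δ / 2) (half_pos hδ)
    have h2 : ∀ᶠ k in atTop, g^[q k] y ∈ O := by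
      filter_upwards [hyt.eventually h1, hκt.eventually (ball_mem_nhds z (half_pos hδ))] with k hk1 hk2
      refine hδO ?_
      rw [mem_ball] at *
      have := hk1 (q k)
      have := dist_triangle (g^[q k] y) (g^[q k] (yk k)) z
      linarith
    exact hqt.frequently h2.frequently
  obtain ⟨T0, hT0⟩ := h.no_crit hy hyz
  set T := T0 + 1 with hT
  -- connected neighbourhood of y in Fa
  obtain ⟨B, ⟨hBo, hyB, hBc⟩, hBF⟩ := (LocallyConnectedSpace.open_connected_basis y).mem_iff.1 (Fa_open.mem_nhds hy)
  simp only [id] at hBF hBo hyB hBc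
  have hBi : ∀ i, IsPreconnected (g^[i] '' B) := fun i => hBc.isPreconnected.image _ (h.hg.iter i).cont.continuousOn
  have hBiF : ∀ i, g^[i] '' B ⊆ Fa g := fun i => by rintro _ ⟨x, hx, rfl⟩; exact (Fa_iff h.hg i).2 (hBF hx)
  obtain ⟨c', hc'⟩ := exists_chart_pole (g^[T + 1] y)
  have hKc : IsCompact (g^[T + 1] '' B)ᶜ := ((h.hg.iter (T + 1)).isOpenMap _ hBo).isClosed_compl.isCompact
  have hKp : ∀ x ∈ (g^[T + 1] '' B)ᶜ, x ≠ c'.pole := by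
    rintro x hx rfl; exact hx ⟨y, hyB, hc'.symm⟩
  obtain ⟨M, hM⟩ := hKc.exists_bound_of_continuousOn (f := c'.τ) fun x hx => (c'.τ_cont (hKp x hx)).continuousWithinAt
  have hM' : ∀ x ∈ (g^[T + 1] '' B)ᶜ, ‖c'.τ x‖ ≤ |M| := fun x hx => (hM x hx).trans (le_abs_self _)
  obtain ⟨n, hn, hcore⟩ := core_inst
  have hev : ∀ᶠ k in atTop, yk k ∈ B ∧ T ≤ q k := (hyt.eventually (hBo.mem_nhds hyB)).and (hqt.eventually_ge_atTop T)
  obtain ⟨k0, hk0⟩ := eventually_atTop.1 hev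
  have hit : ∀ k ≥ k0, g^[q k - T] (g^[T] (yk k)) = c.κ (w k) := fun k hk => by
    rw [← Function.iterate_add_apply, Nat.sub_add_cancel (hk0 k hk).2, hq]
  have hJball : ∀ k, ∀ u ∈ ball (w k) (dist (w k) (w' k)), c.κ u ∉ Ju g := fun k u hu hJ => by
    have := infDist_le_dist_of_mem (x := w k) (s := c.κ ⁻¹' Ju g) hJ
    rw [mem_ball, dist_comm, hw'd] at hu; linarith
  have hwF : ∀ k ≥ k0, c.κ (w k) ∈ Fa g := fun k hk => by
    rw [← hq]; exact (Fa_iff h.hg _).2 (hBF (hk0 k hk).1)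
  have hdpos : ∀ k ≥ k0, 0 < dist (w k) (w' k) := fun k hk => dist_pos.2 fun e => hw'J k (e ▸ hwF k hk)
  have hmain : ∀ k ≥ k0, ∃ a j, a ≠ c'.pole ∧ a ∈ (g^[T + 1] '' B)ᶜ ∧ ‖c'.τ a‖ ≤ |M| ∧ j ∈ Ju g ∧
      (∀ η, Good g c η (w' k) (dist (w k) (w' k) / 16 / 2) (q k - T) → dist a j ≤ η) ∧
      (j ≠ c'.pole → ‖c'.τ j‖ < |M| + 1 → (‖c'.τ (g^[T] (yk k)) - c'.τ j‖ / (2 * |M| + 2)) ^ n ≤ ‖c'.τ a - c'.τ j‖ / (2 * |M| + 2)) := by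
    intro k hk
    set P := connectedComponentIn (g^[q k - T] ⁻¹' c.D (w k) (dist (w k) (w' k))) (g^[T] (yk k)) with hP
    have hPD : P ⊆ g^[q k - T] ⁻¹' c.D (w k) (dist (w k) (w' k)) := connectedComponentIn_subset _ _
    have hPF : P ⊆ Fa g := by
      intro x hx
      obtain ⟨u, hu, hux⟩ := hPD hx
      by_contra hxJ
      exact hJball k u hu (by rw [hux]; exact (Ju_iff h.hg _).2 hxJ)
    have hyP : g^[T] (yk k) ∈ P := mem_connectedComponentIn (by rw [mem_preimage, hit k hk]; exact c.κ_mem_D.2 (by simpa using hdpos k hk))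
    have hRc : IsPreconnected (P ∪ g^[T] '' B) := isPreconnected_connectedComponentIn.union _ hyP ⟨_, (hk0 k hk).1, rfl⟩ (hBi T)
    have hRF : P ∪ g^[T] '' B ⊆ Fa g := union_subset hPF (hBiF T)
    have hPc : P ⊆ (g^[T + 1] '' B)ᶜ := by
      intro x hx hxB
      have := h.wander hy hyz (hRc.union x (Or.inl hx) hxB (hBi (T + 1))) (union_subset hRF (hBiF _)) (m := T) (n := T + 1)
        (Or.inl (Or.inr ⟨y, hyB, rfl⟩)) (Or.inr ⟨y, hyB, rfl⟩)
      omega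
    obtain ⟨a, j, h1, h2, h3⟩ := hcore g c c' (q k - T) (g^[T] (yk k)) (w k) (w' k) |M| h.hg (abs_nonneg _) (hit k hk) (hdpos k hk) (hw'J k)
      (hJball k) (by
        intro x hx
        refine ⟨locinj_iter h.hg fun i _ hcr => ?_, hKp x (hPc hx), hM' x (hPc hx)⟩
        have := hT0 (i + T) (by omega) (g^[i] '' (P ∪ g^[T] '' B)) (hRc.image _ (h.hg.iter i).cont.continuousOn)
          (by rintro _ ⟨x, hx, rfl⟩; exact (Fa_iff h.hg i).2 (hRF hx)) ⟨g^[T] y, Or.inr ⟨y, hyB, rfl⟩, (Function.iterate_add_apply _ _ _ _).symm⟩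
        exact disjoint_left.1 this ⟨x, Or.inl hx, rfl⟩ hcr)
    exact ⟨a, j, h1, hPc h2, h3⟩
  choose a j hap haK haM hjJ hsm hfin using fun k => hmain (k + k0) (by omega)
  have hdaj : Tendsto (fun k => dist (a k) (j k)) atTop (𝓝 0) := by
    rw [Metric.tendsto_atTop']
    intro η hη
    obtain ⟨r, hr0, hr⟩ := h.tiny hd (half_pos hη)
    have h1 : ∀ᶠ k in atTop, ‖w (k + k0)‖ < r / 2 := by
      have := (tendsto_add_atTop_iff_nat k0).2 hwt.norm
      rw [norm_zero] at this
      exact this.eventually (gt_mem_nhds (half_pos hr0))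
    obtain ⟨k1, hk1⟩ := eventually_atTop.1 h1
    refine ⟨k1, fun k hk => ?_⟩
    rw [Real.dist_eq, sub_zero, abs_of_nonneg dist_nonneg]
    refine lt_of_le_of_lt (hsm k _ (hr _ _ _ (hw'J _) ?_ ?_ ?_ fun i hi => hG (k + k0) i ?_)) (half_lt_self hη)
    · have h2 := hk1 k hk.le
      have h3 := hdw (k + k0)
      have h4 : ‖w' (k + k0)‖ ≤ ‖w (k + k0)‖ + dist (w (k + k0)) (w' (k + k0)) := by
        rw [dist_comm, dist_eq_norm]; have := norm_sub_norm_le (w' (k + k0)) (w (k + k0)); linarith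
      linarith
    · have := hdpos (k + k0) (by omega); positivity
    · have := hdpos (k + k0) (by omega); linarith [hk1 k hk.le, hdw (k + k0)]
    · have := (hk0 (k + k0) (by omega)).2; omega
  obtain ⟨a0, φ, hφ, ha0⟩ := CompactSpace.tendsto_subseq a
  have ha0K : a0 ∈ (g^[T + 1] '' B)ᶜ := hKc.isClosed.mem_of_tendsto ha0 (Eventually.of_forall fun k => haK _)
  have ha0p := hKp a0 ha0K
  have hj0 : Tendsto (j ∘ φ) atTop (𝓝 a0) := (tendsto_iff_of_dist (hdaj.comp hφ.tendsto_atTop)).1 ha0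
  have ha0J : a0 ∈ Ju g := Ju_closed.mem_of_tendsto hj0 (Eventually.of_forall fun k => hjJ _)
  have hτa : Tendsto (fun k => c'.τ (a (φ k))) atTop (𝓝 (c'.τ a0)) := (c'.τ_cont ha0p).tendsto.comp ha0
  have hτj : Tendsto (fun k => c'.τ (j (φ k))) atTop (𝓝 (c'.τ a0)) := (c'.τ_cont ha0p).tendsto.comp hj0
  have hyT : g^[T] y ∈ (g^[T + 1] '' B)ᶜ := fun hB' => by
    have := h.wander hy hyz (hBi (T + 1)) (hBiF _) (m := T) (n := T + 1) hB' ⟨y, hyB, rfl⟩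
    omega
  have hyTp := hKp _ hyT
  have hτy : Tendsto (fun k => c'.τ (g^[T] (yk (φ k + k0)))) atTop (𝓝 (c'.τ (g^[T] y))) :=
    (c'.τ_cont hyTp).tendsto.comp ((h.hg.iter T).cont.continuousAt.tendsto.comp (hyt.comp ((tendsto_add_atTop_nat k0).comp hφ.tendsto_atTop)))
  have hlim : (‖c'.τ (g^[T] y) - c'.τ a0‖ / (2 * |M| + 2)) ^ n ≤ ‖c'.τ a0 - c'.τ a0‖ / (2 * |M| + 2) := by
    refine le_of_tendsto_of_tendsto ((((hτy.sub hτj).norm).div_const _).pow n) (((hτa.sub hτj).norm).div_const _) ?_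
    have hb : ‖c'.τ a0‖ ≤ |M| := hM' a0 ha0K
    filter_upwards [hj0.eventually_ne ha0p, hτj.norm.eventually (gt_mem_nhds (show ‖c'.τ a0‖ < |M| + 1 by linarith))] with k hk1 hk2
    exact hfin (φ k) hk1 hk2
  rw [sub_self, norm_zero, zero_div] at hlim
  have h0 : ‖c'.τ (g^[T] y) - c'.τ a0‖ / (2 * |M| + 2) = 0 := pow_eq_zero_iff hn |>.1 (le_antisymm hlim (by positivity))
  have hpos : 2 * |M| + 2 ≠ 0 := by positivity
  rw [div_eq_zero_iff, or_iff_left hpos, norm_eq_zero, sub_eq_zero] at h0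
  have : g^[T] y = a0 := by rw [← c'.κτ hyTp, h0, c'.κτ ha0p]
  exact ha0J (this ▸ (Fa_iff h.hg T).2 hy)

end CSphere
end

noncomputable section
open Set Metric Topology Filter
namespace CSphere

lemma chain_small {ι : Type} {I : Finset ι} {S : ι → Set CSphere} {Y : Set CSphere} {ε : ℝ} (hε : 0 ≤ ε) (hY : IsPreconnected Y)
    (hc : ∀ y ∈ Y, ∃ i ∈ I, y ∈ S i) (hS : ∀ i ∈ I, Small ε (S i)) : Small (2 * (I.card * ε)) Y := by
  classical
  intro x0 hx0 y1 hy1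
  have hpre : IsPreconnected ((fun y => dist x0 y) '' Y) := hY.image _ (continuous_const.dist continuous_id).continuousOn
  have hsub : Icc 0 (dist x0 y1) ⊆ (fun y => dist x0 y) '' Y :=
    hpre.Icc_subset ⟨x0, hx0, dist_self _⟩ ⟨y1, hy1, rfl⟩
  let a : ι → CSphere := fun i => if h : (S i).Nonempty then h.choose else x0
  have ha : ∀ i, ∀ y ∈ S i, a i ∈ S i := fun i y hy => by
    have hne : (S i).Nonempty := ⟨y, hy⟩
    simp only [a, dif_pos hne]; exact hne.choose_spec
  have hsub2 : Icc 0 (dist x0 y1) ⊆ ⋃ i ∈ I, Icc (dist x0 (a i) - ε) (dist x0 (a i) + ε) := by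
    intro r hr
    obtain ⟨y, hy, rfl⟩ := hsub hr
    obtain ⟨i, hi, hyi⟩ := hc y hy
    refine mem_iUnion₂.2 ⟨i, hi, ?_⟩
    have h1 := hS i hi y hyi _ (ha i y hyi)
    have h2 := dist_triangle x0 y (a i)
    have h3 := dist_triangle x0 (a i) y
    rw [dist_comm (a i) y] at h3
    constructor <;> simp only <;> linarith
  have hm := (MeasureTheory.measure_mono hsub2).trans (MeasureTheory.measure_biUnion_finset_le (μ := MeasureTheory.volume) I _)
  simp only [Real.volume_Icc] at hm
  rw [← ENNReal.ofReal_sum_of_nonneg (fun i _ => by linarith)] at hm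
  rw [ENNReal.ofReal_le_ofReal_iff (Finset.sum_nonneg fun i _ => by linarith)] at hm
  have : ∀ i, dist x0 (a i) + ε - (dist x0 (a i) - ε) = 2 * ε := fun i => by ring
  simp only [this, Finset.sum_const, nsmul_eq_mul] at hm
  linarith

lemma DE.claim2 {g : CSphere → CSphere} {c : Cht} {R ε0 ε : ℝ} {N : ℕ} {F : Set CSphere} (hd : DE g c R ε0 N F ε) (hg : Hol g)
    {t : Finset ℂ} (ht : ball (0 : ℂ) 2 ⊆ ⋃ i ∈ t, ball i (1 / 4)) (ht2 : ∀ i ∈ t, i ∈ ball (0 : ℂ) 2) (hε : 2 * ((t.card * N : ℕ) * ε) ≤ ε0)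
    {x : ℂ} {s : ℝ} {n : ℕ} (hs : 0 < s) (hD : c.D x (2 * s) ⊆ c.D 0 R) (hG : ∀ m < n, ∀ x' ∈ ball x (2 * s), Good g c ε x' (s / 4) m)
    (hF : ∀ q ≤ n, ∀ y ∈ F, g^[q] y ∉ c.D x (2 * s)) : ∀ m < n, ∀ Y, IsPreconnected Y → g^[m] '' Y ⊆ c.D x (2 * s) → Small ε0 Y := by
  classical
  intro m
  induction m using Nat.strong_induction_on with
  | _ m ih =>
  intro hm Y hY hYD
  rcases Y.eq_empty_or_nonempty with rfl | ⟨y0, hy0⟩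
  · exact fun x hx => hx.elim
  set Y' := connectedComponentIn (g^[m] ⁻¹' c.D x (2 * s)) y0 with hY'
  have hYY : Y ⊆ Y' := comp_sub hY hYD hy0
  have hsub : Y' ⊆ g^[m] ⁻¹' c.D x (2 * s) := connectedComponentIn_subset _ _
  have hpc : IsPreconnected Y' := isPreconnected_connectedComponentIn
  have hdeg := hd.deg m Y' hpc ((image_subset_iff.2 hsub).trans hD) (fun i hi1 hi => by
    refine ⟨ih (m - i) (by omega) (by omega) _ (hpc.image _ (hg.iter i).cont.continuousOn) (by rw [iter_img hi.le]; exact image_subset_iff.2 hsub), ?_⟩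
    refine disjoint_left.2 ?_
    rintro _ ⟨p, hp, rfl⟩ hpF
    refine hF (m - i) (by omega) _ hpF ?_
    rw [← Function.iterate_add_apply, Nat.sub_add_cancel hi.le]
    exact hsub hp)
  have hfin : ∀ w, (Y' ∩ g^[m] ⁻¹' {w}).Finite := fun w => ((hg.iter m).finfib w).subset inter_subset_right
  let X : ℂ → ℂ := fun i => x + s * i
  have hX : ∀ u i : ℂ, dist u (X i) = s * dist ((u - x) / s) i := fun u i => by
    have hs' : (s : ℂ) ≠ 0 := by exact_mod_cast hs.ne'
    rw [dist_eq_norm, dist_eq_norm, ← Real.norm_of_nonneg hs.le, ← Complex.norm_real, ← norm_mul, Complex.norm_real, Real.norm_of_nonneg hs.le]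
    congr 1; simp only [X]; field_simp; ring
  have hXb : ∀ i ∈ t, X i ∈ ball x (2 * s) := fun i hi => by
    have h1 := ht2 i hi
    rw [mem_ball_zero_iff] at h1
    rw [mem_ball, dist_eq_norm]; simp only [X, add_sub_cancel_left, norm_mul, Complex.norm_real, Real.norm_of_nonneg hs.le]
    nlinarith
  let A : ℂ → Set ℂ := fun i => ball x (2 * s) ∩ ball (X i) (s / 4)
  have hAo : ∀ i, IsOpen (c.κ '' A i) := fun i => c.κ_open (isOpen_ball.inter isOpen_ball)
  have hAc : ∀ i, IsPreconnected (c.κ '' A i) := fun i =>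
    (((convex_ball _ _).inter (convex_ball _ _)).isPreconnected).image _ c.κ_cont.continuousOn
  let I : Finset (Σ _ : ℂ, CSphere) := t.sigma fun i => (hfin (c.κ (X i))).toFinset
  have hI : I.card ≤ t.card * N := by
    rw [Finset.card_sigma]
    refine (Finset.sum_le_card_nsmul _ _ N fun i _ => ?_).trans (le_of_eq (by simp))
    rw [← ncard_eq_toFinset_card _ (hfin _)]; exact hdeg _
  let S : (Σ _ : ℂ, CSphere) → Set CSphere := fun p => connectedComponentIn (g^[m] ⁻¹' (c.κ '' A p.1)) p.2
  have hch := chain_small (I := I) (S := S) (ε := ε) hd.e0.le hpc (fun y hy => by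
    obtain ⟨u, hu, huy⟩ := hsub hy
    have hv : (u - x) / s ∈ ball (0 : ℂ) 2 := by
      rw [mem_ball_zero_iff, norm_div, Complex.norm_real, Real.norm_of_nonneg hs.le, div_lt_iff₀ hs, ← dist_eq_norm]; exact hu
    obtain ⟨i, hi, hvi⟩ := mem_iUnion₂.1 (ht hv)
    have huA : u ∈ A i := ⟨hu, by rw [mem_ball, hX]; rw [mem_ball] at hvi; nlinarith⟩
    obtain ⟨b, hb, hbx⟩ := comp_onto (hg.iter m) (hAo i) (hAc i) (y := y) (huy ▸ mem_image_of_mem _ huA) (w := c.κ (X i))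
      ⟨X i, ⟨hXb i hi, mem_ball_self (by positivity)⟩, rfl⟩
    refine ⟨⟨i, b⟩, ?_, ?_⟩
    · simp only [I, Finset.mem_sigma, hi, true_and, Finite.mem_toFinset]
      refine ⟨?_, hbx⟩
      have h1 : connectedComponentIn (g^[m] ⁻¹' (c.κ '' A i)) y ⊆ connectedComponentIn (g^[m] ⁻¹' c.D x (2 * s)) y :=
        connectedComponentIn_mono _ (preimage_mono (image_mono inter_subset_left))
      rw [hY', connectedComponentIn_eq hy]; exact h1 hb
    · change y ∈ connectedComponentIn (g^[m] ⁻¹' (c.κ '' A i)) b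
      rw [← connectedComponentIn_eq hb]
      exact mem_connectedComponentIn (by rw [mem_preimage, ← huy]; exact mem_image_of_mem _ huA)) (fun p hp => by
    have hp1 : p.1 ∈ t := (Finset.mem_sigma.1 hp).1
    refine hG m hm _ (hXb _ hp1) _ isPreconnected_connectedComponentIn ?_
    have h1 : S p ⊆ g^[m] ⁻¹' (c.κ '' A p.1) := connectedComponentIn_subset _ _
    exact (image_subset_iff.2 h1).trans (image_mono inter_subset_right))
  refine hch.mono hYY (le_trans ?_ hε)
  have : (I.card : ℝ) ≤ (t.card * N : ℕ) := by exact_mod_cast hI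
  have := hd.e0
  gcongr

end CSphere
end

noncomputable section
open Set Metric Topology Filter
namespace CSphere

def LP (g : CSphere → CSphere) (c : Cht) (ε η : ℝ) (y : CSphere) : Prop := ∀ q w w', g^[q] y = c.κ w → ‖w‖ < η →
      c.κ w' ∈ Ju g → dist w w' = infDist w (c.κ ⁻¹' Ju g) → ∃ q' < q, ¬ Good g c ε w' (dist w w' / 16) q'

def Rho (g : CSphere → CSphere) (c : Cht) (x : ℂ) : ℝ := ‖x‖ + 2 * infDist x (c.κ ⁻¹' Ju g)

lemma Rho_lip {g : CSphere → CSphere} {c : Cht} {x y : ℂ} : Rho g c y ≤ Rho g c x + 3 * dist y x := by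
  have h1 := infDist_le_infDist_add_dist (s := c.κ ⁻¹' Ju g) (x := y) (y := x)
  have h2 : ‖y‖ ≤ ‖x‖ + dist y x := by rw [dist_eq_norm]; have := norm_sub_norm_le y x; linarith
  unfold Rho; linarith

/-- if all smaller times are good then the (LP) points do not hit the disc -/
lemma LP.avoid {g : CSphere → CSphere} {z : CSphere} {c : Cht} {lam : ℂ} (h : PC g z c lam) {ε η R x s n y} (hy : LP g c ε η y) (hyF : y ∈ Fa g)
    (hR : R < η) (hs : 0 < s) (hx : Rho g c x + 12 * s ≤ R)
    (hG : ∀ m < n, ∀ x s, 0 < s → Rho g c x + 12 * s ≤ R → Good g c ε x s m) : ∀ q ≤ n, g^[q] y ∉ c.D x (2 * s) := by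
  rintro q hq ⟨w, hw, hwy⟩
  have hcl : IsClosed (c.κ ⁻¹' Ju g) := Ju_closed.preimage c.κ_cont
  have hJ0 : (0 : ℂ) ∈ c.κ ⁻¹' Ju g := by rw [mem_preimage, h.cz]; exact h.zJ
  obtain ⟨w', hw'J, hw'⟩ := hcl.exists_infDist_eq_dist ⟨0, hJ0⟩ w
  have hl := Rho_lip (g := g) (c := c) (x := x) (y := w)
  rw [mem_ball] at hw
  have hRw : Rho g c w ≤ R := by linarith
  have hi0 : 0 ≤ infDist w (c.κ ⁻¹' Ju g) := infDist_nonneg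
  have hnw : ‖w‖ < η := by unfold Rho at hRw; linarith
  obtain ⟨q', hq', hbad⟩ := hy q w w' hwy.symm hnw hw'J hw'.symm
  have hdpos : 0 < dist w w' := dist_pos.2 fun e => by
    have : c.κ w ∈ Ju g := by rw [e]; exact hw'J
    rw [hwy] at this; exact this ((Fa_iff h.hg q).2 hyF)
  refine hbad (hG q' (by omega) w' _ (by positivity) ?_)
  have h1 : Rho g c w' = ‖w'‖ := by unfold Rho; rw [infDist_zero_of_mem hw'J]; ring
  have h2 : ‖w'‖ ≤ ‖w‖ + dist w w' := by rw [dist_comm, dist_eq_norm]; have := norm_sub_norm_le w' w; linarith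
  have h3 : Rho g c w = ‖w‖ + 2 * dist w w' := by unfold Rho; rw [hw']
  linarith

lemma PC.mainM {g : CSphere → CSphere} {z : CSphere} {c : Cht} {lam : ℂ} (h : PC g z c lam) {R ε0 ε : ℝ} {N : ℕ} {F : Set CSphere}
    (hd : DE g c R ε0 N F ε) {t : Finset ℂ} (ht : ball (0 : ℂ) 2 ⊆ ⋃ i ∈ t, ball i (1 / 4)) (ht2 : ∀ i ∈ t, i ∈ ball (0 : ℂ) 2)
    (hε : 2 * ((t.card * N : ℕ) * ε) ≤ ε0) : ∃ r > 0, ∀ n x s, 0 < s → Rho g c x + 12 * s ≤ r → Good g c ε x s n := by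
  classical
  -- uniform LP on F
  have hFη : ∃ η > 0, ∀ y ∈ F, LP g c ε η y := by
    refine hd.Fc.induction_on (p := fun K => ∃ η > 0, ∀ y ∈ K, LP g c ε η y) ⟨1, one_pos, fun _ h => h.elim⟩ ?_ ?_ ?_
    · rintro s t hst ⟨η, hη, H⟩; exact ⟨η, hη, fun y hy => H y (hst hy)⟩
    · rintro s t ⟨η, hη, H⟩ ⟨η', hη', H'⟩
      refine ⟨min η η', lt_min hη hη', ?_⟩
      rintro y (hy | hy) q w w' h1 h2
      · exact H y hy q w w' h1 (h2.trans_le (min_le_left _ _))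
      · exact H' y hy q w w' h1 (h2.trans_le (min_le_right _ _))
    · intro y hy
      obtain ⟨O, hO, η, hη, H⟩ := h.Lp hd (hd.FF hy)
      exact ⟨O, mem_nhdsWithin_of_mem_nhds hO, η, hη, H⟩
  obtain ⟨η, hη, hLF⟩ := hFη
  by_contra! hcon
  set r0 := min (R / 2) (η / 2) with hr0
  have hr0p : 0 < r0 := lt_min (half_pos hd.Rp) (half_pos hη)
  have hr : ∀ k : ℕ, 0 < r0 * (1 / ((k : ℝ) + 1)) := fun k => by positivity
  have hcon' : ∀ k : ℕ, ∃ n x s, 0 < s ∧ Rho g c x + 12 * s ≤ r0 * (1 / ((k : ℝ) + 1)) ∧ ¬ Good g c ε x s n ∧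
      ∀ m < n, ∀ x s, 0 < s → Rho g c x + 12 * s ≤ r0 * (1 / ((k : ℝ) + 1)) → Good g c ε x s m := by
    intro k
    have hex : ∃ n, ∃ x s, 0 < s ∧ Rho g c x + 12 * s ≤ r0 * (1 / ((k : ℝ) + 1)) ∧ ¬ Good g c ε x s n := hcon _ (hr k)
    obtain ⟨x, s, h1, h2, h3⟩ := Nat.find_spec hex
    refine ⟨_, x, s, h1, h2, h3, fun m hm x s h4 h5 => ?_⟩
    by_contra h6
    exact Nat.find_min hex hm ⟨x, s, h4, h5, h6⟩
  choose n x s hs hxs hbad hG using hcon'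
  unfold Good at hbad
  push Not at hbad
  choose V hV hVD hVS using hbad
  choose e he using fun k => not_small_ne (hVS k)
  have hle : ∀ k : ℕ, r0 * (1 / ((k : ℝ) + 1)) ≤ r0 := fun k => by
    refine mul_le_of_le_one_right hr0p.le ?_
    rw [div_le_one (by positivity)]; have : (0 : ℝ) ≤ k := by positivity
    linarith
  have htt : Tendsto (fun k : ℕ => r0 * (1 / ((k : ℝ) + 1))) atTop (𝓝 0) := by
    simpa using tendsto_one_div_add_atTop_nhds_zero_nat.const_mul r0
  have hxR : ∀ k, ‖x k‖ ≤ Rho g c (x k) := fun k => by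
    have : 0 ≤ infDist (x k) (c.κ ⁻¹' Ju g) := infDist_nonneg
    unfold Rho; linarith
  have hx0 : Tendsto x atTop (𝓝 0) := squeeze_zero_norm (fun k => by linarith [hxR k, hs k, hxs k]) htt
  have hs0 : Tendsto s atTop (𝓝 0) := squeeze_zero (fun k => (hs k).le) (fun k => by linarith [hxR k, hs k, hxs k, norm_nonneg (x k)]) htt
  have hDD : ∀ k, c.D (x k) (2 * s k) ⊆ c.D 0 R := fun k => c.D_mono (ball_subset_ball' (by
    rw [dist_zero_right]; have := min_le_left (R / 2) (η / 2); linarith [hxR k, hs k, hxs k, hle k, hd.Rp]))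
  have hF : ∀ k, ∀ q ≤ n k, ∀ y ∈ F, g^[q] y ∉ c.D (x k) (2 * s k) := fun k q hq y hy =>
    (hLF y hy).avoid h (hd.FF hy) (lt_of_le_of_lt (hle k) (by have := min_le_right (R / 2) (η / 2); linarith)) (hs k) (hxs k) (hG k) q hq
  have hc2 : ∀ k, ∀ m < n k, ∀ Y, IsPreconnected Y → g^[m] '' Y ⊆ c.D (x k) (2 * s k) → Small ε0 Y := fun k =>
    hd.claim2 h.hg ht ht2 hε (hs k) (hDD k) (fun m hm x' hx' => hG k m hm x' _ (by linarith [hs k]) (by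
      have := Rho_lip (g := g) (c := c) (x := x k) (y := x')
      rw [mem_ball] at hx'; linarith [hxs k, hs k])) (hF k)
  have hpl : ∀ k, Pl (g^[n k]) c (x k) (s k) N (V k) (connectedComponentIn (g^[n k] ⁻¹' c.D (x k) (2 * s k)) (e k)) := fun k => by
    refine mkPl (h.hg.iter _) (hs k) (hV k) (hVD k) (he k) ?_
    have hsub : connectedComponentIn (g^[n k] ⁻¹' c.D (x k) (2 * s k)) (e k) ⊆ g^[n k] ⁻¹' c.D (x k) (2 * s k) := connectedComponentIn_subset _ _
    refine hd.deg _ _ isPreconnected_connectedComponentIn ((image_subset_iff.2 hsub).trans (hDD k)) fun i hi1 hi => ?_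
    refine ⟨hc2 k (n k - i) (by omega) _ (isPreconnected_connectedComponentIn.image _ (h.hg.iter i).cont.continuousOn)
      (by rw [iter_img hi.le]; exact image_subset_iff.2 hsub), disjoint_left.2 ?_⟩
    rintro _ ⟨p, hp, rfl⟩ hpF
    refine hF k (n k - i) (by omega) _ hpF ?_
    rw [← Function.iterate_add_apply, Nat.sub_add_cancel hi.le]
    exact hsub hp
  have hnt : Tendsto n atTop atTop := by
    refine fixN_ev h.hg z hd.e0 hV hVS fun O hO => ?_
    obtain ⟨r, hr, hrO⟩ := c.D_basis (u := 0) (O := O) (by rw [h.cz]; exact hO)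
    filter_upwards [htt.eventually (gt_mem_nhds hr)] with k hk
    refine (hVD k).trans ((c.D_mono (ball_subset_ball' ?_)).trans hrO)
    rw [dist_zero_right]; linarith [hxR k, hs k, hxs k]
  obtain ⟨e0, φ, hφ, he0⟩ := CompactSpace.tendsto_subseq e
  by_cases he0J : e0 ∈ Ju g
  · obtain ⟨O, hO, hOJ, hfr⟩ := Tprime h.hg c N (fun k => hpl (φ k)) (fun k => he (φ k)) he0 (h.perfect he0J) hd.e0 (fun k => hVS (φ k))
    exact h.C4 hO hOJ (hnt.comp hφ.tendsto_atTop) (hx0.comp hφ.tendsto_atTop) (hs0.comp hφ.tendsto_atTop) hfr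
  · rw [not_Ju] at he0J
    obtain ⟨O, hO, η', hη', hL⟩ := h.Lp hd he0J
    obtain ⟨k, hk1, hk2, hk3⟩ := ((he0.eventually hO).and ((he0.eventually (Fa_open.mem_nhds he0J)).and ((htt.comp hφ.tendsto_atTop).eventually (gt_mem_nhds hη')))).exists
    refine LP.avoid h (y := e (φ k)) (hL _ hk1) hk2 hk3 (hs (φ k)) (hxs (φ k)) (hG (φ k)) (n (φ k)) le_rfl ?_
    exact c.D_mono (ball_subset_ball (by linarith [hs (φ k)])) (hVD (φ k) ⟨_, he _, rfl⟩)

lemma PC.absurd {g : CSphere → CSphere} {z : CSphere} {c : Cht} {lam : ℂ} (h : PC g z c lam) : False := by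
  obtain ⟨R, ε0, N, F, hDC⟩ := h.exists_DC
  obtain ⟨t, ht2, htf, ht⟩ := Metric.finite_approx_of_totallyBounded (s := ball (0 : ℂ) 2) ((isCompact_closedBall (0 : ℂ) 2).totallyBounded.subset ball_subset_closedBall) (1 / 4) (by norm_num)
  lift t to Finset ℂ using htf
  have hdis : Disjoint F (Ju g) := disjoint_left.2 fun x hx hJ => hJ (hDC.FF hx)
  obtain ⟨r1, hr1, hr1F⟩ := exists_pos_forall_lt_edist hDC.Fc Ju_closed hdis
  obtain ⟨δ, hδ, hδD⟩ := Metric.mem_nhds_iff.1 (show c.D 0 R ∈ 𝓝 z from h.cz ▸ c.D_nhds hDC.Rp)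
  set K : ℝ := ((t.card * N : ℕ) : ℝ) with hK
  have hK0 : 0 ≤ K := by positivity
  obtain ⟨ε, hε0, hε1, hε2, hε3⟩ : ∃ ε : ℝ, 0 < ε ∧ ε < r1 ∧ ε < δ ∧ (2 * K + 1) * ε ≤ ε0 := by
    have h1 : 0 < ε0 / (2 * K + 1) := by have := hDC.ep; positivity
    have h2 : 0 < min (r1 : ℝ) (min δ (ε0 / (2 * K + 1))) := lt_min hr1 (lt_min hδ h1)
    refine ⟨min (r1 : ℝ) (min δ (ε0 / (2 * K + 1))) / 2, by positivity, ?_, ?_, ?_⟩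
    · linarith [min_le_left (r1 : ℝ) (min δ (ε0 / (2 * K + 1)))]
    · linarith [min_le_right (r1 : ℝ) (min δ (ε0 / (2 * K + 1))), min_le_left δ (ε0 / (2 * K + 1))]
    · rw [mul_comm, ← le_div_iff₀ (by positivity)]
      linarith [min_le_right (r1 : ℝ) (min δ (ε0 / (2 * K + 1))), min_le_right δ (ε0 / (2 * K + 1))]
  have hKe : 0 ≤ K * ε := by positivity
  have hd : DE g c R ε0 N F ε := ⟨hDC, hε0, by nlinarith, fun x hx p hp => by
    have := hr1F x hx p hp
    rw [edist_nndist, ENNReal.coe_lt_coe] at this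
    have h2 : (r1 : ℝ) < dist x p := by rw [← coe_nndist]; exact_mod_cast this
    linarith⟩
  obtain ⟨r, hr, hgood⟩ := h.mainM hd ht (fun i hi => ht2 hi) (by nlinarith)
  have hJ0 : (0 : ℂ) ∈ c.κ ⁻¹' Ju g := by rw [mem_preimage, h.cz]; exact h.zJ
  set s := r / 12 with hs
  have hsp : 0 < s := by positivity
  have hG : ∀ n, Good g c ε 0 s n := fun n => hgood n 0 s hsp (by
    unfold Rho; rw [infDist_zero_of_mem hJ0, norm_zero, hs]; linarith)
  have hRp := hDC.Rp
  set c0 : ℝ := 1 ^ 2 * (s / 2) / (16 * (2 * R / (s / 2))) with hc0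
  have hc0p : 0 < c0 := by positivity
  have hmap : ∀ n, ∀ p ∈ c.D 0 c0, g^[n] p ∈ c.D 0 s := by
    intro n
    have hzD : g^[n] z ∈ c.D 0 s := by rw [h.fixn, ← h.cz]; exact c.κ_mem_D.2 (by simpa using hsp)
    set W := connectedComponentIn (g^[n] ⁻¹' c.D 0 s) z with hW
    have hzW : z ∈ W := mem_connectedComponentIn hzD
    have hWo : IsOpen W := ((c.D_open _ _).preimage (h.hg.iter n).cont).connectedComponentIn
    have hWD : W ⊆ g^[n] ⁻¹' c.D 0 s := connectedComponentIn_subset _ _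
    have hWi : ∀ i ≤ n, g^[i] '' W ⊆ c.D 0 R := by
      intro i hi p hp
      have := hG (n - i) (g^[i] '' W) (isPreconnected_connectedComponentIn.image _ (h.hg.iter i).cont.continuousOn)
        (by rw [iter_img hi]; exact image_subset_iff.2 hWD) p hp z ⟨z, hzW, h.fixn i⟩
      exact hδD (mem_ball.2 (by linarith))
    have hinj : ∀ i ≤ n, InjOn g^[i] W := by
      intro i
      induction i with
      | zero => intro _ a _ b _ e; exact e
      | succ i ih =>
        intro hi a ha b hb e
        rw [Function.iterate_succ_apply', Function.iterate_succ_apply'] at e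
        exact ih (by omega) ha hb (hDC.inj (hWi i (by omega) ⟨a, ha, rfl⟩) (hWi i (by omega) ⟨b, hb, rfl⟩) e)
    obtain ⟨χ, hχ, hχ0, hχW⟩ := section_ex (h.hg.iter n) c hsp (y := z) (w := 0) (by rw [h.fixn, h.cz])
      (fun x hx => ⟨W, hWo.mem_nhds hx, hinj n le_rfl⟩)
    have hχD : ∀ u ∈ ball (0 : ℂ) s, χ u ∈ c.D 0 R := fun u hu => hWi 0 (by omega) ⟨χ u, (hχW u hu).1, rfl⟩
    have hψ : ∀ u ∈ ball (0 : ℂ) s, AnalyticAt ℂ (fun u => c.τ (χ u)) u := fun u hu =>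
      sec_an (h.hg.iter n) c c hχ (fun u hu => (hχW u hu).2) hu (c.mem_D.1 (hχD u hu)).1
    have hψd : DifferentiableOn ℂ (fun u => c.τ (χ u)) (ball 0 s) := fun u hu => (hψ u hu).differentiableAt.differentiableWithinAt
    have hψb : ∀ u ∈ ball (0 : ℂ) s, ‖c.τ (χ u)‖ < R := fun u hu => by simpa using (c.mem_D.1 (hχD u hu)).2
    have hψ0 : c.τ (χ 0) = 0 := by rw [hχ0, h.τz]
    have hder : ‖deriv (fun u => c.τ (χ u)) 0‖ = 1 := by
      have h1 := (hψ 0 (mem_ball_self hsp)).differentiableAt.hasDerivAt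
      have h2 := h.dern n
      rw [← hψ0] at h2
      have h3 := HasDerivAt.comp (0 : ℂ) h2 h1
      have h4 : (fun u => c.τ (g^[n] (c.κ u))) ∘ (fun u => c.τ (χ u)) =ᶠ[𝓝 0] id := by
        filter_upwards [ball_mem_nhds (0 : ℂ) hsp] with u hu
        simp only [Function.comp, id]
        rw [c.κτ (c.mem_D.1 (hχD u hu)).1, (hχW u hu).2, c.τκ]
      have h5 := (h3.congr_of_eventuallyEq h4.symm).unique (hasDerivAt_id 0)
      have h6 := congrArg norm h5
      rw [norm_mul, norm_pow, h.nl, one_pow, one_mul, norm_one] at h6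
      exact h6
    have hcov := covers (f := fun u => c.τ (χ u)) (p := 0) (ρ := s / 2) (M := 2 * R / (s / 2)) (half_pos hsp)
      (hψd.mono (ball_subset_ball (by linarith))) (fun x hx => by
        have hsub : ball x (s / 2) ⊆ ball 0 s := ball_subset_ball' (by rw [mem_ball] at hx; linarith)
        refine Complex.norm_deriv_le_div_of_mapsTo_ball (hψd.mono hsub) (fun u hu => ?_) (half_pos hsp)
        rw [mem_closedBall, dist_eq_norm]
        have := norm_sub_le (c.τ (χ u)) (c.τ (χ x))
        have := hψb u (hsub hu)
        have := hψb x (hsub (mem_ball_self (half_pos hsp)))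
        linarith) (by rw [hder]; exact one_pos)
    rw [hder, hψ0, ← hc0] at hcov
    rintro _ ⟨u, hu, rfl⟩
    obtain ⟨v, hv, rfl⟩ := hcov hu
    have hv' : v ∈ ball (0 : ℂ) s := ball_subset_ball (by linarith) hv
    simp only
    rw [c.κτ (c.mem_D.1 (hχD v hv')).1, (hχW v hv').2]
    exact mem_image_of_mem _ hv'
  have hO : IsOpen (c.κ '' closedBall 0 s)ᶜ := ((isCompact_closedBall _ _).image c.κ_cont).isClosed.isOpen_compl
  have := sub_Fa h.hg (c.D_open 0 c0) hO ⟨c.pole, fun ⟨u, _, hu⟩ => c.κ_ne _ hu⟩ 0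
    (fun n _ p hp hpO => hpO (image_mono ball_subset_closedBall (hmap n p hp)))
  exact h.zJ (this (h.cz ▸ c.κ_mem_D.2 (by simpa using hc0p)))

end CSphere
end

noncomputable section
open Set Metric Topology Filter
namespace CSphere

lemma rsF_eq {G : Set (CSphere → CSphere)} : rsFatou G = interior {x | EquicontinuousAt (fun f : G => f.1) x} := by
  apply Subset.antisymm
  · rintro z ⟨r, hr, H⟩
    rw [mem_interior]
    refine ⟨ball z r, fun x hx => ?_, isOpen_ball, mem_ball_self hr⟩
    rw [mem_ofPred_eq, Metric.equicontinuousAt_iff_right]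
    intro ε hε
    obtain ⟨δ, hδ, H⟩ := H ε hε
    filter_upwards [isOpen_ball.mem_nhds hx, ball_mem_nhds x hδ] with w hw hw' f
    exact H f.1 f.2 x hx w hw (by rw [dist_comm]; exact hw')
  · intro z hz
    obtain ⟨r, hr, hs⟩ := Metric.isOpen_iff.1 isOpen_interior z hz
    refine ⟨r / 2, half_pos hr, fun ε hε => ?_⟩
    have hK : ∀ y ∈ closedBall z (r / 2), EquicontinuousAt (fun f : G => f.1) y := fun y hy =>
      interior_subset (hs (closedBall_subset_ball (half_lt_self hr) hy))
    have hK' : ∀ y ∈ closedBall z (r / 2), y ∈ interior {w | ∀ f : G, dist (f.1 y) (f.1 w) < ε / 2} := fun y hy =>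
      mem_interior_iff_mem_nhds.2 (Metric.equicontinuousAt_iff_right.1 (hK y hy) (ε / 2) (half_pos hε))
    obtain ⟨δ, hδ, H⟩ := lebesgue_number_lemma_of_metric (isCompact_closedBall z (r / 2)) 
      (c := fun y : CSphere => interior {w | ∀ f : G, dist (f.1 y) (f.1 w) < ε / 2}) (fun _ => isOpen_interior)
      (fun y hy => mem_iUnion.2 ⟨y, hK' y hy⟩)
    refine ⟨δ, hδ, fun f hf a ha b hb hab => ?_⟩
    obtain ⟨y, hy⟩ := H a (ball_subset_closedBall ha)
    have h1 := interior_subset (hy (mem_ball_self hδ)) ⟨f, hf⟩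
    have h2 := interior_subset (hy (show b ∈ ball a δ by rwa [mem_ball, dist_comm])) ⟨f, hf⟩
    have := dist_triangle_left (f a) (f b) (f y)
    simp only at h1 h2
    linarith

lemma rsF_fwd {G : Set (CSphere → CSphere)} (hG : ∀ a ∈ G, ∀ b ∈ G, a ∘ b ∈ G) {f : CSphere → CSphere} (hf : f ∈ G) (hH : Hol f)
    {x : CSphere} (hx : x ∈ rsFatou G) : f x ∈ rsFatou G := by
  rw [rsF_eq] at hx ⊢
  rw [mem_interior]
  refine ⟨f '' interior {x | EquicontinuousAt (fun f : G => f.1) x}, ?_, hH.isOpenMap _ isOpen_interior, ⟨x, hx, rfl⟩⟩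
  rintro _ ⟨y, hy, rfl⟩
  rw [mem_ofPred_eq, Metric.equicontinuousAt_iff_right]
  intro ε hε
  have h1 := Metric.equicontinuousAt_iff_right.1 (interior_subset hy) ε hε
  filter_upwards [hH.isOpenMap.image_mem_nhds h1]
  rintro _ ⟨w, hw, rfl⟩ k
  exact hw ⟨k.1 ∘ f, hG _ k.2 _ hf⟩

section words
variable {m : ℕ} (h : Fin m → CSphere → CSphere)

def compL : List (Fin m) → CSphere → CSphere
  | [] => id
  | j :: l => h j ∘ compL l

lemma compL_app (l l' : List (Fin m)) : compL h (l ++ l') = compL h l ∘ compL h l' := by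
  induction l with
  | nil => rfl
  | cons j l ih => simp only [List.cons_append, compL, ih]; rfl

lemma mem_gen {f : CSphere → CSphere} : f ∈ genFin h ↔ ∃ l, l ≠ [] ∧ f = compL h l := by
  have key : ∀ l : List (Fin m), compL h l = (l.map h).foldr (· ∘ ·) id := by
    intro l
    induction l with
    | nil => rfl
    | cons j l ih => simp only [compL, ih]; rfl
  constructor
  · rintro ⟨l, hl, hr, rfl⟩
    have : l ∈ range (List.map h) := by rw [Set.range_list_map]; exact hr
    obtain ⟨l', rfl⟩ := this
    exact ⟨l', by rintro rfl; exact hl rfl, (key l').symm⟩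
  · rintro ⟨l, hl, rfl⟩
    refine ⟨l.map h, by simpa using hl, by simp, key l⟩

lemma gen_comp : ∀ a ∈ genFin h, ∀ b ∈ genFin h, a ∘ b ∈ genFin h := by
  intro a ha b hb
  rw [mem_gen] at *
  obtain ⟨l, hl, rfl⟩ := ha
  obtain ⟨l', _, rfl⟩ := hb
  exact ⟨l ++ l', by simp [hl], (compL_app h l l').symm⟩

variable {h}
lemma hol_compL (hH : ∀ j, Hol (h j)) : ∀ l, Hol (compL h l)
  | [] => hol_id
  | j :: l => (hH j).comp (hol_compL hH l)

lemma J_bwd (hH : ∀ j, Hol (h j)) (l : List (Fin m)) {x : CSphere} (hx : compL h l x ∈ rsJulia (genFin h)) : x ∈ rsJulia (genFin h) := by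
  rcases eq_or_ne l [] with rfl | hl
  · exact hx
  · exact fun hF => hx (rsF_fwd (gen_comp h) ((mem_gen h).2 ⟨l, hl, rfl⟩) (hol_compL hH l) hF)

variable (h) in
def SG (p : CSphere) : Prop := ∃ N : ℕ, ∃ B, IsOpen B ∧ p ∈ B ∧
  ∀ l V, IsPreconnected V → compL h l '' V ⊆ B → ∀ w, (V ∩ compL h l ⁻¹' {w}).ncard ≤ N

lemma fib_fin {f : CSphere → CSphere} (hf : Hol f) (V : Set CSphere) (w : CSphere) : (V ∩ f ⁻¹' {w}).Finite :=
  (hf.finfib w).subset inter_subset_right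

lemma SG_iff (hH : ∀ j, Hol (h j)) {p : CSphere} : p ∉ rsUH (genFin h) ↔ SG h p := by
  simp only [rsUH, mem_compl_iff, not_not, mem_iUnion]
  constructor
  · rintro ⟨N, δ, hδ, H⟩
    refine ⟨max N 1, ball p δ, isOpen_ball, mem_ball_self hδ, fun l V hV hVB w => ?_⟩
    by_cases hl : l = []
    · subst hl
      refine le_trans ?_ (le_max_right _ _)
      refine (ncard_le_ncard (t := {w}) inter_subset_right (finite_singleton w)).trans (by simp)
    · refine le_trans ?_ (le_max_left _ _)
      rcases (V ∩ compL h l ⁻¹' {w}).eq_empty_or_nonempty with e | ⟨y, hy, hyw⟩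
      · rw [e]; simp
      · have hyB : y ∈ compL h l ⁻¹' ball p δ := hVB ⟨y, hy, rfl⟩
        have hyw' : compL h l y = w := hyw
        refine le_trans (ncard_le_ncard (inter_subset_inter_left _ ?_) (fib_fin (hol_compL hH l) _ _))
          (H _ ((mem_gen h).2 ⟨l, hl, rfl⟩) y hyB w (by rw [← hyw']; exact hyB))
        exact hV.subset_connectedComponentIn hy (image_subset_iff.1 hVB)
  · rintro ⟨N, B, hB, hp, H⟩
    obtain ⟨δ, hδ, hs⟩ := Metric.isOpen_iff.1 hB p hp
    refine ⟨N, δ, hδ, ?_⟩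
    intro f hf y hy w _
    obtain ⟨l, _, rfl⟩ := (mem_gen h).1 hf
    have hsub : connectedComponentIn (compL h l ⁻¹' ball p δ) y ⊆ compL h l ⁻¹' ball p δ := connectedComponentIn_subset _ _
    exact H l _ isPreconnected_connectedComponentIn ((image_subset_iff.2 hsub).trans hs) w

lemma pre_nbhd {f : CSphere → CSphere} (hf : Hol f) (p : CSphere) {B : CSphere → Set CSphere} (hB : ∀ a, f a = p → B a ∈ 𝓝 a) :
    ∃ O ∈ 𝓝 p, ∀ V, IsPreconnected V → f '' V ⊆ O → ∃ a, f a = p ∧ V ⊆ B a := by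
  have hε : ∃ ε > 0, ∀ a ∈ f ⁻¹' {p}, ball a ε ⊆ B a := by
    have : ∀ᶠ ε in 𝓝[>] (0:ℝ), ∀ a ∈ f ⁻¹' {p}, ball a ε ⊆ B a := by
      rw [Filter.eventually_all_finite (hf.finfib p)]
      intro a ha
      obtain ⟨r, hr, hs⟩ := Metric.mem_nhds_iff.1 (hB a ha)
      filter_upwards [Ioc_mem_nhdsGT hr] with ε he
      exact (ball_subset_ball he.2).trans hs
    obtain ⟨ε, h1, h2⟩ := (this.and self_mem_nhdsWithin).exists
    exact ⟨ε, h2, h1⟩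
  obtain ⟨ε, hε, hs⟩ := hε
  obtain ⟨O, hO, hp, H⟩ := fixN hf p hε
  refine ⟨O, hO.mem_nhds hp, fun V hV hVO => ?_⟩
  obtain ⟨a, ha, h1⟩ := H V hV hVO
  exact ⟨a, ha, h1.trans (hs a ha)⟩

end words
end CSphere
end

noncomputable section
open Set Metric Topology Filter
namespace CSphere
section words
variable {m : ℕ} {h : Fin m → CSphere → CSphere}

lemma SG_of (hH : ∀ j, Hol (h j)) {z : CSphere} {p : ℕ} (hp : 0 < p) {g : CSphere → CSphere}
    (hexp : ∃ Bz ∈ 𝓝 z, ∀ O ∈ 𝓝 z, ∃ O' ⊆ O, O' ∈ 𝓝 z ∧ ∀ V ⊆ Bz, g '' V ⊆ O' → V ⊆ O' ∧ InjOn g V)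
    (hpre : ∀ u : List (Fin m), u.length = p → ∀ a, compL h u a = z → SG h a ∨ (compL h u = g ∧ a = z)) : SG h z := by
  classical
  obtain ⟨Bz, hBz, hexp⟩ := hexp
  have hch : ∀ a, ∃ N : ℕ, ∃ B ∈ 𝓝 a, SG h a → ∀ l V, IsPreconnected V → compL h l '' V ⊆ B → ∀ w, (V ∩ compL h l ⁻¹' {w}).ncard ≤ N := by
    intro a
    by_cases ha : SG h a
    · obtain ⟨N, B, hB, haB, H⟩ := ha
      exact ⟨N, B, hB.mem_nhds haB, fun _ => H⟩
    · exact ⟨0, univ, univ_mem, fun h => absurd h ha⟩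
  choose N B hB hSG using hch
  have hd : ∀ u : List (Fin m), ∃ d : ℕ, ∀ w, (compL h u ⁻¹' {w}).ncard ≤ d := fun u => by
    obtain ⟨d, hd⟩ := (hol_compL hH u).fib; exact ⟨d, fun w => (hd w).2⟩
  choose d hd using hd
  have hM : ∀ u : List (Fin m), ∃ M : ℕ, d u ≤ M ∧ ∀ a, compL h u a = z → N a * d u ≤ M := fun u => by
    obtain ⟨M, hM⟩ := (((hol_compL hH u).finfib z).image fun a => N a * d u).bddAbove
    exact ⟨max (d u) M, le_max_left _ _, fun a ha => (hM ⟨a, ha, rfl⟩).trans (le_max_right _ _)⟩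
  choose M1 hM1 hM2 using hM
  obtain ⟨M, hM⟩ := ((List.finite_length_le (Fin m) p).image M1).bddAbove
  have hMu : ∀ u : List (Fin m), u.length ≤ p → M1 u ≤ M := fun u hu => hM ⟨u, hu, rfl⟩
  have hO : ∀ u : List (Fin m), ∃ O ∈ 𝓝 z, ∀ V, IsPreconnected V → compL h u '' V ⊆ O →
      ∃ a, compL h u a = z ∧ V ⊆ (if a = z then B a ∩ Bz else B a) := fun u => by
    refine pre_nbhd (hol_compL hH u) z (B := fun a => if a = z then B a ∩ Bz else B a) fun a _ => ?_
    split_ifs with e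
    · subst e; exact inter_mem (hB _) hBz
    · exact hB a
  choose O hO hOV using hO
  obtain ⟨O', hO'O, hO', hex⟩ := hexp (⋂ u ∈ {u : List (Fin m) | u.length = p}, O u)
    ((biInter_mem (List.finite_length_eq (Fin m) p)).2 fun u _ => hO u)
  have key : ∀ n, ∀ l : List (Fin m), l.length = n → ∀ V, IsPreconnected V → compL h l '' V ⊆ O' → ∀ w, (V ∩ compL h l ⁻¹' {w}).ncard ≤ M := by
    intro n
    induction n using Nat.strong_induction_on with
    | _ n ih =>
    intro l hl V hV hVO w
    by_cases hlp : l.length < p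
    · exact ((ncard_le_ncard inter_subset_right ((hol_compL hH l).finfib w)).trans (hd l w)).trans ((hM1 l).trans (hMu l hlp.le))
    push Not at hlp
    set u := l.take p with hu
    set l' := l.drop p with hl'
    have hul : u.length = p := by simp [hu, hlp]
    have hl'l : l'.length < n := by simp [hl']; omega
    have hlu : compL h l = compL h u ∘ compL h l' := by rw [← compL_app, List.take_append_drop]
    rw [hlu] at hVO ⊢
    rw [image_comp] at hVO
    have hW : IsPreconnected (compL h l' '' V) := hV.image _ (hol_compL hH l').cont.continuousOn
    obtain ⟨a, ha, hWa⟩ := hOV u _ hW (hVO.trans (hO'O.trans (biInter_subset_of_mem (show u ∈ {u : List (Fin m) | u.length = p} from hul))))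
    have hWB : compL h l' '' V ⊆ B a := by
      split_ifs at hWa with e
      · exact hWa.trans inter_subset_left
      · exact hWa
    rcases hpre u hul a ha with hs | ⟨hg, rfl⟩
    · refine le_trans ?_ ((hM2 u a ha).trans (hMu u hul.le))
      refine ncard_fib (φ := compL h l') (T := compL h u ⁻¹' {w}) (fib_fin ((hol_compL hH u).comp (hol_compL hH l')) _ _) ((hol_compL hH u).finfib w) (fun x hx => hx.2) (hd u w) fun w' => ?_
      exact (ncard_le_ncard (inter_subset_inter_left _ inter_subset_left) (fib_fin (hol_compL hH l') _ _)).trans (hSG a hs l' V hV hWB w')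
    · rw [if_pos rfl] at hWa
      rw [hg] at hVO
      obtain ⟨h1, h2⟩ := hex _ (hWa.trans inter_subset_right) hVO
      rcases (V ∩ (compL h u ∘ compL h l') ⁻¹' {w}).eq_empty_or_nonempty with e | ⟨x, hx, hxw⟩
      · rw [e]; simp
      · refine (ncard_le_ncard ?_ (fib_fin (hol_compL hH l') V (compL h l' x))).trans (ih _ hl'l l' rfl V hV h1 _)
        rintro y ⟨hy, hyw⟩
        refine ⟨hy, h2 ⟨y, hy, rfl⟩ ⟨x, hx, rfl⟩ ?_⟩
        rw [← hg]; exact hyw.trans hxw.symm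
  refine ⟨M, interior O', isOpen_interior, mem_interior_iff_mem_nhds.2 hO', fun l V hV hVO => key _ l rfl V hV (hVO.trans interior_subset)⟩

lemma SG_gen (hH : ∀ j, Hol (h j)) {z : CSphere} (hz : ∀ j a, h j a = z → SG h a) : SG h z := by
  refine SG_of hH one_pos (g := id) ⟨univ, univ_mem, fun O hO => ⟨O, Subset.rfl, hO, fun V _ hV => ⟨by simpa using hV, Function.injective_id.injOn⟩⟩⟩ fun u hu a ha => ?_
  obtain ⟨j, rfl⟩ := List.length_eq_one_iff.1 hu
  exact Or.inl (hz j a ha)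

lemma hexp_of {g : CSphere → CSphere} (hg : Hol g) {z : CSphere} (hz : g z = z) {c : Cht} (hc : c.κ 0 = z) {lam : ℂ}
    (hl : HasDerivAt (fun u => c.τ (g (c.κ u))) lam 0) (h1 : 1 < ‖lam‖) :
    ∃ Bz ∈ 𝓝 z, ∀ O ∈ 𝓝 z, ∃ O' ⊆ O, O' ∈ 𝓝 z ∧ ∀ V ⊆ Bz, g '' V ⊆ O' → V ⊆ O' ∧ InjOn g V := by
  have hne : g (c.κ 0) ≠ c.pole := by rw [hc, hz, ← hc]; exact c.κ_ne 0
  have h00 : c.τ (g (c.κ 0)) = 0 := by rw [hc, hz, ← hc]; simp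
  obtain ⟨O1, hO1, hinj⟩ := inj_chart c c hg hne (u := 0) (by rw [hl.deriv]; intro e; rw [e] at h1; simp at h1; linarith)
  have hev : ∀ᶠ u in 𝓝 (0:ℂ), ‖u‖ ≤ ‖c.τ (g (c.κ u))‖ := by
    have h2 := (hasDerivAt_iff_isLittleO.1 hl).def (c := ‖lam‖ - 1) (by linarith)
    filter_upwards [h2] with u hu
    rw [h00] at hu
    simp only [sub_zero, smul_eq_mul] at hu
    have h3 := norm_sub_norm_le (u * lam) (c.τ (g (c.κ u)))
    rw [norm_sub_rev, norm_mul] at h3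
    nlinarith [norm_nonneg u]
  obtain ⟨ρ, hρ, hball⟩ := Metric.mem_nhds_iff.1 hev
  refine ⟨c.D 0 ρ ∩ O1, inter_mem (hc ▸ c.D_nhds hρ) (hc ▸ hO1), fun O hO => ?_⟩
  obtain ⟨r, hr, hrO⟩ := c.D_basis (u := 0) (by rw [hc]; exact hO)
  refine ⟨c.D 0 r, hrO, hc ▸ c.D_nhds hr, fun V hV hgV => ⟨fun x hx => ?_, hinj.mono (hV.trans inter_subset_right)⟩⟩
  obtain ⟨u, hu, rfl⟩ := (hV hx).1
  have h2 := hball hu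
  obtain ⟨_, h3⟩ := c.mem_D.1 (hgV ⟨_, hx, rfl⟩)
  apply c.κ_mem_D.2
  rw [sub_zero] at *
  exact lt_of_le_of_lt h2 h3

lemma attr_Fa {g : CSphere → CSphere} (hg : Hol g) {z : CSphere} (hz : g z = z) {c : Cht} (hc : c.κ 0 = z) {lam : ℂ}
    (hl : HasDerivAt (fun u => c.τ (g (c.κ u))) lam 0) (h1 : ‖lam‖ < 1) : z ∈ Fa g := by
  have hne : g (c.κ 0) ≠ c.pole := by rw [hc, hz, ← hc]; exact c.κ_ne 0
  have h00 : c.τ (g (c.κ 0)) = 0 := by rw [hc, hz, ← hc]; simp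
  have hev : ∀ᶠ u in 𝓝 (0:ℂ), ‖c.τ (g (c.κ u))‖ ≤ ‖u‖ ∧ g (c.κ u) ≠ c.pole := by
    have h2 := (hasDerivAt_iff_isLittleO.1 hl).def (c := 1 - ‖lam‖) (by linarith)
    filter_upwards [h2, (hg.cont.comp c.κ_cont).continuousAt.eventually_ne hne] with u hu hu'
    refine ⟨?_, hu'⟩
    rw [h00] at hu
    simp only [sub_zero, smul_eq_mul] at hu
    have h3 := norm_sub_norm_le (c.τ (g (c.κ u))) (u * lam)
    rw [norm_mul] at h3
    nlinarith [norm_nonneg u]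
  obtain ⟨ρ, hρ, hball⟩ := Metric.mem_nhds_iff.1 hev
  have hstep : ∀ x ∈ c.D 0 ρ, g x ∈ c.D 0 ρ := by
    rintro _ ⟨u, hu, rfl⟩
    obtain ⟨h2, h3⟩ := hball hu
    rw [c.mem_D]; refine ⟨h3, ?_⟩
    rw [sub_zero]; rw [mem_ball_zero_iff] at hu
    exact h2.trans_lt hu
  have hit : ∀ n : ℕ, ∀ x ∈ c.D 0 ρ, g^[n] x ∈ c.D 0 ρ := by
    intro n
    induction n with
    | zero => exact fun x hx => hx
    | succ n ih => intro x hx; rw [Function.iterate_succ_apply]; exact ih _ (hstep x hx)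
  -- the disc misses a neighbourhood of the pole
  have hcl : c.D 0 ρ ⊆ c.κ '' closedBall 0 ρ := image_mono ball_subset_closedBall
  have hcpt : IsClosed (c.κ '' closedBall 0 ρ) := ((isCompact_closedBall _ _).image c.κ_cont).isClosed
  refine sub_Fa hg (c.D_open 0 ρ) hcpt.isOpen_compl ⟨c.pole, ?_⟩ 0 (fun n _ x hx hn => hn (hcl (hit n x hx))) (mem_of_mem_nhds (hc ▸ c.D_nhds hρ))
  rintro ⟨u, _, hu⟩; exact c.κ_ne u hu

lemma chart_deriv (z : CSphere) : ∃ c : Cht, c.κ 0 = z ∧ ∀ g : CSphere → CSphere, Hol g → g z = z → ∀ d,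
    HasDerivAt (fun u => c.τ (g (c.κ u))) d 0 → derivFixEq g z d := by
  rcases cases' z with rfl | ⟨w, rfl⟩
  · have hk : (⟨sphInv, sphInv, hol_sphInv, hol_sphInv, sphInv_sphInv, sphInv_sphInv⟩ : Cht).κ 0 = infty := by simp [Cht.κ]
    refine ⟨_, hk, fun g hg hz d hd => Or.inr ⟨rfl, _, ?_, hd⟩⟩
    have hne : g (sphInv (ofC 0)) ≠ ofC 0 := by rw [sphInv_zero, hz]; exact (ofC_ne 0).symm
    filter_upwards [((hg.cont.comp hol_sphInv.cont).comp cont_ofC).continuousAt.eventually_ne hne] with u hu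
    simp only [Cht.τ, Cht.κ]
    apply ofC_toC
    intro e
    apply hu
    have := congrArg sphInv e
    rwa [sphInv_sphInv, sphInv_infty] at this
  · have hl : ∀ a : ℂ, ∀ x, trans (-a) (trans a x) = x := fun a x => by rcases cases' x with rfl | ⟨v, rfl⟩ <;> simp
    have hr : ∀ a : ℂ, ∀ x, trans a (trans (-a) x) = x := fun a x => by rcases cases' x with rfl | ⟨v, rfl⟩ <;> simp
    have hk : (⟨trans w, trans (-w), hol_trans _, hol_trans _, fun x => by simp [hl, hr], fun x => by simp [hl, hr]⟩ : Cht).κ 0 = ofC w := by simp [Cht.κ]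
    refine ⟨_, hk, fun g hg hz d hd => Or.inl ⟨w, rfl, fun v => toC (trans (-w) (g (trans w (ofC (v - w))))) + w, ?_, ?_⟩⟩
    · have hne : g (ofC w) ≠ infty := by rw [hz]; exact ofC_ne w
      filter_upwards [(hg.cont.comp cont_ofC).continuousAt.eventually_ne hne] with v hv
      rw [trans_ofC, sub_add_cancel]
      rcases cases' (g (ofC v)) with e | ⟨y, e⟩
      · exact absurd e hv
      · rw [e, trans_ofC, toC_ofC, neg_add_cancel_right]
    · have hd' : HasDerivAt (fun u => toC (trans (-w) (g (trans w (ofC u))))) d (w - w) := by rw [sub_self]; exact hd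
      exact (hd'.comp_sub_const w w).add_const w
end words
end CSphere
end

noncomputable section
open Set Metric Topology Filter
namespace CSphere
section words
variable {m : ℕ} {h : Fin m → CSphere → CSphere}

lemma osc_eq {U : Set CSphere} (ho : OpenSetCond h U) {i j : Fin m} {x : CSphere} (hi : h i x ∈ U) (hj : h j x ∈ U) : i = j := by
  by_contra hne
  exact disjoint_left.1 (ho.2.2.2 hne) hi hj

/-- the cyclic structure on the finite set of bad points -/
structure Cyc (h : Fin m → CSphere → CSphere) (U A : Set CSphere) (jj : CSphere → Fin m) (s : CSphere → CSphere) : Prop where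
  o : OpenSetCond h U
  AU : A ⊆ U
  fin : A.Finite
  sj : ∀ a, s a = h (jj a) a
  sA : ∀ a ∈ A, s a ∈ A
  inj : InjOn s A

lemma exists_cyc {U A : Set CSphere} (ho : OpenSetCond h U) (hAU : A ⊆ U) (hf : A.Finite) (hne : A.Nonempty)
    (hp : ∀ z ∈ A, ∃ j, ∃ a ∈ A, h j a = z) : ∃ jj s, Cyc h U A jj s := by
  classical
  obtain ⟨z0, hz0⟩ := hne
  have hj0 : Nonempty (Fin m) := (hp z0 hz0).nonempty
  have : ∀ z, ∃ a, z ∈ A → a ∈ A ∧ ∃ j, h j a = z := fun z => by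
    by_cases hz : z ∈ A
    · obtain ⟨j, a, ha, e⟩ := hp z hz; exact ⟨a, fun _ => ⟨ha, j, e⟩⟩
    · exact ⟨z, fun h => absurd h hz⟩
  choose pr hpr using this
  have hinj : InjOn pr A := by
    intro x hx y hy e
    obtain ⟨_, j, hj⟩ := hpr x hx
    obtain ⟨_, k, hk⟩ := hpr y hy
    rw [e] at hj
    have : j = k := osc_eq ho (x := pr y) (by rw [hj]; exact hAU hx) (by rw [hk]; exact hAU hy)
    rw [this] at hj; exact hj.symm.trans hk
  have hmaps : MapsTo pr A A := fun x hx => (hpr x hx).1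
  have hsurj : SurjOn pr A A := by
    have := Finset.surjOn_of_injOn_of_card_le (s := hf.toFinset) (t := hf.toFinset) pr (by simpa using hmaps) (by simpa using hinj) le_rfl
    simpa using this
  have hj : ∀ a, ∃ j, a ∈ A → h j a ∈ A := fun a => by
    by_cases ha : a ∈ A
    · obtain ⟨z, hz, e⟩ := hsurj ha
      obtain ⟨_, j, hj⟩ := hpr z hz
      exact ⟨j, fun _ => by rw [← e, hj]; exact hz⟩
    · exact ⟨Classical.arbitrary _, fun h => absurd h ha⟩
  choose jj hjj using hj
  have hnx : ∀ z ∈ A, h (jj (pr z)) (pr z) = z := fun z hz => by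
    obtain ⟨h1, j, hj⟩ := hpr z hz
    have : j = jj (pr z) := osc_eq ho (x := pr z) (by rw [hj]; exact hAU hz) (hAU (hjj _ h1))
    rw [← this, hj]
  refine ⟨jj, fun a => h (jj a) a, ho, hAU, hf, fun a => rfl, hjj, fun a ha b hb e => ?_⟩
  obtain ⟨x, hx, rfl⟩ := hsurj ha
  obtain ⟨y, hy, rfl⟩ := hsurj hb
  simp only [hnx x hx, hnx y hy] at e
  rw [e]

def wd (jj : CSphere → Fin m) (s : CSphere → CSphere) : ℕ → CSphere → List (Fin m)
  | 0, _ => []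
  | n + 1, a => jj (s^[n] a) :: wd jj s n a

variable {U A : Set CSphere} {jj : CSphere → Fin m} {s : CSphere → CSphere}

lemma wd_len (n : ℕ) (a : CSphere) : (wd jj s n a).length = n := by
  induction n with
  | zero => rfl
  | succ n ih => simp [wd, ih]

lemma Cyc.wd_app (C : Cyc h U A jj s) (n : ℕ) (a : CSphere) : compL h (wd jj s n a) a = s^[n] a := by
  induction n with
  | zero => rfl
  | succ n ih => rw [Function.iterate_succ_apply', C.sj, ← ih]; simp only [wd, compL, Function.comp, ih]

lemma Cyc.itA (C : Cyc h U A jj s) (n : ℕ) {a : CSphere} (ha : a ∈ A) : s^[n] a ∈ A := by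
  induction n with
  | zero => exact ha
  | succ n ih => rw [Function.iterate_succ_apply']; exact C.sA _ ih

lemma Cyc.eq_wd (C : Cyc h U A jj s) {a : CSphere} {x : CSphere} (hx : ∀ n, compL h (wd jj s n a) x ∈ U) :
    ∀ l, compL h l x ∈ U → l = wd jj s l.length a := by
  intro l
  induction l with
  | nil => intro _; rfl
  | cons j l ih =>
    intro hl
    have h1 := ih (C.o.2.2.1 j hl)
    have h2 := hx (l.length + 1)
    simp only [wd, ← h1, compL] at h2
    simp only [List.length_cons, wd, ← h1]
    rw [osc_eq C.o hl h2]

lemma Cyc.uniq (C : Cyc h U A jj s) {a : CSphere} (ha : a ∈ A) {l : List (Fin m)} (hl : compL h l a ∈ U) :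
    l = wd jj s l.length a := C.eq_wd (fun n => by rw [C.wd_app]; exact C.AU (C.itA n ha)) l hl

def rep (k : ℕ) (u : List (Fin m)) : List (Fin m) := (List.replicate k u).flatten
lemma rep_len (k : ℕ) (u : List (Fin m)) : (rep k u).length = k * u.length := by simp [rep]
lemma rep_comp (k : ℕ) (u : List (Fin m)) : compL h (rep k u) = (compL h u)^[k] := by
  induction k with
  | zero => rfl
  | succ n ih =>
    have : rep (n + 1) u = u ++ rep n u := by simp [rep, List.replicate_succ]
    rw [this, compL_app, ih, Function.iterate_succ']

/-- the return word -/
structure Ret (h : Fin m → CSphere → CSphere) (A U : Set CSphere) (z : CSphere) (p : ℕ) (u : List (Fin m)) : Prop where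
  pp : 0 < p
  len : u.length = p
  fix : compL h u z = z
  inj : ∀ l : List (Fin m), l.length = p → ∀ a ∈ A, compL h l a = z → l = u ∧ a = z
  stab : ∀ l : List (Fin m), compL h l z = z → ∃ k, l = rep k u

lemma Cyc.period (C : Cyc h U A jj s) {z : CSphere} (hz : z ∈ A) : ∃ p, 0 < p ∧ s^[p] z = z ∧ ∀ n, s^[n] z = z → p ∣ n := by
  refine ⟨Function.minimalPeriod s z, ?_, Function.iterate_minimalPeriod, fun n hn => Function.IsPeriodicPt.minimalPeriod_dvd hn⟩
  apply Function.minimalPeriod_pos_of_mem_periodicPts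
  obtain ⟨i, -, j, -, hij, e⟩ := infinite_univ.exists_lt_map_eq_of_mapsTo (f := fun n : ℕ => s^[n] z) (t := A) (fun n _ => C.itA n hz) C.fin
  have key : ∀ i k, s^[i] (s^[k] z) = s^[i] z → s^[k] z = z := by
    intro i k
    induction i with
    | zero => exact id
    | succ i ih =>
      intro e
      rw [Function.iterate_succ_apply', Function.iterate_succ_apply'] at e
      exact ih (C.inj (C.itA _ (C.itA _ hz)) (C.itA _ hz) e)
  refine ⟨j - i, by omega, key i _ ?_⟩
  rw [← Function.iterate_add_apply, Nat.add_sub_of_le hij.le]; exact e.symm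

lemma Cyc.ret (C : Cyc h U A jj s) {z : CSphere} (hz : z ∈ A) : ∃ p, Ret h A U z p (wd jj s p z) := by
  obtain ⟨p, hp, hfix, hdiv⟩ := C.period hz
  have hitinj : ∀ i, ∀ a ∈ A, ∀ b ∈ A, s^[i] a = s^[i] b → a = b := by
    intro i
    induction i with
    | zero => exact fun a _ b _ e => e
    | succ i ih =>
      intro a ha b hb e
      rw [Function.iterate_succ_apply', Function.iterate_succ_apply'] at e
      exact ih a ha b hb (C.inj (C.itA _ ha) (C.itA _ hb) e)
  have hfz : compL h (wd jj s p z) z = z := by rw [C.wd_app, hfix]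
  refine ⟨p, hp, wd_len _ _, hfz, fun l hl a ha e => ?_, fun l hl => ?_⟩
  · have h1 := C.uniq ha (l := l) (by rw [e]; exact C.AU hz)
    rw [hl] at h1
    have h2 : s^[p] a = s^[p] z := by rw [hfix, ← e]; conv_rhs => rw [h1]
                                      exact (C.wd_app p a).symm
    have h3 := hitinj p a ha z hz h2
    subst h3; exact ⟨h1, rfl⟩
  · have h1 := C.uniq hz (l := l) (by rw [hl]; exact C.AU hz)
    have h2 : s^[l.length] z = z := by rw [← C.wd_app, ← h1, hl]
    obtain ⟨k, hk⟩ := hdiv _ h2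
    refine ⟨k, ?_⟩
    have h3 := C.uniq hz (l := rep k (wd jj s p z)) (by rw [rep_comp, Function.iterate_fixed hfz]; exact C.AU hz)
    rw [rep_len, wd_len, mul_comm, ← hk, ← h1] at h3
    exact h3.symm

lemma Cyc.split (C : Cyc h U A jj s) {z : CSphere} (hz : z ∈ A) {p : ℕ} (hr : Ret h A U z p (wd jj s p z)) (n : ℕ) :
    wd jj s n z = wd jj s (n % p) z ++ rep (n / p) (wd jj s p z) := by
  have h3 := C.uniq hz (l := wd jj s (n % p) z ++ rep (n / p) (wd jj s p z))
    (by rw [compL_app, rep_comp, Function.comp, Function.iterate_fixed hr.fix, C.wd_app]; exact C.AU (C.itA _ hz))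
  rw [List.length_append, rep_len, wd_len, wd_len, mul_comm, Nat.mod_add_div] at h3
  exact h3.symm

lemma Cyc.inFa (C : Cyc h U A jj s) (hH : ∀ j, Hol (h j)) {z : CSphere} (hz : z ∈ A) {p : ℕ} (hr : Ret h A U z p (wd jj s p z))
    (hF : z ∈ Fa (compL h (wd jj s p z))) : z ∈ rsFatou (genFin h) := by
  classical
  set g := compL h (wd jj s p z) with hg
  have hO : ∀ᶠ y in 𝓝 z, ∀ r ∈ Finset.range p, compL h (wd jj s r z) y ∈ U := by
    rw [Filter.eventually_all_finset]
    intro r _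
    exact (hol_compL hH _).cont.continuousAt.preimage_mem_nhds (C.o.2.1.mem_nhds (by rw [C.wd_app]; exact C.AU (C.itA _ hz)))
  obtain ⟨ε, hε, hball⟩ := Metric.mem_nhds_iff.1 hO
  have hD := Metric.equicontinuousAt_iff_right.1 (Fa_eq hF) ε hε
  obtain ⟨D, hDs, hDo, hzD⟩ := _root_.mem_nhds_iff.1 hD
  have hDU : ∀ x ∈ D, ∀ n, compL h (wd jj s n z) x ∈ U := by
    intro x hx n
    rw [C.split hz hr, compL_app, rep_comp]
    have h1 := hDs hx (n / p)
    rw [Function.iterate_fixed hr.fix, dist_comm] at h1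
    exact hball h1 (n % p) (Finset.mem_range.2 (Nat.mod_lt _ hr.pp))
  rw [rsF_eq, mem_interior]
  refine ⟨D ∩ Fa g, fun x hx => ?_, hDo.inter Fa_open, hzD, hF⟩
  have hm := montel (F := fun l : {l : List (Fin m) // ∀ x ∈ D, compL h l x ∉ U} => compL h l.1) (fun l => hol_compL hH _) hDo C.o.2.1 C.o.1
    (fun l => l.2) hx.1
  rw [mem_ofPred_eq, Metric.equicontinuousAt_iff_right]
  rw [Metric.equicontinuousAt_iff_right] at hm
  intro e he
  have huc : ∃ δ > 0, ∀ r ∈ Finset.range p, ∀ a b, dist a b < δ → dist (compL h (wd jj s r z) a) (compL h (wd jj s r z) b) < e := by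
    have : ∀ᶠ δ in 𝓝[>] (0:ℝ), ∀ r ∈ Finset.range p, ∀ a b, dist a b < δ → dist (compL h (wd jj s r z) a) (compL h (wd jj s r z) b) < e := by
      rw [Filter.eventually_all_finset]
      intro r _
      obtain ⟨δ, hδ, H⟩ := Metric.uniformContinuous_iff.1 (CompactSpace.uniformContinuous_of_continuous (hol_compL hH (wd jj s r z)).cont) e he
      filter_upwards [Ioc_mem_nhdsGT hδ] with δ' h' a b hab
      exact H (hab.trans_le h'.2)
    obtain ⟨δ, h1, h2⟩ := (this.and self_mem_nhdsWithin).exists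
    exact ⟨δ, h2, h1⟩
  obtain ⟨δ, hδ, huc⟩ := huc
  filter_upwards [hm e he, Metric.equicontinuousAt_iff_right.1 (Fa_eq hx.2) δ hδ] with y hy1 hy2
  rintro ⟨f, hf⟩
  obtain ⟨l, _, rfl⟩ := (mem_gen h).1 hf
  by_cases hl : ∀ x ∈ D, compL h l x ∉ U
  · exact hy1 ⟨l, hl⟩
  · push Not at hl
    obtain ⟨q, hq, hqU⟩ := hl
    have h1 := C.eq_wd (hDU q hq) l hqU
    rw [C.split hz hr] at h1
    change dist (compL h l x) (compL h l y) < e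
    rw [h1]
    simp only [compL_app, rep_comp]
    exact huc _ (Finset.mem_range.2 (Nat.mod_lt _ hr.pp)) _ _ (hy2 _)

lemma SG.sht {u : List (Fin m)} {p : CSphere} (hs : SG h p) : SHt (compL h u) p := by
  obtain ⟨N, B, hB, hp, H⟩ := hs
  refine ⟨N, B, hB, hp, fun n V hV hVB w => ?_⟩
  rw [← rep_comp] at hVB ⊢
  exact H _ V hV hVB w

lemma Ju_sub (hH : ∀ j, Hol (h j)) {u : List (Fin m)} (hu : u ≠ []) : Ju (compL h u) ⊆ rsJulia (genFin h) := by
  intro x hx hF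
  refine hx ?_
  rw [rsF_eq] at hF
  refine interior_mono (fun y hy => ?_) hF
  refine eq_of_tail (hol_compL hH u).cont (N := 1) ?_
  have hmem : ∀ n : ℕ, (compL h u)^[n + 1] ∈ genFin h := fun n => (mem_gen h).2 ⟨rep (n + 1) u, fun e => by
    have := congrArg List.length e
    rw [rep_len] at this
    simp [hu] at this, (rep_comp _ _).symm⟩
  exact EquicontinuousAt.comp hy (fun n : ℕ => (⟨_, hmem n⟩ : genFin h))

theorem core_main (hrat : ∀ j, IsNonconstRatMap (h j)) (hosc : OpenSetCond h U)
    (hfin : (rsUH (genFin h) ∩ rsJulia (genFin h)).Finite) (hsub : rsUH (genFin h) ∩ rsJulia (genFin h) ⊆ U)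
    {z : CSphere} (hz : z ∈ rsUH (genFin h) ∩ rsJulia (genFin h)) :
      ∃ gz ∈ genFin h, IsParabolicFixPt gz z ∧ {β ∈ genFin h | β z = z} = {β | ∃ n : ℕ, 0 < n ∧ β = gz^[n]} := by
  have hH : ∀ j, Hol (h j) := fun j => (hrat j).hol
  set A := rsUH (genFin h) ∩ rsJulia (genFin h) with hA
  have hSG : ∀ p ∈ rsJulia (genFin h), p ∉ A → SG h p := fun p hp hpA => (SG_iff hH).1 fun hu => hpA ⟨hu, hp⟩
  have hnSG : ∀ p ∈ A, ¬ SG h p := fun p hp hs => (SG_iff hH).2 hs hp.1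
  obtain ⟨jj, s, C⟩ := exists_cyc hosc hsub hfin ⟨z, hz⟩ fun y hy => by
    by_contra! hcon
    refine hnSG y hy (SG_gen hH fun j a e => hSG a (J_bwd hH [j] (x := a) ?_) fun ha => hcon j a ha e)
    change h j a ∈ _; rw [e]; exact hy.2
  obtain ⟨p, hr⟩ := C.ret hz
  set u := wd jj s p z with hu
  have hune : u ≠ [] := fun e => by have := hr.len; rw [e] at this; exact hr.pp.ne this
  have hg := hol_compL hH u
  have hzJ : z ∈ Ju (compL h u) := fun hF => hz.2 (C.inFa hH hz hr hF)
  refine ⟨compL h u, (mem_gen h).2 ⟨u, hune, rfl⟩, ⟨hr.fix, ?_⟩, ?_⟩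
  · obtain ⟨c, hc, hcd⟩ := chart_deriv z
    have hne : compL h u (c.κ 0) ≠ c.pole := by rw [hc, hr.fix, ← hc]; exact c.κ_ne 0
    have hder := (hg.anc c c hne).differentiableAt.hasDerivAt
    set lam := deriv (fun v => c.τ (compL h u (c.κ v))) 0 with hlam
    refine ⟨lam, hcd _ hg hr.fix _ hder, ?_⟩
    by_contra! hnr
    have hpreA : ∀ l : List (Fin m), l.length = p → ∀ a, compL h l a = z → SG h a ∨ (compL h l = compL h u ∧ a = z) := by
      intro l hl a ha
      by_cases haA : a ∈ A
      · obtain ⟨h1, h2⟩ := hr.inj l hl a haA ha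
        exact Or.inr ⟨by rw [h1], h2⟩
      · exact Or.inl (hSG a (J_bwd hH l (by rw [ha]; exact hz.2)) haA)
    rcases lt_trichotomy ‖lam‖ 1 with h1 | h1 | h1
    · exact hzJ (attr_Fa hg hr.fix hc hder h1)
    · refine PC.absurd (g := compL h u) (z := z) (c := c) (lam := lam) ⟨hg, hc, hr.fix, hder, h1, hnr, hzJ, ⟨(A \ {z})ᶜ, ?_, fun q hq hqJ hqz => ?_⟩, fun a ha haz => ?_⟩
      · exact (hfin.subset sdiff_subset).isClosed.isOpen_compl.mem_nhds fun h => h.2 rfl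
      · exact (hSG q (Ju_sub hH hune hqJ) fun hqA => hq ⟨hqA, hqz⟩).sht
      · rcases hpreA u hr.len a ha with h2 | h2
        · exact h2.sht
        · exact absurd h2.2 haz
    · exact hnSG z hz (SG_of hH hr.pp (hexp_of hg hr.fix hc hder h1) hpreA)
  · ext β
    constructor
    · rintro ⟨hβ, hβz⟩
      obtain ⟨l, hl, rfl⟩ := (mem_gen h).1 hβ
      obtain ⟨k, rfl⟩ := hr.stab l hβz
      refine ⟨k, Nat.pos_of_ne_zero ?_, rep_comp _ _⟩
      rintro rfl; exact hl rfl
    · rintro ⟨n, hn, rfl⟩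
      refine ⟨(mem_gen h).2 ⟨rep n u, fun e => ?_, (rep_comp _ _).symm⟩, Function.iterate_fixed hr.fix n⟩
      have := congrArg List.length e
      rw [rep_len] at this
      simp [hune, hn.ne'] at this
end words
end CSphere
end

/-- **Lemma (Sumi, Lem 2.29)**.
Let `G = ⟨h₁, …, h_m⟩` be a rational semigroup satisfying the open set
condition with an open set `U`, with `UH(G) ∩ J(G)` finite and contained in
`U`, and assume either `m ≥ 2` and `G` contains an element of degree at least
two, or `m = 1` and `J(G) ≠ ℂ̂`.  If `UH(G) ∩ J(G) ≠ ∅`, then every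
`z ∈ UH(G) ∩ J(G)` is a parabolic fixed point of some element of `G`, and the
stabilizer `{β ∈ G | β(z) = z}` equals `{g_z^n | n ∈ ℕ}` for some `g_z ∈ G`
having `z` as a parabolic fixed point. -/
theorem parabolic_structure_of_non_semihyperbolic_points
    {m : ℕ} (hm : 0 < m) (h : Fin m → CSphere → CSphere)
    (hrat : ∀ j, CSphere.IsNonconstRatMap (h j))
    (U : Set CSphere) (hosc : OpenSetCond h U)
    (hfin : (rsUH (genFin h) ∩ rsJulia (genFin h)).Finite)
    (hsub : rsUH (genFin h) ∩ rsJulia (genFin h) ⊆ U)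
    (halt : (2 ≤ m ∧ ∃ gm ∈ genFin h, CSphere.IsRatMapDegGeTwo gm) ∨
      (m = 1 ∧ rsJulia (genFin h) ≠ Set.univ))
    (hne : (rsUH (genFin h) ∩ rsJulia (genFin h)).Nonempty) :
    ∀ z ∈ rsUH (genFin h) ∩ rsJulia (genFin h),
      (∃ hm' ∈ genFin h, IsParabolicFixPt hm' z) ∧
      ∃ gz ∈ genFin h, IsParabolicFixPt gz z ∧
        {β ∈ genFin h | β z = z} = {β | ∃ n : ℕ, 0 < n ∧ β = gz^[n]} := by
  intro z hz
  obtain ⟨g, hg, hp, hs⟩ := CSphere.core_main hrat hosc hfin hsub hz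
  exact ⟨⟨g, hg, hp⟩, g, hg, hp, hs⟩
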